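/- arXiv:math/0405464 — 3 statements merged into one kernel-verified Lean document; each statement's English description precedes it below -/
import Mathlib

section
/- Let k be an algebraically closed field of characteristic p ≥ 3. Let F ∈ k[X,Y,Z] be a homogeneous polynomial of degree 3 such that the only common zero in k³ of F and its partial derivatives ∂F/∂X, ∂F/∂Y, ∂F/∂Z is (0,0,0), and set R = k[X,Y,Z]/(F). Then for every e ≥ 0, writing q = p^e, the Hilbert–Kunz function of the maximal ideal (X,Y,Z) satisfies 4 · dim_k( k[X,Y,Z]/(F, X^q, Y^q, Z^q) ) = 9q² − 5; that is, φ(q) = (9/4)q² − 5/4. -/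
section WronskianDescent

open Polynomial

variable {k : Type*} [Field k]

theorem natDegree_wronskian_add_two_le {a b : k[X]} {d : ℕ} (ha : a.natDegree ≤ d)
    (hb : b.natDegree ≤ d) (hw : wronskian a b ≠ 0) : (wronskian a b).natDegree + 2 ≤ 2 * d := by
  by_cases hlt : a.natDegree + b.natDegree < 2 * d
  · have := natDegree_wronskian_lt_add hw
    omega
  have had : a.natDegree = d := by omega
  have hbd : b.natDegree = d := by omega
  have ha0 : a ≠ 0 := by
    rintro rfl
    simp at hw
  have hb0 : b ≠ 0 := by
    rintro rfl
    simp at hw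
  set t : k := b.leadingCoeff / a.leadingCoeff with ht
  have ht0 : t ≠ 0 := div_ne_zero (leadingCoeff_ne_zero.2 hb0) (leadingCoeff_ne_zero.2 ha0)
  have hwr : wronskian a (b - C t * a) = wronskian a b := by
    simp only [wronskian, derivative_sub, derivative_mul, derivative_C]
    ring
  have hc0 : b - C t * a ≠ 0 := by
    intro h
    rw [h] at hwr
    simp at hwr
    exact hw hwr.symm
  have hdeg : (b - C t * a).natDegree < d := by
    rw [← hbd]
    refine natDegree_lt_natDegree hc0 (degree_sub_lt_left ?_ hb0 ?_)
    · rw [degree_C_mul ht0, degree_eq_natDegree ha0, degree_eq_natDegree hb0, had, hbd]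
    · rw [leadingCoeff_mul, leadingCoeff_C, ht, div_mul_cancel₀ _ (leadingCoeff_ne_zero.2 ha0)]
  have := natDegree_wronskian_lt_add (hwr ▸ hw)
  rw [hwr] at this
  omega

theorem exists_eq_pow_of_derivative_eq_zero (p : ℕ) [Fact p.Prime] [CharP k p] [PerfectField k]
    {f : k[X]} (hf : derivative f = 0) : ∃ g : k[X], f = g ^ p := by
  have hp : p ≠ 0 := (Fact.out : p.Prime).ne_zero
  have : ExpChar k p := .prime Fact.out
  have hsurj : Function.Surjective (frobenius k p) := surjective_frobenius k p
  obtain ⟨g, hg⟩ := Polynomial.map_surjective _ hsurj (contract p f)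
  refine ⟨g, ?_⟩
  rw [← map_frobenius_expand, map_expand, hg, expand_contract p hf hp]

theorem exists_pow_mul_of_wronskian_eq_zero (p : ℕ) [Fact p.Prime] [CharP k p] [PerfectField k]
    {a b : k[X]} (hab : a ≠ 0 ∨ b ≠ 0) (hw : wronskian a b = 0) :
    ∃ u A B : k[X], a = u * A ^ p ∧ b = u * B ^ p := by
  classical
  set u := EuclideanDomain.gcd a b with hu
  have hu0 : u ≠ 0 := by
    rw [hu, Ne, EuclideanDomain.gcd_eq_zero_iff]
    tauto
  obtain ⟨a', ha'⟩ := EuclideanDomain.gcd_dvd_left a b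
  obtain ⟨b', hb'⟩ := EuclideanDomain.gcd_dvd_right a b
  rw [← hu] at ha' hb'
  have hcop : IsCoprime a' b' := by
    refine ⟨EuclideanDomain.gcdA a b, EuclideanDomain.gcdB a b, ?_⟩
    have h := EuclideanDomain.gcd_eq_gcd_ab a b
    rw [← hu] at h
    apply mul_left_cancel₀ hu0
    calc _ = (u * a') * EuclideanDomain.gcdA a b + (u * b') * EuclideanDomain.gcdB a b := by ring
      _ = u * 1 := by rw [← ha', ← hb', ← h, mul_one]
  have hw' : wronskian a' b' = 0 := by
    have : wronskian a b = u ^ 2 * wronskian a' b' := by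
      conv_lhs => rw [ha', hb']
      simp only [wronskian, derivative_mul]
      ring
    rw [this] at hw
    exact (mul_eq_zero.1 hw).resolve_left (pow_ne_zero _ hu0)
  obtain ⟨h1, h2⟩ := hcop.wronskian_eq_zero_iff.1 hw'
  obtain ⟨A, rfl⟩ := exists_eq_pow_of_derivative_eq_zero p h1
  obtain ⟨B, rfl⟩ := exists_eq_pow_of_derivative_eq_zero p h2
  exact ⟨u, A, B, ha', hb'⟩

theorem sum_le_natDegree_of_forall_pow_dvd {ι : Type*} [Fintype ι] {x : ι → k}
    (hx : Function.Injective x) {f : k[X]} (hf : f ≠ 0) {n : ι → ℕ}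
    (hn : ∀ i, (X - C (x i)) ^ n i ∣ f) : ∑ i, n i ≤ f.natDegree := by
  have hdvd : ∏ i, (X - C (x i)) ^ n i ∣ f := by
    refine Finset.prod_dvd_of_coprime (fun i _ j _ hij => ?_) fun i _ => hn i
    exact (isCoprime_X_sub_C_of_isUnit_sub
      (sub_ne_zero.2 fun h => hij (hx h)).isUnit).pow
  have := natDegree_le_of_dvd hdvd hf
  rwa [natDegree_prod_of_monic _ _ fun i _ => (monic_X_sub_C _).pow _,
    Finset.sum_congr rfl fun i _ => by rw [natDegree_pow, natDegree_X_sub_C, mul_one]] at this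

theorem natDegree_add_mul_le {u f : k[X]} {p d : ℕ} (hu : u ≠ 0) (hf : f ≠ 0)
    (h : (u * f ^ p).natDegree ≤ d) : u.natDegree + p * f.natDegree ≤ d := by
  rwa [natDegree_mul hu (pow_ne_zero _ hf), natDegree_pow] at h

theorem natDegree_add_mul_max_le {u A B : k[X]} {p d : ℕ} (hp : p ≠ 0)
    (h : u * A ^ p ≠ 0 ∨ u * B ^ p ≠ 0) (hA : (u * A ^ p).natDegree ≤ d)
    (hB : (u * B ^ p).natDegree ≤ d) :
    u.natDegree + p * max A.natDegree B.natDegree ≤ d := by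
  have hu : u ≠ 0 := by
    rintro rfl
    simp at h
  rcases eq_or_ne A 0 with rfl | hA0
  · have hB0 : B ≠ 0 := by
      rintro rfl
      simp [hp] at h
    simpa using natDegree_add_mul_le hu hB0 hB
  rcases eq_or_ne B 0 with rfl | hB0
  · simpa using natDegree_add_mul_le hu hA0 hA
  rcases max_choice A.natDegree B.natDegree with h | h <;> rw [h]
  exacts [natDegree_add_mul_le hu hA0 hA, natDegree_add_mul_le hu hB0 hB]

/-- Semistability of the Frobenius pull-backs of the kernel of `(1, x)` on the projective line with
half-weights at three points. -/
theorem eq_zero_of_pow_dvd_mul_X_pow_add (p : ℕ) [Fact p.Prime] [CharP k p] [PerfectField k]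
    (hp : p ≠ 2) {x : Fin 3 → k} (hx : Function.Injective x) (e : ℕ) :
    ∀ (a b : k[X]) (d : ℕ) (n : Fin 3 → ℕ), a.natDegree ≤ d → b.natDegree ≤ d →
      (∀ i, (X - C (x i)) ^ n i ∣ a * X ^ p ^ e + b) →
      4 * d + 2 * ∑ i, (p ^ e - 2 * n i) < 3 * p ^ e → a = 0 ∧ b = 0 := by
  classical
  have hpp : p.Prime := Fact.out
  induction e with
  | zero =>
    intro a b d n ha hb hn hlt
    rw [pow_zero] at *
    simp only [Fin.sum_univ_three] at hlt
    obtain rfl : d = 0 := by omega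
    rw [eq_C_of_natDegree_le_zero ha, eq_C_of_natDegree_le_zero hb] at hn ⊢
    have hroot : ∀ i, n i ≠ 0 → a.coeff 0 * x i + b.coeff 0 = 0 := by
      intro i hi
      have := (dvd_pow_self _ hi).trans (hn i)
      rw [dvd_iff_isRoot] at this
      simpa using this
    have key : ∀ i j, i ≠ j → n i ≠ 0 → n j ≠ 0 → a.coeff 0 = 0 ∧ b.coeff 0 = 0 := by
      intro i j hij hi hj
      have h1 := hroot i hi
      have h2 := hroot j hj
      have h3 : a.coeff 0 * (x i - x j) = 0 := by linear_combination h1 - h2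
      have h4 : a.coeff 0 = 0 :=
        (mul_eq_zero.1 h3).resolve_right (sub_ne_zero.2 fun h => hij (hx h))
      exact ⟨h4, by simpa [h4] using h1⟩
    suffices a.coeff 0 = 0 ∧ b.coeff 0 = 0 by simp [this.1, this.2]
    by_cases h0 : n 0 = 0
    · exact key 1 2 (by decide) (by omega) (by omega)
    by_cases h1 : n 1 = 0
    · exact key 0 2 (by decide) (by omega) (by omega)
    · exact key 0 1 (by decide) h0 h1
  | succ e ih =>
    intro a b d n ha hb hn hlt
    by_contra hab
    have hab' : a ≠ 0 ∨ b ≠ 0 := by tauto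
    obtain ⟨r, hr⟩ : Odd (p ^ (e + 1)) := (hpp.odd_of_ne_two hp).pow
    set δ := a * X ^ p ^ (e + 1) + b with hδ
    have hδ0 : δ ≠ 0 := by
      intro h
      have hb' : b = -(a * X ^ p ^ (e + 1)) := by linear_combination h
      have ha0 : a ≠ 0 := by
        rintro rfl
        simp at hb'
        tauto
      rw [hb', natDegree_neg, natDegree_mul_X_pow _ ha0] at hb
      omega
    have hw : wronskian a b = 0 := by
      by_contra hw0
      have hdeg := natDegree_wronskian_add_two_le ha hb hw0
      have hdvd : ∀ i, (X - C (x i)) ^ (n i - 1) ∣ wronskian a b := by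
        intro i
        have hwδ : wronskian a b = a * derivative δ - derivative a * δ := by
          have : derivative (X ^ p ^ (e + 1) : k[X]) = 0 := by
            rw [derivative_X_pow, Nat.cast_pow, CharP.cast_eq_zero, zero_pow e.succ_ne_zero, C_0,
              zero_mul]
          rw [hδ, wronskian, derivative_add, derivative_mul, this]
          ring
        have h1 := (pow_dvd_pow (X - C (x i)) (Nat.sub_le (n i) 1)).trans (hn i)
        rw [hwδ]
        refine dvd_sub (Dvd.dvd.mul_left ?_ _) (h1.mul_left _)
        obtain ⟨c, hc⟩ := hn i
        rw [hc, derivative_mul, derivative_pow]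
        refine dvd_add (Dvd.dvd.mul_right ?_ _) ((pow_dvd_pow _ (Nat.sub_le _ _)).mul_right _)
        exact (dvd_mul_left _ _).mul_right _
      have hsum := sum_le_natDegree_of_forall_pow_dvd hx hw0 hdvd
      simp only [Fin.sum_univ_three] at hsum hlt
      omega
    obtain ⟨u, A, B, rfl, rfl⟩ := exists_pow_mul_of_wronskian_eq_zero p hab' hw
    set η := A * X ^ p ^ e + B with hη
    have hδη : δ = u * η ^ p := by
      rw [hδ, hη, add_pow_char, mul_pow, ← pow_mul, ← pow_succ]
      ring
    have hu0 : u ≠ 0 := by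
      rintro rfl
      simp [hδη] at hδ0
    have hη0 : η ≠ 0 := by
      intro h
      simp [hδη, h, hpp.ne_zero] at hδ0
    have hmult : ∀ i, n i ≤ rootMultiplicity (x i) u + p * rootMultiplicity (x i) η := by
      intro i
      have := (le_rootMultiplicity_iff hδ0).2 (hn i)
      rw [hδη, ← count_roots, roots_mul (hδη ▸ hδ0), roots_pow, Multiset.count_add,
        Multiset.count_nsmul, count_roots, count_roots] at this
      exact this
    have hsumu := sum_le_natDegree_of_forall_pow_dvd hx hu0
      fun i => pow_rootMultiplicity_dvd u (x i)
    set d' := max A.natDegree B.natDegree with hd'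
    have hd : u.natDegree + p * d' ≤ d := natDegree_add_mul_max_le hpp.ne_zero hab' ha hb
    obtain ⟨rfl, rfl⟩ := ih A B d' (fun i => rootMultiplicity (x i) η) (le_max_left _ _)
      (le_max_right _ _) (fun i => pow_rootMultiplicity_dvd _ _) (by
        have hterm : ∀ i, p * (p ^ e - 2 * rootMultiplicity (x i) η) ≤
            (p ^ (e + 1) - 2 * n i) + 2 * rootMultiplicity (x i) u := by
          intro i
          have h := hmult i
          rw [Nat.mul_sub, pow_succ']
          have : p * (2 * rootMultiplicity (x i) η) = 2 * (p * rootMultiplicity (x i) η) := by ring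
          omega
        have hsum := Finset.sum_le_sum fun i (_ : i ∈ Finset.univ) => hterm i
        rw [← Finset.mul_sum, Finset.sum_add_distrib, ← Finset.mul_sum] at hsum
        refine lt_of_mul_lt_mul_left (a := p) ?_ (Nat.zero_le p)
        have h3 : p * (3 * p ^ e) = 3 * p ^ (e + 1) := by ring
        rw [h3, mul_add, mul_left_comm, mul_left_comm p 2]
        omega)
    simp [hpp.ne_zero] at hab

end WronskianDescent

section Dehomogenization

variable {k : Type*} [Field k]

open Polynomial in
/-- Setting the third variable equal to `1`. -/
noncomputable def dehomogenize : MvPolynomial (Fin 3) k →ₐ[k] k[X][X] :=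
  MvPolynomial.aeval ![C X, X, 1]

open Polynomial in
/-- The homogeneous polynomial `Y²Z - ∏ (X - xᵢZ)`. -/
noncomputable def weierstrassForm (x : Fin 3 → k) : MvPolynomial (Fin 3) k :=
  .X 1 ^ 2 * .X 2 - ∏ i, (.X 0 - .C (x i) * .X 2)

open Polynomial in
theorem dehomogenize_weierstrassForm (x : Fin 3 → k) :
    dehomogenize (weierstrassForm x) = X ^ 2 - C (∏ i, (X - C (x i))) := by
  simp only [weierstrassForm, dehomogenize, map_sub, map_mul, map_pow, map_prod,
    MvPolynomial.aeval_X, MvPolynomial.aeval_C]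
  simp [Polynomial.algebraMap_apply]

open Polynomial in
theorem coeff_coeff_dehomogenize (A : MvPolynomial (Fin 3) k) (i j : ℕ) :
    ((dehomogenize A).coeff j).coeff i =
      ∑ m ∈ A.support, if m 0 = i ∧ m 1 = j then A.coeff m else 0 := by
  conv_lhs => rw [A.as_sum, map_sum, finsetSum_coeff, finsetSum_coeff]
  refine Finset.sum_congr rfl fun m _ => ?_
  rw [dehomogenize, MvPolynomial.aeval_monomial]
  rw [Finsupp.prod_fintype _ _ fun _ => pow_zero _]
  simp only [Fin.prod_univ_three, Matrix.cons_val_zero, Matrix.cons_val_one, Matrix.cons_val,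
    one_pow, mul_one, Polynomial.algebraMap_apply, ← C_pow]
  rw [← mul_assoc, ← C_mul, coeff_C_mul, coeff_X_pow]
  simp only [Algebra.algebraMap_self, RingHom.id_apply]
  by_cases hj : m 1 = j
  · rw [if_pos hj.symm, mul_one, coeff_C_mul, coeff_X_pow]
    by_cases hi : m 0 = i
    · simp [hi, hj]
    · simp [hi, Ne.symm hi]
  · simp [hj, Ne.symm hj]

theorem sum_eq_of_mem_support {A : MvPolynomial (Fin 3) k} {n : ℕ} (hA : A.IsHomogeneous n)
    {m : Fin 3 →₀ ℕ} (hm : m ∈ A.support) : m 0 + m 1 + m 2 = n := by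
  rw [hA.degree_eq_sum_deg_support hm, ← Finsupp.degree_apply, Finsupp.degree_eq_sum,
    Fin.sum_univ_three]

theorem coeff_coeff_dehomogenize_of_degree_eq {A : MvPolynomial (Fin 3) k} {n : ℕ}
    (hA : A.IsHomogeneous n) (m : Fin 3 →₀ ℕ) (hm : m 0 + m 1 + m 2 = n) :
    ((dehomogenize A).coeff (m 1)).coeff (m 0) = A.coeff m := by
  rw [coeff_coeff_dehomogenize, Finset.sum_eq_single m]
  · simp
  · intro m' hm' hne
    rw [if_neg]
    rintro ⟨h0, h1⟩
    have h := sum_eq_of_mem_support hA hm'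
    apply hne
    ext i
    fin_cases i
    · exact h0
    · exact h1
    · simp only [Fin.reduceFinMk]
      omega
  · intro h
    simpa using h

theorem coeff_coeff_dehomogenize_of_lt {A : MvPolynomial (Fin 3) k} {n : ℕ}
    (hA : A.IsHomogeneous n) {i j : ℕ} (hij : n < i + j) :
    ((dehomogenize A).coeff j).coeff i = 0 := by
  rw [coeff_coeff_dehomogenize]
  refine Finset.sum_eq_zero fun m hm => if_neg ?_
  rintro ⟨h0, h1⟩
  have h := sum_eq_of_mem_support hA hm
  omega

open Polynomial

theorem exists_eq_C_add_C_mul_X_add_mul {g : k[X]} (hg : g.natDegree ≤ 3) {n : ℕ} {P : k[X][X]}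
    (hP : ∀ i j, n < i + j → (P.coeff j).coeff i = 0) :
    ∃ (a b : k[X]) (h : k[X][X]), P = C a + C b * X + h * (X ^ 2 - C g) ∧
      (∀ i, 3 * n < 2 * i → a.coeff i = 0) ∧ ∀ i, 3 * n < 2 * i + 3 → b.coeff i = 0 := by
  have key : ∀ s : Finset ℕ, ∃ (a b : k[X]) (h : k[X][X]),
      ∑ j ∈ s, monomial j (P.coeff j) = C a + C b * X + h * (X ^ 2 - C g) ∧
      (∀ i, 3 * n < 2 * i → a.coeff i = 0) ∧ ∀ i, 3 * n < 2 * i + 3 → b.coeff i = 0 := by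
    intro s
    induction s using Finset.induction_on with
    | empty => exact ⟨0, 0, 0, by simp, by simp, by simp⟩
    | insert j s hj ih =>
      obtain ⟨a, b, h, hs, ha, hb⟩ := ih
      rw [Finset.sum_insert hj, hs]
      by_cases hjn : n < j
      · have : P.coeff j = 0 := by
          ext i
          exact hP i j (by omega)
        exact ⟨a, b, h, by simp [this], ha, hb⟩
      have hdeg : (P.coeff j).natDegree ≤ n - j :=
        natDegree_le_iff_coeff_eq_zero.2 fun i hi => hP i j (by omega)
      have hdeg' : ∀ l, (P.coeff j * g ^ l).natDegree ≤ n - j + 3 * l := by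
        intro l
        refine natDegree_mul_le.trans (Nat.add_le_add hdeg (natDegree_pow_le.trans ?_))
        rw [mul_comm]
        gcongr
      obtain ⟨l, hl | hl⟩ := Nat.even_or_odd' j
      · obtain ⟨c, hc⟩ := sub_dvd_pow_sub_pow (X ^ 2 : k[X][X]) (C g) l
        refine ⟨P.coeff j * g ^ l + a, b, C (P.coeff j) * c + h, ?_, fun i hi => ?_, hb⟩
        · have hX : (X ^ j : k[X][X]) = C g ^ l + (X ^ 2 - C g) * c := by
            rw [hl, pow_mul, ← hc]
            ring
          rw [← C_mul_X_pow_eq_monomial, hX, C_add, C_mul, C_pow]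
          ring
        · rw [coeff_add, ha i hi, add_zero]
          exact coeff_eq_zero_of_natDegree_lt ((hdeg' l).trans_lt (by omega))
      · obtain ⟨c, hc⟩ := sub_dvd_pow_sub_pow (X ^ 2 : k[X][X]) (C g) l
        refine ⟨a, P.coeff j * g ^ l + b, C (P.coeff j) * c * X + h, ?_, ha, fun i hi => ?_⟩
        · have hX : (X ^ j : k[X][X]) = (C g ^ l + (X ^ 2 - C g) * c) * X := by
            rw [hl, pow_succ, pow_mul, ← hc]
            ring
          rw [← C_mul_X_pow_eq_monomial, hX, C_add, C_mul, C_pow]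
          ring
        · rw [coeff_add, hb i hi, add_zero]
          exact coeff_eq_zero_of_natDegree_lt ((hdeg' l).trans_lt (by omega))
  obtain ⟨a, b, h, hs, hab⟩ := key P.support
  refine ⟨a, b, h, ?_, hab⟩
  rw [← hs]
  exact P.as_sum_support

theorem add_le_of_coeff_mul_ne_zero {g : k[X]} (hg : g.Monic) (hg3 : g.natDegree = 3) {n : ℕ}
    {h : k[X][X]} (hh : ∀ i j, n < i + j → ((h * (X ^ 2 - C g)).coeff j).coeff i = 0) {i j : ℕ}
    (hij : (h.coeff j).coeff i ≠ 0) : i + j + 3 ≤ n := by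
  classical
  set S := h.support.biUnion fun j => (h.coeff j).support.image (· + j) with hS
  have memS : ∀ s, s ∈ S ↔ ∃ i j, (h.coeff j).coeff i ≠ 0 ∧ i + j = s := by
    intro s
    simp only [hS, Finset.mem_biUnion, mem_support_iff, Finset.mem_image]
    constructor
    · rintro ⟨j, -, i, hi, rfl⟩
      exact ⟨i, j, hi, rfl⟩
    · rintro ⟨i, j, hi, rfl⟩
      refine ⟨j, fun h0 => hi ?_, i, hi, rfl⟩
      rw [h0, coeff_zero]
  have hne : S.Nonempty := ⟨i + j, (memS _).2 ⟨i, j, hij, rfl⟩⟩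
  obtain ⟨i₀, j₀, h₀, hmax⟩ := (memS _).1 (S.max'_mem hne)
  have hle : ∀ i j, i₀ + j₀ < i + j → (h.coeff j).coeff i = 0 := by
    intro i j hlt
    by_contra hne0
    have := S.le_max' _ ((memS _).2 ⟨i, j, hne0, rfl⟩)
    omega
  have hi : i + j ≤ i₀ + j₀ := by
    by_contra hlt
    exact hij (hle i j (by omega))
  by_contra hlt
  have hzero := hh (i₀ + 3) j₀ (by omega)
  have h1 : ((h * X ^ 2).coeff j₀).coeff (i₀ + 3) = 0 := by
    rw [coeff_mul_X_pow']
    split_ifs with h2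
    · exact hle _ _ (by omega)
    · simp
  have h2 : (h.coeff j₀).natDegree ≤ i₀ :=
    natDegree_le_iff_coeff_eq_zero.2 fun i hi => hle i j₀ (by omega)
  have h3 := coeff_mul_add_eq_of_natDegree_le h2 hg3.le
  rw [mul_sub, coeff_sub, coeff_sub, h1, coeff_mul_C, h3, ← hg3, hg.coeff_natDegree] at hzero
  apply h₀
  simpa using hzero

end Dehomogenization

section MaximalRank

variable {k : Type*} [Field k]

theorem exists_eq_sum_X_pow_mul {P : MvPolynomial (Fin 3) k} {N q : ℕ} (hP : P.IsHomogeneous N)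
    (hbox : ∀ m : Fin 3 →₀ ℕ, (∀ i, m i < q) → P.coeff m = 0) :
    ∃ A B C : MvPolynomial (Fin 3) k, A.IsHomogeneous (N - q) ∧ B.IsHomogeneous (N - q) ∧
      C.IsHomogeneous (N - q) ∧ P = .X 0 ^ q * A + .X 1 ^ q * B + .X 2 ^ q * C := by
  have hdiv : ∀ {Q : MvPolynomial (Fin 3) k} (i : Fin 3), Q.IsHomogeneous N →
      (Q.divMonomial (Finsupp.single i q)).IsHomogeneous (N - q) := by
    intro Q i hQ m hm
    rw [MvPolynomial.coeff_divMonomial] at hm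
    have := hQ hm
    rw [map_add, Finsupp.weight_single] at this
    simp at this
    omega
  have hmod : ∀ {Q : MvPolynomial (Fin 3) k} (s : Fin 3 →₀ ℕ), Q.IsHomogeneous N →
      (Q.modMonomial s).IsHomogeneous N := by
    intro Q s hQ m hm
    by_cases hs : s ≤ m
    · rw [MvPolynomial.coeff_modMonomial_of_le _ hs] at hm
      exact absurd rfl hm
    · rw [MvPolynomial.coeff_modMonomial_of_not_le _ hs] at hm
      exact hQ hm
  have hsplit : ∀ (Q : MvPolynomial (Fin 3) k) (i : Fin 3),
      Q = .X i ^ q * Q.divMonomial (Finsupp.single i q) + Q.modMonomial (Finsupp.single i q) := by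
    intro Q i
    rw [MvPolynomial.X_pow_eq_monomial]
    exact (MvPolynomial.divMonomial_add_modMonomial Q _).symm
  set P₁ := P.modMonomial (Finsupp.single 0 q) with hP₁
  set P₂ := P₁.modMonomial (Finsupp.single 1 q) with hP₂
  set P₃ := P₂.modMonomial (Finsupp.single 2 q) with hP₃
  have h₃ : P₃ = 0 := by
    ext m
    rw [MvPolynomial.coeff_zero]
    have hle : ∀ i, Finsupp.single i q ≤ m ↔ q ≤ m i := fun i => by
      simp
    by_cases h2 : q ≤ m 2
    · exact MvPolynomial.coeff_modMonomial_of_le _ ((hle 2).2 h2)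
    rw [hP₃, MvPolynomial.coeff_modMonomial_of_not_le _ (mt (hle 2).1 h2)]
    by_cases h1 : q ≤ m 1
    · exact MvPolynomial.coeff_modMonomial_of_le _ ((hle 1).2 h1)
    rw [hP₂, MvPolynomial.coeff_modMonomial_of_not_le _ (mt (hle 1).1 h1)]
    by_cases h0 : q ≤ m 0
    · exact MvPolynomial.coeff_modMonomial_of_le _ ((hle 0).2 h0)
    rw [hP₁, MvPolynomial.coeff_modMonomial_of_not_le _ (mt (hle 0).1 h0)]
    apply hbox
    intro i
    fin_cases i
    · exact not_le.1 h0
    · exact not_le.1 h1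
    · exact not_le.1 h2
  refine ⟨P.divMonomial (Finsupp.single 0 q), P₁.divMonomial (Finsupp.single 1 q),
    P₂.divMonomial (Finsupp.single 2 q), hdiv 0 hP, hdiv 1 (hmod _ hP),
    hdiv 2 (hmod _ (hmod _ hP)), ?_⟩
  conv_lhs => rw [hsplit P 0, ← hP₁, hsplit P₁ 1, ← hP₂, hsplit P₂ 2, ← hP₃, h₃]
  ring

open MvPolynomial in
theorem isHomogeneous_weierstrassForm (x : Fin 3 → k) : (weierstrassForm x).IsHomogeneous 3 := by
  have h1 : (X 1 ^ 2 * X 2 : MvPolynomial (Fin 3) k).IsHomogeneous 3 :=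
    (isHomogeneous_X_pow 1 2).mul (isHomogeneous_X k 2)
  have h2 (i : Fin 3) : (X 0 - C (x i) * X 2 : MvPolynomial (Fin 3) k).IsHomogeneous 1 :=
    (isHomogeneous_X k 0).sub (isHomogeneous_C_mul_X (x i) 2)
  have h3 := IsHomogeneous.prod Finset.univ _ _ fun i _ => h2 i
  exact h1.sub (by simpa using h3)

open Polynomial in
theorem eq_zero_of_coeff_weierstrassForm_mul (p : ℕ) [Fact p.Prime] [CharP k p] [PerfectField k]
    (hp : p ≠ 2) {x : Fin 3 → k} (hx : Function.Injective x) (e : ℕ) {N : ℕ}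
    {G : MvPolynomial (Fin 3) k} (hG : G.IsHomogeneous N) (hN : 2 * N + 7 ≤ 3 * p ^ e)
    (hGbox : ∀ m ∈ G.support, ∀ i, m i < p ^ e)
    (hFG : ∀ m : Fin 3 →₀ ℕ, (∀ i, m i < p ^ e) → (weierstrassForm x * G).coeff m = 0) :
    G = 0 := by
  obtain ⟨r, hr⟩ : Odd (p ^ e) := ((Fact.out : p.Prime).odd_of_ne_two hp).pow
  set g : k[X] := ∏ i, (X - C (x i)) with hg
  have hgm : g.Monic := monic_prod_of_monic _ _ fun i _ => monic_X_sub_C _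
  have hg3 : g.natDegree = 3 := by
    rw [hg, natDegree_prod_of_monic _ _ fun i _ => monic_X_sub_C _]
    simp
  set f : k[X][X] := X ^ 2 - C g with hf
  have hfm : f.Monic := monic_X_pow_sub_C g two_ne_zero
  have hf2 : f.natDegree = 2 := natDegree_X_pow_sub_C
  obtain ⟨A, B, D, hA, hB, hD, hABD⟩ :=
    exists_eq_sum_X_pow_mul ((isHomogeneous_weierstrassForm x).mul hG) hFG
  set n := 3 + N - p ^ e with hn
  have hnr : n ≤ r := by omega
  obtain ⟨a₀, a₁, hₐ, ha, ha₀, ha₁⟩ := exists_eq_C_add_C_mul_X_add_mul hg3.le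
    fun i j hij => coeff_coeff_dehomogenize_of_lt hA (i := i) (j := j) hij
  obtain ⟨b₀, b₁, h_b, hb, -, -⟩ := exists_eq_C_add_C_mul_X_add_mul hg3.le
    fun i j hij => coeff_coeff_dehomogenize_of_lt hB (i := i) (j := j) hij
  obtain ⟨c₀, c₁, h_c, hc, hc₀, hc₁⟩ := exists_eq_C_add_C_mul_X_add_mul hg3.le
    fun i j hij => coeff_coeff_dehomogenize_of_lt hD (i := i) (j := j) hij
  rw [← hf] at ha hb hc
  have hrel : f * dehomogenize G = C X ^ p ^ e * dehomogenize A + X ^ p ^ e * dehomogenize B +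
      dehomogenize D := by
    have := congrArg dehomogenize hABD
    rw [map_mul, dehomogenize_weierstrassForm] at this
    rw [hf, this]
    simp [dehomogenize]
  obtain ⟨w, hw⟩ := sub_dvd_pow_sub_pow (X ^ 2 : k[X][X]) (C g) r
  obtain ⟨w', hw'⟩ := sub_dvd_pow_sub_pow (X ^ 2 : k[X][X]) (C g) (r + 1)
  rw [← hf] at hw hw'
  have hX : (X ^ p ^ e : k[X][X]) = (C g ^ r + f * w) * X := by
    rw [hr, pow_succ, pow_mul, ← hw]
    ring
  have hX' : (X ^ p ^ e : k[X][X]) * X = C g ^ (r + 1) + f * w' := by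
    rw [← pow_succ, hr, ← hw', ← pow_mul]
    ring
  set s := a₀ * X ^ p ^ e + c₀ + b₁ * g ^ (r + 1) with hs
  set t := a₁ * X ^ p ^ e + c₁ + b₀ * g ^ r with ht
  have hdvd : f ∣ C t * X + C s := by
    refine ⟨dehomogenize G - C X ^ p ^ e * hₐ - X ^ p ^ e * h_b - h_c - C b₀ * w * X - C b₁ * w',
      ?_⟩
    simp only [hs, ht, C_add, C_mul, C_pow]
    rw [ha, hb, hc] at hrel
    linear_combination -hrel - C b₀ * hX - C b₁ * hX'
  have hzero : C t * X + C s = 0 := by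
    refine eq_zero_of_dvd_of_natDegree_lt hdvd ?_
    rw [hf2]
    exact natDegree_linear_le.trans_lt one_lt_two
  have hs0 : s = 0 := by simpa using congrArg (coeff · 0) hzero
  have ht0 : t = 0 := by simpa using congrArg (coeff · 1) hzero
  have hgdvd : ∀ i l, (X - C (x i)) ^ l ∣ g ^ l := fun i l =>
    pow_dvd_pow_of_dvd (Finset.dvd_prod_of_mem _ (Finset.mem_univ i)) l
  have hac₀ : a₀ = 0 ∧ c₀ = 0 := by
    refine eq_zero_of_pow_dvd_mul_X_pow_add p hp hx e a₀ c₀ (3 * n / 2) (fun _ => r + 1)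
      (natDegree_le_iff_coeff_eq_zero.2 fun i hi => ha₀ i (by omega))
      (natDegree_le_iff_coeff_eq_zero.2 fun i hi => hc₀ i (by omega)) (fun i => ?_) ?_
    · have : a₀ * X ^ p ^ e + c₀ = -b₁ * g ^ (r + 1) := by linear_combination hs0
      rw [this]
      exact (hgdvd i _).mul_left _
    · simp only [Fin.sum_univ_three]
      omega
  have hac₁ : a₁ = 0 ∧ c₁ = 0 := by
    rcases Nat.eq_zero_or_pos n with hn0 | hn0
    · constructor <;> ext i
      · exact ha₁ i (by omega)
      · exact hc₁ i (by omega)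
    refine eq_zero_of_pow_dvd_mul_X_pow_add p hp hx e a₁ c₁ ((3 * n - 3) / 2) (fun _ => r)
      (natDegree_le_iff_coeff_eq_zero.2 fun i hi => ha₁ i (by omega))
      (natDegree_le_iff_coeff_eq_zero.2 fun i hi => hc₁ i (by omega)) (fun i => ?_) ?_
    · have : a₁ * X ^ p ^ e + c₁ = -b₀ * g ^ r := by linear_combination ht0
      rw [this]
      exact (hgdvd i _).mul_left _
    · simp only [Fin.sum_univ_three]
      omega
  obtain ⟨rfl, rfl⟩ := hac₀
  obtain ⟨rfl, rfl⟩ := hac₁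
  have hb₁ : b₁ = 0 := by simpa [hs, hgm.ne_zero] using hs0
  have hb₀ : b₀ = 0 := by simpa [ht, hgm.ne_zero] using ht0
  subst hb₀ hb₁
  simp only [C_0, zero_mul, add_zero, zero_add] at ha hb hc
  have hGeq : dehomogenize G = C (X ^ p ^ e) * hₐ + h_b * X ^ p ^ e + h_c := by
    apply mul_left_cancel₀ hfm.ne_zero
    rw [hrel, ha, hb, hc, C_pow]
    ring
  by_contra hG0
  obtain ⟨m, hm⟩ := MvPolynomial.support_nonempty.2 hG0
  have hdeg := sum_eq_of_mem_support hG hm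
  have hcoeff := coeff_coeff_dehomogenize_of_degree_eq hG m hdeg
  rw [hGeq, coeff_add, coeff_add, coeff_add, coeff_add, coeff_C_mul, coeff_X_pow_mul',
    coeff_mul_X_pow', if_neg (hGbox m hm 0).not_ge, if_neg (hGbox m hm 1).not_ge, coeff_zero,
    zero_add, zero_add] at hcoeff
  have := add_le_of_coeff_mul_ne_zero hgm hg3 (n := n) (h := h_c)
    (fun i j hij => by rw [← hf, ← hc]; exact coeff_coeff_dehomogenize_of_lt hD hij)
    (i := m 0) (j := m 1) (by rw [hcoeff]; exact MvPolynomial.mem_support_iff.1 hm)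
  have := hGbox m hm 2
  omega

end MaximalRank

section BlockRank

variable {k ι : Type*} [Field k] [Fintype ι]

theorem Matrix.finrank_ker_mulVecLin_of_symm (T : Matrix ι ι k) {c : ι → ι}
    (hc : Function.Involutive c) (hT : ∀ i j, T (c j) (c i) = T i j) (L : ι → Prop)
    [DecidablePred L] (hL : ∀ i j, T i j ≠ 0 → (L j ↔ ¬ L (c i)))
    (hinj : ∀ v : ι → k, (∀ i, ¬ L i → v i = 0) → T.mulVec v = 0 → v = 0) :
    Module.finrank k (LinearMap.ker T.mulVecLin) + 2 * Fintype.card {i // L i} =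
      Fintype.card ι := by
  let S : Matrix {i // L i} ι k := T.submatrix (fun i => c i) id
  have hS : Function.Surjective S.mulVecLin := by
    have hrow : LinearIndependent k S.row := by
      rw [← Matrix.vecMul_injective_iff]
      change Function.Injective S.vecMulLinear
      rw [injective_iff_map_eq_zero]
      intro a ha
      have h0 := hinj (fun i => if h : L i then a ⟨i, h⟩ else 0) (fun i hi => by simp [hi]) ?_
      · ext i
        simpa [i.2] using congrFun h0 i
      · ext i
        have := congrFun ha (c i)
        simp only [Matrix.vecMulLinear_apply, Matrix.vecMul, dotProduct, S, Matrix.submatrix_apply,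
          id, hT, Pi.zero_apply] at this
        refine Eq.trans ?_ this
        refine (Fintype.sum_of_injective _ Subtype.val_injective _ _ (fun j hj => ?_)
          fun j => ?_).symm
        · have hj : ¬ L j := fun h => hj ⟨⟨j, h⟩, rfl⟩
          simp [hj]
        · simp [j.2, mul_comm]
    rw [← LinearMap.range_eq_top]
    apply Submodule.eq_top_of_finrank_eq
    rw [Module.finrank_fintype_fun_eq_card]
    exact hrow.rank_matrix
  let Ψ : (ι → k) →ₗ[k] ({i // L i} → k) × ({i // L i} → k) :=
    (LinearMap.funLeft k k Subtype.val).prod S.mulVecLin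
  have hlow (v : ι → k) (i : ι) (hi : L (c i)) :
      T.mulVec v i = T.mulVec (fun j => if L j then 0 else v j) i := by
    refine Finset.sum_congr rfl fun j _ => ?_
    by_cases hij : T i j = 0
    · simp [hij]
    · simp [(not_congr (hL i j hij)).2 (not_not.2 hi)]
  have hhigh (v : ι → k) (i : ι) (hi : ¬ L (c i)) :
      T.mulVec v i = T.mulVec (fun j => if L j then v j else 0) i := by
    refine Finset.sum_congr rfl fun j _ => ?_
    by_cases hij : T i j = 0
    · simp [hij]
    · simp [(hL i j hij).2 hi]
  have hker : LinearMap.ker T.mulVecLin = LinearMap.ker Ψ := by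
    ext v
    rw [LinearMap.mem_ker, LinearMap.mem_ker, Matrix.mulVecLin_apply]
    constructor
    · intro hv
      refine Prod.ext ?_ ?_
      · have h0 := hinj (fun j => if L j then v j else 0) (fun i hi => by simp [hi]) ?_
        · ext i
          simpa [Ψ, i.2] using congrFun h0 i
        · ext i
          by_cases hi : L (c i)
          · rw [hlow _ _ hi]
            refine Finset.sum_eq_zero fun j _ => ?_
            by_cases hj : L j <;> simp [hj]
          · rw [← hhigh _ _ hi, hv]
      · ext i
        exact congrFun hv (c i)
    · intro h
      have hv : LinearMap.funLeft k k Subtype.val v = 0 := congrArg Prod.fst h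
      have hv' : S.mulVecLin v = 0 := congrArg Prod.snd h
      ext i
      by_cases hi : L (c i)
      · have := congrFun hv' ⟨c i, hi⟩
        simpa [S, Matrix.mulVec, hc i] using this
      · rw [hhigh _ _ hi]
        have : (fun j => if L j then v j else 0) = 0 := by
          ext j
          by_cases hj : L j
          · simpa [hj] using congrFun hv ⟨j, hj⟩
          · simp [hj]
        rw [this, Matrix.mulVec_zero]
  have hsurj : LinearMap.range Ψ = ⊤ := by
    rw [LinearMap.range_eq_top]
    rintro ⟨a, b⟩
    obtain ⟨v, hv⟩ := hS b
    refine ⟨fun i => if h : L i then a ⟨i, h⟩ else v i, ?_⟩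
    refine Prod.ext ?_ ?_
    · ext i
      simp [Ψ, i.2]
    · ext i
      have hi : L (c (c i)) := by rw [hc]; exact i.2
      have := congrFun hv i
      change T.mulVec _ (c i) = _ at this
      change T.mulVec _ (c i) = _
      refine Eq.trans ?_ this
      rw [hlow _ _ hi, hlow v _ hi]
      congr 1
      ext j
      by_cases hj : L j <;> simp [hj]
  have := Ψ.finrank_range_add_finrank_ker
  rw [hsurj, finrank_top, Module.finrank_prod, Module.finrank_fintype_fun_eq_card,
    Module.finrank_fintype_fun_eq_card] at this
  rw [hker]
  omega

end BlockRank

section BoxMatrix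

variable {k : Type*} [Field k]

/-- A point of the box `[0, q)³`, as an exponent. -/
noncomputable def boxExponent {q : ℕ} (m : Fin 3 → Fin q) : Fin 3 →₀ ℕ :=
  Finsupp.equivFunOnFinite.symm fun i => (m i : ℕ)

@[simp]
theorem boxExponent_apply {q : ℕ} (m : Fin 3 → Fin q) (i : Fin 3) : boxExponent m i = m i := rfl

theorem boxExponent_injective {q : ℕ} : Function.Injective (boxExponent (q := q)) := by
  intro m m' h
  ext i
  exact DFunLike.congr_fun h i

theorem exists_boxExponent_eq {q : ℕ} {s : Fin 3 →₀ ℕ} (hs : ∀ i, s i < q) :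
    ∃ m : Fin 3 → Fin q, boxExponent m = s :=
  ⟨fun i => ⟨s i, hs i⟩, by ext i; rfl⟩

open MvPolynomial

/-- The coefficients of a polynomial at the exponents in the box `[0, q)³`. -/
noncomputable def boxCoeff (k : Type*) [Field k] (q : ℕ) :
    MvPolynomial (Fin 3) k →ₗ[k] (Fin 3 → Fin q) → k :=
  LinearMap.pi fun m => lcoeff k (boxExponent m)

theorem boxCoeff_apply {q : ℕ} (P : MvPolynomial (Fin 3) k) (m : Fin 3 → Fin q) :
    boxCoeff k q P m = P.coeff (boxExponent m) := rfl

/-- The polynomial with prescribed coefficients in the box `[0, q)³`. -/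
noncomputable def boxPolynomial {q : ℕ} (v : (Fin 3 → Fin q) → k) : MvPolynomial (Fin 3) k :=
  ∑ m, monomial (boxExponent m) (v m)

theorem coeff_boxExponent_boxPolynomial {q : ℕ} (v : (Fin 3 → Fin q) → k) (m : Fin 3 → Fin q) :
    (boxPolynomial v).coeff (boxExponent m) = v m := by
  classical
  rw [boxPolynomial, coeff_sum, Finset.sum_eq_single m]
  · simp
  · intro m' _ h
    rw [coeff_monomial, if_neg (boxExponent_injective.ne h)]
  · simp

theorem boxCoeff_boxPolynomial {q : ℕ} (v : (Fin 3 → Fin q) → k) :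
    boxCoeff k q (boxPolynomial v) = v := by
  ext m
  rw [boxCoeff_apply, coeff_boxExponent_boxPolynomial]

theorem exists_of_mem_support_boxPolynomial {q : ℕ} {v : (Fin 3 → Fin q) → k} {s : Fin 3 →₀ ℕ}
    (hs : s ∈ (boxPolynomial v).support) : ∃ m, boxExponent m = s ∧ v m ≠ 0 := by
  classical
  rw [mem_support_iff, boxPolynomial, coeff_sum] at hs
  obtain ⟨m, -, hm⟩ := Finset.exists_ne_zero_of_sum_ne_zero hs
  rw [coeff_monomial] at hm
  split_ifs at hm with h
  · exact ⟨m, h, hm⟩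
  · exact absurd rfl hm

theorem boxCoeff_X_pow_mul {q : ℕ} (i : Fin 3) (P : MvPolynomial (Fin 3) k) :
    boxCoeff k q (X i ^ q * P) = 0 := by
  ext m
  rw [boxCoeff_apply, X_pow_eq_monomial, coeff_monomial_mul', if_neg, Pi.zero_apply]
  intro h
  have := h i
  simp only [Finsupp.single_eq_same, boxExponent_apply] at this
  omega

/-- The matrix of multiplication by `F` in the monomial basis of `k[X, Y, Z]/(X^q, Y^q, Z^q)`. -/
noncomputable def boxMatrix (F : MvPolynomial (Fin 3) k) (q : ℕ) :
    Matrix (Fin 3 → Fin q) (Fin 3 → Fin q) k :=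
  Matrix.of fun m m' => boxCoeff k q (monomial (boxExponent m') 1 * F) m

theorem boxMatrix_apply (F : MvPolynomial (Fin 3) k) (q : ℕ) (m m' : Fin 3 → Fin q)
    [Decidable (boxExponent m' ≤ boxExponent m)] :
    boxMatrix F q m m' =
      if boxExponent m' ≤ boxExponent m then F.coeff (boxExponent m - boxExponent m') else 0 := by
  rw [boxMatrix, Matrix.of_apply, boxCoeff_apply, coeff_monomial_mul', one_mul]
  congr

theorem boxCoeff_mul (F P : MvPolynomial (Fin 3) k) (q : ℕ) :
    boxCoeff k q (F * P) = (boxMatrix F q).mulVec (boxCoeff k q P) := by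
  induction P using MvPolynomial.induction_on' with
  | add P Q hP hQ => rw [mul_add, map_add, map_add, hP, hQ, Matrix.mulVec_add]
  | monomial s a =>
    by_cases hs : ∀ i, s i < q
    · obtain ⟨m, rfl⟩ := exists_boxExponent_eq hs
      have : boxCoeff k q (monomial (boxExponent m) a) = Pi.single m a := by
        ext m'
        rw [boxCoeff_apply, coeff_monomial, Pi.single_apply]
        simp only [boxExponent_injective.eq_iff, eq_comm]
      rw [this, Matrix.mulVec_single]
      ext m'
      simp only [Matrix.col_apply, Pi.smul_apply, boxMatrix, Matrix.of_apply,
        MulOpposite.smul_eq_mul_unop, MulOpposite.unop_op]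
      rw [← mul_one a, ← smul_eq_mul a, ← smul_monomial, mul_smul_comm, map_smul]
      simp [mul_comm]
    · push Not at hs
      obtain ⟨i, hi⟩ := hs
      have : monomial s a = X i ^ q * monomial (s - Finsupp.single i q) a := by
        rw [X_pow_eq_monomial, monomial_mul, one_mul, add_tsub_cancel_of_le (by simpa using hi)]
      rw [this, mul_left_comm, boxCoeff_X_pow_mul, boxCoeff_X_pow_mul, Matrix.mulVec_zero]

theorem mem_span_of_boxCoeff_eq_zero {q : ℕ} {P : MvPolynomial (Fin 3) k}
    (hP : boxCoeff k q P = 0) :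
    P ∈ Ideal.span (Set.range fun i : Fin 3 => (X i ^ q : MvPolynomial (Fin 3) k)) := by
  rw [P.as_sum]
  refine Ideal.sum_mem _ fun s _ => ?_
  by_cases hs : ∀ i, s i < q
  · obtain ⟨m, rfl⟩ := exists_boxExponent_eq hs
    rw [← boxCoeff_apply, hP, Pi.zero_apply, monomial_zero]
    exact Ideal.zero_mem _
  · push Not at hs
    obtain ⟨i, hi⟩ := hs
    have : monomial s (P.coeff s) = X i ^ q * monomial (s - Finsupp.single i q) (P.coeff s) := by
      rw [X_pow_eq_monomial, monomial_mul, one_mul, add_tsub_cancel_of_le (by simpa using hi)]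
    rw [this]
    exact Ideal.mul_mem_right _ _ (Ideal.subset_span ⟨i, rfl⟩)

theorem boxCoeff_eq_zero_of_mem_span {q : ℕ} {P : MvPolynomial (Fin 3) k}
    (hP : P ∈ Ideal.span (Set.range fun i : Fin 3 => (X i ^ q : MvPolynomial (Fin 3) k))) :
    boxCoeff k q P = 0 := by
  obtain ⟨c, rfl⟩ := Ideal.mem_span_range_iff_exists_fun.1 hP
  rw [map_sum]
  refine Finset.sum_eq_zero fun i _ => ?_
  rw [mul_comm, boxCoeff_X_pow_mul]

theorem finrank_quotient_span_insert (F : MvPolynomial (Fin 3) k) (q : ℕ) :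
    Module.finrank k (MvPolynomial (Fin 3) k ⧸ Ideal.span (insert F
      (Set.range fun i : Fin 3 => (X i ^ q : MvPolynomial (Fin 3) k)))) =
      Module.finrank k (LinearMap.ker (boxMatrix F q).mulVecLin) := by
  set I := Ideal.span (insert F
      (Set.range fun i : Fin 3 => (X i ^ q : MvPolynomial (Fin 3) k))) with hI
  let ψ := (LinearMap.range (boxMatrix F q).mulVecLin).mkQ ∘ₗ boxCoeff k q
  have hψ : Function.Surjective ψ :=
    (Submodule.mkQ_surjective _).comp fun v => ⟨_, boxCoeff_boxPolynomial v⟩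
  have hker : I.restrictScalars k = LinearMap.ker ψ := by
    ext P
    rw [Submodule.restrictScalars_mem, LinearMap.mem_ker, LinearMap.comp_apply,
      Submodule.mkQ_apply, Submodule.Quotient.mk_eq_zero, hI, Ideal.mem_span_insert]
    constructor
    · rintro ⟨Q, z, hz, rfl⟩
      rw [map_add, boxCoeff_eq_zero_of_mem_span hz, add_zero, mul_comm, boxCoeff_mul]
      exact ⟨_, rfl⟩
    · rintro ⟨v, hv⟩
      refine ⟨boxPolynomial v, P - boxPolynomial v * F, mem_span_of_boxCoeff_eq_zero ?_, by ring⟩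
      rw [map_sub, mul_comm, boxCoeff_mul, boxCoeff_boxPolynomial, ← hv, Matrix.mulVecLin_apply,
        sub_self]
  have e : (MvPolynomial (Fin 3) k ⧸ I) ≃ₗ[k] _ :=
    (Submodule.Quotient.restrictScalarsEquiv k I).symm ≪≫ₗ
      Submodule.quotEquivOfEq _ _ hker ≪≫ₗ ψ.quotKerEquivOfSurjective hψ
  rw [e.finrank_eq]
  have h1 := (LinearMap.range (boxMatrix F q).mulVecLin).finrank_quotient_add_finrank
  have h2 := (boxMatrix F q).mulVecLin.finrank_range_add_finrank_ker
  omega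

theorem boxMatrix_rev (F : MvPolynomial (Fin 3) k) (q : ℕ) (m m' : Fin 3 → Fin q) :
    boxMatrix F q (fun i => (m' i).rev) (fun i => (m i).rev) = boxMatrix F q m m' := by
  classical
  rw [boxMatrix_apply, boxMatrix_apply]
  congr 1
  · simp only [Finsupp.le_def, boxExponent_apply, Fin.val_fin_le, Fin.rev_le_rev]
  · congr 1
    ext i
    simp only [Finsupp.coe_tsub, Pi.sub_apply, boxExponent_apply, Fin.val_rev]
    omega

theorem add_three_of_boxMatrix_ne_zero {F : MvPolynomial (Fin 3) k} (hF : F.IsHomogeneous 3)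
    {q : ℕ} {m m' : Fin 3 → Fin q} (h : boxMatrix F q m m' ≠ 0) :
    (m' 0 + m' 1 + m' 2 + 3 : ℕ) = m 0 + m 1 + m 2 := by
  classical
  rw [boxMatrix_apply] at h
  split_ifs at h with hle
  · have := sum_eq_of_mem_support hF (mem_support_iff.2 h)
    simp only [Finsupp.coe_tsub, Pi.sub_apply, boxExponent_apply] at this
    have h0 := hle 0
    have h1 := hle 1
    have h2 := hle 2
    simp only [boxExponent_apply] at h0 h1 h2
    omega
  · exact absurd rfl h

theorem coeff_mul_homogeneousComponent {F : MvPolynomial (Fin 3) k} {d : ℕ}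
    (hF : F.IsHomogeneous d) (P : MvPolynomial (Fin 3) k) (N : ℕ) {s : Fin 3 →₀ ℕ}
    (hs : s.degree = d + N) : (F * homogeneousComponent N P).coeff s = (F * P).coeff s := by
  classical
  rw [coeff_mul, coeff_mul]
  refine Finset.sum_congr rfl fun a ha => ?_
  rw [Finset.HasAntidiagonal.mem_antidiagonal] at ha
  by_cases h : F.coeff a.1 = 0
  · rw [h, zero_mul, zero_mul]
  · have h1 : a.1.degree = d := by
      rw [Finsupp.degree_eq_weight_one]
      exact hF h
    rw [coeff_homogeneousComponent, if_pos]
    rw [← ha, map_add] at hs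
    omega

theorem finrank_quotient_add_of_forall_eq_zero {F : MvPolynomial (Fin 3) k}
    (hF : F.IsHomogeneous 3) {q : ℕ} (hq : Odd q)
    (hinj : ∀ (N : ℕ) (G : MvPolynomial (Fin 3) k), G.IsHomogeneous N → 2 * N + 7 ≤ 3 * q →
      (∀ m ∈ G.support, ∀ i, m i < q) →
      (∀ m : Fin 3 →₀ ℕ, (∀ i, m i < q) → (F * G).coeff m = 0) → G = 0) :
    Module.finrank k (MvPolynomial (Fin 3) k ⧸ Ideal.span (insert F
      (Set.range fun i : Fin 3 => (X i ^ q : MvPolynomial (Fin 3) k)))) +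
      2 * Fintype.card {m : Fin 3 → Fin q // 2 * (m 0 + m 1 + m 2 : ℕ) + 7 ≤ 3 * q} = q ^ 3 := by
  rw [finrank_quotient_span_insert,
    Matrix.finrank_ker_mulVecLin_of_symm (boxMatrix F q) (c := fun m i => (m i).rev)
    (fun m => by simp) (fun m m' => boxMatrix_rev F q m m')]
  · simp
  · intro m m' h
    have := add_three_of_boxMatrix_ne_zero hF h
    obtain ⟨r, hr⟩ := hq
    simp only [Fin.val_rev]
    omega
  · intro v hv hTv
    have hbox : ∀ s ∈ (boxPolynomial v).support, ∀ i, s i < q := by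
      intro s hs i
      obtain ⟨m, rfl, -⟩ := exists_of_mem_support_boxPolynomial hs
      exact (m i).2
    have hzero : boxPolynomial v = 0 := by
      rw [← sum_homogeneousComponent (boxPolynomial v)]
      refine Finset.sum_eq_zero fun N _ => ?_
      by_cases hN : 2 * N + 7 ≤ 3 * q
      · refine hinj N _ (homogeneousComponent_isHomogeneous N _) hN (fun s hs => hbox s ?_)
          fun s hs => ?_
        · rw [mem_support_iff, coeff_homogeneousComponent] at hs
          rw [mem_support_iff]
          aesop
        · by_contra hne
          have hdeg : s.degree = 3 + N := by
            rw [Finsupp.degree_eq_weight_one]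
            exact (hF.mul (homogeneousComponent_isHomogeneous N _)) hne
          obtain ⟨m, rfl⟩ := exists_boxExponent_eq hs
          rw [coeff_mul_homogeneousComponent hF _ _ hdeg, ← boxCoeff_apply, boxCoeff_mul,
            boxCoeff_boxPolynomial, hTv] at hne
          exact hne rfl
      · ext s
        rw [coeff_homogeneousComponent, coeff_zero]
        split_ifs with hs
        · by_contra hne
          obtain ⟨m, rfl, hm⟩ := exists_of_mem_support_boxPolynomial (mem_support_iff.2 hne)
          refine hm (hv m ?_)
          rw [Finsupp.degree_eq_sum, Fin.sum_univ_three] at hs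
          simp only [boxExponent_apply] at hs
          omega
        · rfl
    rw [← boxCoeff_boxPolynomial v, hzero, map_zero]

end BoxMatrix

section LatticePoints

theorem sum_range_choose_sub (d n q : ℕ) :
    ∑ b ∈ Finset.range q, ((n - b + d).choose (d + 1) : ℤ) =
      (n + (d + 1)).choose (d + 2) - (n - q + (d + 1)).choose (d + 2) := by
  have h (m : ℕ) : ((m + d).choose (d + 1) : ℤ) =
      (m + (d + 1)).choose (d + 2) - (m - 1 + (d + 1)).choose (d + 2) := by
    rcases m with _ | m
    · simp
    · rw [show m + 1 + (d + 1) = m + 1 + d + 1 by ring, Nat.choose_succ_succ (m + 1 + d) (d + 1)]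
      rw [show m + 1 - 1 + (d + 1) = m + 1 + d by omega]
      push_cast
      ring
  simp only [h, Nat.sub_sub]
  exact Finset.sum_range_sub' (fun b => ((n - b + (d + 1)).choose (d + 2) : ℤ)) q

theorem card_sum_lt (n q : ℕ) :
    (Fintype.card {m : Fin 3 → Fin q // (m 0 + m 1 + m 2 : ℕ) < n} : ℤ) =
      (n + 2).choose 3 - 3 * (n - q + 2).choose 3 + 3 * (n - q - q + 2).choose 3 -
        (n - q - q - q + 2).choose 3 := by
  let e : (Fin 3 → Fin q) ≃ Fin q × Fin q × Fin q :=
    ⟨fun m => (m 0, m 1, m 2), fun x => ![x.1, x.2.1, x.2.2],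
      fun m => by ext i; fin_cases i <;> rfl, fun x => rfl⟩
  have h1 (w : ℕ) : ∑ c ∈ Finset.range q, (if c < w then 1 else 0 : ℤ) =
      ((w + 0).choose (0 + 1) - (w - q + 0).choose (0 + 1)) := by
    rw [← Finset.sum_filter, Finset.sum_const, nsmul_one, Nat.add_zero, Nat.add_zero,
      Nat.choose_one_right, Nat.choose_one_right]
    have : (Finset.range q).filter (· < w) = Finset.range (min q w) := by
      ext c
      simp
    rw [this, Finset.card_range]
    omega
  have h2 (w : ℕ) : ∑ b ∈ Finset.range q, ∑ c ∈ Finset.range q, (if b + c < w then 1 else 0 : ℤ) =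
      (w + 1).choose 2 - 2 * (w - q + 1).choose 2 + (w - q - q + 1).choose 2 := by
    have : ∀ b c, b + c < w ↔ c < w - b := fun b c => by omega
    simp only [this, h1, Finset.sum_sub_distrib, Nat.sub_right_comm w _ q, sum_range_choose_sub]
    ring
  rw [Fintype.card_subtype, Finset.card_filter]
  push_cast
  refine (e.sum_comp fun x => (if (x.1 + x.2.1 + x.2.2 : ℕ) < n then 1 else 0 : ℤ)).trans ?_
  simp only [Fintype.sum_prod_type]
  rw [Fin.sum_univ_eq_sum_range fun a : ℕ => ∑ b : Fin q, ∑ c : Fin q,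
    (if a + b + c < n then 1 else 0 : ℤ)]
  have h3 (a : ℕ) : ∑ b : Fin q, ∑ c : Fin q, (if a + b + c < n then 1 else 0 : ℤ) =
      ∑ b ∈ Finset.range q, ∑ c ∈ Finset.range q, (if b + c < n - a then 1 else 0 : ℤ) := by
    rw [← Fin.sum_univ_eq_sum_range fun b : ℕ => ∑ c ∈ Finset.range q,
      (if b + c < n - a then 1 else 0 : ℤ)]
    refine Finset.sum_congr rfl fun b _ => ?_
    rw [← Fin.sum_univ_eq_sum_range fun c : ℕ => (if b + c < n - a then 1 else 0 : ℤ)]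
    refine Finset.sum_congr rfl fun c _ => if_congr (by omega) rfl rfl
  simp only [h3, h2, Finset.sum_add_distrib, Finset.sum_sub_distrib, ← Finset.mul_sum,
    Nat.sub_right_comm n _ q, Nat.sub_right_comm (n - q) _ q]
  have := sum_range_choose_sub 1
  simp only [Nat.reduceAdd] at this
  rw [this, this, this]
  ring

theorem eight_mul_card {q : ℕ} (hq : Odd q) :
    8 * (Fintype.card {m : Fin 3 → Fin q // 2 * (m 0 + m 1 + m 2 : ℕ) + 7 ≤ 3 * q} : ℤ) =
      4 * q ^ 3 - 9 * q ^ 2 + 5 := by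
  obtain ⟨r, rfl⟩ := hq
  have h : Fintype.card {m : Fin 3 → Fin (2 * r + 1) //
      2 * (m 0 + m 1 + m 2 : ℕ) + 7 ≤ 3 * (2 * r + 1)} =
      Fintype.card {m : Fin 3 → Fin (2 * r + 1) // (m 0 + m 1 + m 2 : ℕ) < 3 * r - 1} :=
    Fintype.card_congr (Equiv.subtypeEquivRight fun m => by omega)
  have hc (n : ℕ) : 6 * ((n + 2).choose 3 : ℤ) = (n + 2) * (n + 1) * n := by
    have := Nat.descFactorial_eq_factorial_mul_choose (n + 2) 3
    simp [Nat.descFactorial, Nat.factorial] at this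
    zify at this
    rw [← this]
    ring
  rw [h, card_sum_lt]
  have h2 : 3 * r - 1 - (2 * r + 1) - (2 * r + 1) = 0 := by omega
  rw [h2, Nat.zero_sub]
  rcases r with _ | _ | r
  · simp
  · simp [Nat.choose]
  · have e1 : 3 * (r + 1 + 1) - 1 = 3 * r + 5 := by omega
    have e2 : 3 * r + 5 - (2 * (r + 1 + 1) + 1) = r := by omega
    rw [e1, e2]
    have a1 := hc (3 * r + 5)
    have a2 := hc r
    push_cast at a1 ⊢
    norm_num
    linarith

end LatticePoints

section CommonZeros

variable {k : Type*} [Field k]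

open MvPolynomial

theorem natCast_le_height_vanishingIdeal_zero (n : ℕ) :
    (n : ℕ∞) ≤ (vanishingIdeal k {(0 : Fin n → k)}).height := by
  let f (j : ℕ) : MvPolynomial (Fin n) k →ₐ[k] MvPolynomial (Fin n) k :=
    aeval fun i => if (i : ℕ) < j then 0 else X i
  have hf (j : ℕ) : (f (j + 1)).comp (f j) = f (j + 1) := by
    ext1 i
    simp only [AlgHom.comp_apply, f, aeval_X]
    split_ifs
    · simp
    · omega
    · simp_all
    · simp_all
  have hlt (j : ℕ) (hj : j < n) : RingHom.ker (f j) < RingHom.ker (f (j + 1)) := by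
    refine lt_of_le_of_ne (fun P hP => ?_) fun h => ?_
    · rw [RingHom.mem_ker] at hP ⊢
      rw [← hf, AlgHom.comp_apply, hP, map_zero]
    · have h1 : (X ⟨j, hj⟩ : MvPolynomial (Fin n) k) ∈ RingHom.ker (f j) := by
        rw [h, RingHom.mem_ker]
        simp [f]
      rw [RingHom.mem_ker] at h1
      simp [f] at h1
  have key (j : ℕ) (hj : j ≤ n) : (j : ℕ∞) ≤ (RingHom.ker (f j)).height := by
    induction j with
    | zero => simp
    | succ j ih =>
      have h1 : (RingHom.ker (f j)).IsPrime := RingHom.ker_isPrime _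
      have h2 : (RingHom.ker (f (j + 1))).IsPrime := RingHom.ker_isPrime _
      refine le_trans ?_ (Ideal.height_add_one_le_of_lt_of_isPrime (hlt j hj))
      push_cast
      gcongr
      exact ih (by omega)
  refine (key n le_rfl).trans (Ideal.height_mono fun P hP => ?_)
  rw [mem_vanishingIdeal_singleton_iff]
  have h : ((aeval (0 : Fin n → k)).comp (f n)) = aeval (0 : Fin n → k) := by
    ext1 i
    simp [f]
  rw [← h, AlgHom.comp_apply, (RingHom.mem_ker).1 hP, map_zero]

theorem exists_ne_zero_eval_eq_zero [IsAlgClosed k] {F H : MvPolynomial (Fin 3) k}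
    (hF : eval 0 F = 0) (hH : eval 0 H = 0) : ∃ a ≠ 0, eval a F = 0 ∧ eval a H = 0 := by
  by_contra! hne
  have hmem {a : Fin 3 → k} (haF : eval a F = 0) (haH : eval a H = 0) :
      a ∈ zeroLocus k (Ideal.span {F, H}) := by
    intro P hP
    obtain ⟨b, c, rfl⟩ := Ideal.mem_span_pair.1 hP
    change eval a _ = 0
    simp [haF, haH]
  have hzero : zeroLocus k (Ideal.span {F, H}) = {0} := by
    ext a
    refine ⟨fun ha => ?_, ?_⟩
    · by_contra ha0
      exact hne a ha0 (ha F (Ideal.subset_span (by simp))) (ha H (Ideal.subset_span (by simp)))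
    · rintro rfl
      exact hmem hF hH
  have hrad := vanishingIdeal_zeroLocus_eq_radical (K := k) (Ideal.span {F, H})
  rw [hzero] at hrad
  have htop : Ideal.span {F, H} ≠ ⊤ := by
    intro h
    have := hmem hF hH
    rw [h, zeroLocus_top] at this
    exact this
  have h1 := (Ideal.height_le_spanFinrank _ htop).trans
    (Nat.cast_le.2 (Submodule.spanFinrank_span_le_ncard_of_finite (Set.toFinite _)))
  have h2 : (3 : ℕ∞) ≤ (Ideal.span {F, H}).height := by
    rw [Ideal.height_eq_inf_minimalPrimes]
    refine le_iInf₂ fun J hJ => ?_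
    refine (natCast_le_height_vanishingIdeal_zero (k := k) 3).trans (Ideal.height_mono ?_)
    rw [hrad]
    exact hJ.1.1.radical_le_iff.2 hJ.1.2
  have h3 : 3 ≤ ({F, H} : Set (MvPolynomial (Fin 3) k)).ncard := by exact_mod_cast h2.trans h1
  have h4 := Set.ncard_insert_le F {H}
  rw [Set.ncard_singleton] at h4
  omega

end CommonZeros

section LinearSubstitution

variable {k : Type*} [Field k]

open MvPolynomial

/-- The substitution `Xᵢ ↦ ∑ⱼ Mᵢⱼ Xⱼ`. -/
noncomputable def linearSubst (M : Matrix (Fin 3) (Fin 3) k) :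
    MvPolynomial (Fin 3) k →ₐ[k] MvPolynomial (Fin 3) k :=
  aeval fun i => ∑ j, C (M i j) * X j

theorem linearSubst_X (M : Matrix (Fin 3) (Fin 3) k) (i : Fin 3) :
    linearSubst M (X i) = ∑ j, C (M i j) * X j :=
  aeval_X _ _

theorem linearSubst_C (M : Matrix (Fin 3) (Fin 3) k) (a : k) : linearSubst M (C a) = C a :=
  aeval_C _ _

theorem linearSubst_linearSubst (M N : Matrix (Fin 3) (Fin 3) k) (F : MvPolynomial (Fin 3) k) :
    linearSubst M (linearSubst N F) = linearSubst (N * M) F := by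
  refine DFunLike.congr_fun (algHom_ext (f := (linearSubst M).comp (linearSubst N)) fun i => ?_) F
  simp only [AlgHom.comp_apply, linearSubst_X, map_sum, map_mul, linearSubst_C, Finset.mul_sum,
    Matrix.mul_apply, Finset.sum_mul]
  rw [Finset.sum_comm]
  simp only [mul_assoc]

theorem linearSubst_one (F : MvPolynomial (Fin 3) k) :
    linearSubst (1 : Matrix (Fin 3) (Fin 3) k) F = F := by
  refine DFunLike.congr_fun (algHom_ext (g := AlgHom.id k _) fun i => ?_) F
  simp [linearSubst_X, Matrix.one_apply]

theorem eval_linearSubst (M : Matrix (Fin 3) (Fin 3) k) (a : Fin 3 → k)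
    (F : MvPolynomial (Fin 3) k) : eval a (linearSubst M F) = eval (M.mulVec a) F := by
  rw [← coe_aeval_eq_eval, ← coe_aeval_eq_eval, RingHom.coe_coe, RingHom.coe_coe,
    ← AlgHom.comp_apply]
  congr 1
  ext i
  simp [linearSubst_X, Matrix.mulVec, dotProduct]

theorem isHomogeneous_linearSubst (M : Matrix (Fin 3) (Fin 3) k) {F : MvPolynomial (Fin 3) k}
    {n : ℕ} (hF : F.IsHomogeneous n) : (linearSubst M F).IsHomogeneous n := by
  have := hF.aeval (fun i => ∑ j, C (M i j) * X j) (n := 1) fun i =>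
    IsHomogeneous.sum _ _ _ fun j _ => isHomogeneous_C_mul_X (M i j) j
  rwa [one_mul] at this

theorem pderiv_linearSubst (M : Matrix (Fin 3) (Fin 3) k) (F : MvPolynomial (Fin 3) k)
    (j : Fin 3) :
    pderiv j (linearSubst M F) = ∑ i, C (M i j) * linearSubst M (pderiv i F) := by
  induction F using MvPolynomial.induction_on with
  | C a => simp
  | add P Q hP hQ => simp only [map_add, hP, hQ, mul_add, Finset.sum_add_distrib]
  | mul_X P l hP =>
    have h : pderiv j (linearSubst M (X l)) = C (M l j) := by
      simp [linearSubst_X, pderiv_X, Pi.single_apply]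
    simp only [map_mul, Derivation.leibniz, hP, smul_eq_mul, h, map_add, mul_add,
      Finset.sum_add_distrib]
    congr 1
    · simp only [pderiv_X, Pi.single_apply]
      simp [mul_comm]
    · rw [Finset.mul_sum]
      exact Finset.sum_congr rfl fun i _ => by ring

/-- The substitution attached to an invertible matrix, as an automorphism. -/
noncomputable def linearSubstEquiv (M N : Matrix (Fin 3) (Fin 3) k) (h : M * N = 1) :
    MvPolynomial (Fin 3) k ≃ₐ[k] MvPolynomial (Fin 3) k :=
  AlgEquiv.ofAlgHom (linearSubst M) (linearSubst N)
    (AlgHom.ext fun F => by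
      rw [AlgHom.comp_apply, linearSubst_linearSubst, mul_eq_one_comm.1 h, linearSubst_one]; rfl)
    (AlgHom.ext fun F => by
      rw [AlgHom.comp_apply, linearSubst_linearSubst, h, linearSubst_one]; rfl)

/-- The ideal `(F, X^q, Y^q, Z^q)`. -/
noncomputable def frobeniusIdeal (F : MvPolynomial (Fin 3) k) (q : ℕ) :
    Ideal (MvPolynomial (Fin 3) k) :=
  Ideal.span (insert F (Set.range fun i : Fin 3 => (X i ^ q : MvPolynomial (Fin 3) k)))

theorem map_linearSubst_frobeniusIdeal_le (p : ℕ) [ExpChar k p] (M : Matrix (Fin 3) (Fin 3) k)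
    (F : MvPolynomial (Fin 3) k) (e : ℕ) :
    (frobeniusIdeal F (p ^ e)).map (linearSubst M) ≤
      frobeniusIdeal (linearSubst M F) (p ^ e) := by
  rw [frobeniusIdeal, Ideal.map_span, Ideal.span_le]
  rintro _ ⟨P, rfl | ⟨i, rfl⟩, rfl⟩
  · exact Ideal.subset_span (Set.mem_insert _ _)
  · simp only [map_pow, linearSubst_X, sum_pow_char_pow p, mul_pow]
    exact Ideal.sum_mem _ fun j _ =>
      Ideal.mul_mem_left _ _ (Ideal.subset_span (Set.mem_insert_of_mem _ ⟨j, rfl⟩))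

theorem finrank_quotient_frobeniusIdeal_linearSubst (p : ℕ) [ExpChar k p]
    {M N : Matrix (Fin 3) (Fin 3) k} (h : M * N = 1) (F : MvPolynomial (Fin 3) k) (e : ℕ) :
    Module.finrank k (MvPolynomial (Fin 3) k ⧸ frobeniusIdeal (linearSubst M F) (p ^ e)) =
      Module.finrank k (MvPolynomial (Fin 3) k ⧸ frobeniusIdeal F (p ^ e)) := by
  refine (Ideal.quotientEquivAlg _ _ (linearSubstEquiv M N h) ?_).toLinearEquiv.finrank_eq.symm
  apply le_antisymm
  · have h1 := map_linearSubst_frobeniusIdeal_le p N (linearSubst M F) e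
    rw [linearSubst_linearSubst, h, linearSubst_one] at h1
    have h2 := Ideal.map_mono (f := linearSubst M) h1
    rw [Ideal.map_mapₐ] at h2
    have h3 : (linearSubst M).comp (linearSubst N) = AlgHom.id k _ := AlgHom.ext fun P => by
      rw [AlgHom.comp_apply, linearSubst_linearSubst, mul_eq_one_comm.1 h, linearSubst_one]; rfl
    rw [h3] at h2
    exact (Ideal.map_id _).ge.trans h2
  · exact map_linearSubst_frobeniusIdeal_le p M F e

theorem frobeniusIdeal_C_mul {κ : k} (hκ : κ ≠ 0) (F : MvPolynomial (Fin 3) k) (q : ℕ) :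
    frobeniusIdeal (C κ * F) q = frobeniusIdeal F q := by
  rw [frobeniusIdeal, frobeniusIdeal, Ideal.span_insert, Ideal.span_insert,
    Ideal.span_singleton_mul_left_unit ((isUnit_iff_ne_zero.2 hκ).map C)]

/-- A form is smooth if it has no common zero with its partial derivatives but the origin. -/
def IsSmoothForm (F : MvPolynomial (Fin 3) k) : Prop :=
  ∀ a : Fin 3 → k, eval a F = 0 → (∀ i, eval a (pderiv i F) = 0) → a = 0

theorem IsSmoothForm.linearSubst {F : MvPolynomial (Fin 3) k} (hF : IsSmoothForm F)
    {M N : Matrix (Fin 3) (Fin 3) k} (h : M * N = 1) : IsSmoothForm (linearSubst M F) := by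
  intro a ha hda
  have h0 : M.mulVec a = 0 := by
    refine hF _ (by rwa [← eval_linearSubst]) fun i => ?_
    have h1 : Matrix.vecMul (fun i => eval (M.mulVec a) (pderiv i F)) M = 0 := by
      ext j
      have := hda j
      rw [pderiv_linearSubst, map_sum] at this
      simpa [eval_linearSubst, Matrix.vecMul, dotProduct, mul_comm] using this
    have h2 := congrArg (Matrix.vecMul · N) h1
    simp only [Matrix.vecMul_vecMul, h, Matrix.vecMul_one, Matrix.zero_vecMul] at h2
    exact congrFun h2 i
  have := congrArg N.mulVec h0
  rwa [Matrix.mulVec_mulVec, mul_eq_one_comm.1 h, Matrix.one_mulVec, Matrix.mulVec_zero] at this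

end LinearSubstitution

section Flex

variable {k : Type*} [Field k]

open MvPolynomial

theorem eval_zero_of_isHomogeneous {F : MvPolynomial (Fin 3) k} {n : ℕ} (hF : F.IsHomogeneous n)
    (hn : n ≠ 0) : eval 0 F = 0 := by
  rw [eval_zero, constantCoeff_eq]
  exact hF.coeff_eq_zero (by simpa using hn.symm)

/-- The matrix of second partial derivatives. -/
noncomputable def hessianMatrix (F : MvPolynomial (Fin 3) k) :
    Matrix (Fin 3) (Fin 3) (MvPolynomial (Fin 3) k) :=
  Matrix.of fun i j => pderiv i (pderiv j F)

theorem eval_pderiv_pderiv_linearSubst (M : Matrix (Fin 3) (Fin 3) k) (F : MvPolynomial (Fin 3) k)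
    (a : Fin 3 → k) (i j : Fin 3) :
    eval a (pderiv i (pderiv j (linearSubst M F))) =
      (M.transpose * (hessianMatrix F).map (eval (M.mulVec a)) * M) i j := by
  rw [pderiv_linearSubst, map_sum, map_sum]
  simp only [pderiv_C_mul, pderiv_linearSubst, eval_linearSubst, map_mul, map_sum, eval_C,
    Matrix.mul_apply, hessianMatrix, Matrix.map_apply, Matrix.of_apply, Matrix.transpose_apply]
  exact Finset.sum_congr rfl fun l _ => mul_comm _ _

theorem exists_flex [IsAlgClosed k] {F : MvPolynomial (Fin 3) k} (hF : F.IsHomogeneous 3) :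
    ∃ a ≠ 0, eval a F = 0 ∧ ∃ u ≠ 0, Matrix.vecMul u ((hessianMatrix F).map (eval a)) = 0 := by
  obtain ⟨a, ha, haF, haH⟩ := exists_ne_zero_eval_eq_zero (F := F) (H := (hessianMatrix F).det)
    (eval_zero_of_isHomogeneous hF three_ne_zero) (by
      rw [RingHom.map_det]
      have : (eval (0 : Fin 3 → k)).mapMatrix (hessianMatrix F) = 0 := by
        ext i j
        exact eval_zero_of_isHomogeneous (hF.pderiv.pderiv) (by norm_num)
      rw [this, Matrix.det_zero])
  rw [RingHom.map_det] at haH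
  exact ⟨a, ha, haF, Matrix.exists_vecMul_eq_zero_iff.2 haH⟩

theorem vecMul_hessianMatrix {F : MvPolynomial (Fin 3) k} (hF : F.IsHomogeneous 3)
    (a : Fin 3 → k) (j : Fin 3) :
    Matrix.vecMul a ((hessianMatrix F).map (eval a)) j = 2 * eval a (pderiv j F) := by
  have := congrArg (eval a) (hF.pderiv (i := j)).sum_X_mul_pderiv
  simpa [Matrix.vecMul, dotProduct, hessianMatrix] using this

theorem exists_matrix_of_linearIndependent {u a : Fin 3 → k} (h : LinearIndependent k ![u, a]) :
    ∃ M N : Matrix (Fin 3) (Fin 3) k, M * N = 1 ∧ M.col 0 = u ∧ M.col 1 = a := by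
  obtain ⟨i, hi⟩ := Function.ne_iff.1 (crossProduct_ne_zero_iff_linearIndependent.2 h)
  let M : Matrix (Fin 3) (Fin 3) k := (Matrix.of ![u, a, Pi.single i 1]).transpose
  have hdet : M.det = crossProduct u a i := by
    rw [Matrix.det_transpose, Matrix.det_fin_three, cross_apply]
    fin_cases i
    · simp
    · simp
      ring
    · simp
  refine ⟨M, M⁻¹, Matrix.mul_nonsing_inv _ ?_, rfl, rfl⟩
  rw [hdet]
  exact isUnit_iff_ne_zero.2 hi

theorem exists_linearSubst_flex [IsAlgClosed k] (h2 : (2 : k) ≠ 0) {F : MvPolynomial (Fin 3) k}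
    (hF : F.IsHomogeneous 3) (hFs : IsSmoothForm F) :
    ∃ M N : Matrix (Fin 3) (Fin 3) k, M * N = 1 ∧
      eval (Pi.single 1 1) (linearSubst M F) = 0 ∧
      ∀ i, eval (Pi.single 1 1) (pderiv 0 (pderiv i (linearSubst M F))) = 0 := by
  obtain ⟨a, ha, haF, u, hu, hHu⟩ := exists_flex hF
  have hind : LinearIndependent k ![u, a] := by
    rw [LinearIndependent.pair_iff' hu]
    rintro t rfl
    refine ha (hFs _ haF fun j => ?_)
    have h := vecMul_hessianMatrix hF (t • u) j
    rw [Matrix.smul_vecMul, hHu, smul_zero, Pi.zero_apply] at h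
    exact (mul_eq_zero.1 h.symm).resolve_left h2
  obtain ⟨M, N, hMN, hM0, hM1⟩ := exists_matrix_of_linearIndependent hind
  have hMa : M.mulVec (Pi.single 1 1) = a := by rw [Matrix.mulVec_single_one, hM1]
  refine ⟨M, N, hMN, by rw [eval_linearSubst, hMa, haF], fun i => ?_⟩
  rw [eval_pderiv_pderiv_linearSubst, hMa, Matrix.mul_apply]
  refine Finset.sum_eq_zero fun l _ => ?_
  have : (M.transpose * (hessianMatrix F).map (eval a)) 0 l =
      Matrix.vecMul (M.col 0) ((hessianMatrix F).map (eval a)) l := rfl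
  rw [this, hM0, hHu, Pi.zero_apply, zero_mul]

end Flex

section NormalForm
variable {k : Type*} [Field k]
open MvPolynomial

theorem exists_eq_ternary_cubic {F : MvPolynomial (Fin 3) k} (hF : F.IsHomogeneous 3) :
    ∃ c : (Fin 3 → ℕ) → k,
      F = C (c ![3, 0, 0]) * X 0 ^ 3 + C (c ![2, 1, 0]) * X 0 ^ 2 * X 1 +
        C (c ![2, 0, 1]) * X 0 ^ 2 * X 2 + C (c ![1, 2, 0]) * X 0 * X 1 ^ 2 +
        C (c ![1, 1, 1]) * X 0 * X 1 * X 2 + C (c ![1, 0, 2]) * X 0 * X 2 ^ 2 +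
        C (c ![0, 3, 0]) * X 1 ^ 3 + C (c ![0, 2, 1]) * X 1 ^ 2 * X 2 +
        C (c ![0, 1, 2]) * X 1 * X 2 ^ 2 + C (c ![0, 0, 3]) * X 2 ^ 3 := by
  refine ⟨fun m => F.coeff (Finsupp.equivFunOnFinite.symm m), ?_⟩
  have h : F = ∑ m ∈ Finset.Nat.antidiagonalTuple 3 3,
      monomial (Finsupp.equivFunOnFinite.symm m) (F.coeff (Finsupp.equivFunOnFinite.symm m)) := by
    ext n
    have hn (m : Fin 3 → ℕ) : Finsupp.equivFunOnFinite.symm m = n ↔ m = n := by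
      rw [Equiv.symm_apply_eq]
      rfl
    simp only [coeff_sum, coeff_monomial, hn, Finset.sum_ite_eq', Finset.Nat.mem_antidiagonalTuple]
    split_ifs with hs
    · rw [(hn _).2 rfl]
    · refine hF.coeff_eq_zero fun hd => hs ?_
      simpa [Finsupp.degree_eq_sum] using hd
  have hset : Finset.Nat.antidiagonalTuple 3 3 = {![3, 0, 0], ![2, 1, 0], ![2, 0, 1], ![1, 2, 0],
      ![1, 1, 1], ![1, 0, 2], ![0, 3, 0], ![0, 2, 1], ![0, 1, 2], ![0, 0, 3]} := by decide
  conv_lhs => rw [h, hset]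
  repeat rw [Finset.sum_insert (by decide)]
  simp only [Finset.sum_singleton, monomial_eq, Finsupp.prod_fintype, pow_zero, implies_true,
    Fin.prod_univ_three, Finsupp.equivFunOnFinite_symm_apply_apply]
  simp
  ring

theorem exists_eq_of_flex (h2 : (2 : k) ≠ 0) {F : MvPolynomial (Fin 3) k}
    (hF : F.IsHomogeneous 3) (hFs : IsSmoothForm F) (h0 : eval (Pi.single 1 1) F = 0)
    (h1 : ∀ i, eval (Pi.single 1 1) (pderiv 0 (pderiv i F)) = 0) :
    ∃ a b c d f g : k, b ≠ 0 ∧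
      F = C a * X 0 ^ 3 + X 2 * (C b * X 1 ^ 2 + C c * X 1 * X 2 + C d * X 0 ^ 2 +
        C f * X 0 * X 2 + C g * X 2 ^ 2) := by
  obtain ⟨c, hc⟩ := exists_eq_ternary_cubic hF
  have h030 : c ![0, 3, 0] = 0 := by simpa [hc] using h0
  have h210 : c ![2, 1, 0] = 0 := by
    simpa [hc, pderiv_X, Pi.single_apply, Derivation.leibniz_pow, h2] using h1 0
  have h120 : c ![1, 2, 0] = 0 := by
    simpa [hc, h030, pderiv_X, Pi.single_apply, Derivation.leibniz_pow, h2] using h1 1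
  have h111 : c ![1, 1, 1] = 0 := by
    simpa [hc, pderiv_X, Pi.single_apply, Derivation.leibniz_pow] using h1 2
  rw [h030, h210, h120, h111] at hc
  simp only [C_0, zero_mul, add_zero] at hc
  refine ⟨c ![3, 0, 0], c ![0, 2, 1], c ![0, 1, 2], c ![2, 0, 1], c ![1, 0, 2], c ![0, 0, 3],
    fun hb => ?_, by rw [hc]; ring⟩
  have := congrFun (hFs (Pi.single 1 1) h0 fun i => ?_) 1
  · simp at this
  · fin_cases i <;> simp [hc, hb, pderiv_X, Derivation.leibniz_pow]

theorem exists_roots_of_monic_cubic [IsAlgClosed k] (b c d : k) :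
    ∃ x : Fin 3 → k, b = -(x 0 + x 1 + x 2) ∧ c = x 0 * x 1 + x 0 * x 2 + x 1 * x 2 ∧
      d = -(x 0 * x 1 * x 2) := by
  have ha : (⟨1, b, c, d⟩ : Cubic k).a ≠ 0 := one_ne_zero
  obtain ⟨x, y, z, h⟩ := (Cubic.splits_iff_roots_eq_three (φ := RingHom.id k) ha).1
    (IsAlgClosed.splits _)
  refine ⟨![x, y, z], ?_, ?_, ?_⟩
  · simpa using Cubic.b_eq_three_roots ha h
  · simpa using Cubic.c_eq_three_roots ha h
  · simpa using Cubic.d_eq_three_roots ha h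

theorem injective_of_isSmoothForm_weierstrassForm {x : Fin 3 → k}
    (h : IsSmoothForm (weierstrassForm x)) : Function.Injective x := by
  intro i j hij
  by_contra hne
  have hprod : (∏ l, (X 0 - C (x l) * X 2) : MvPolynomial (Fin 3) k) =
      (X 0 - C (x i) * X 2) * ((X 0 - C (x j) * X 2) *
        ∏ l ∈ (Finset.univ.erase i).erase j, (X 0 - C (x l) * X 2)) := by
    rw [Finset.mul_prod_erase _ (fun l => (X 0 - C (x l) * X 2 : MvPolynomial (Fin 3) k))
        (Finset.mem_erase.2 ⟨Ne.symm hne, Finset.mem_univ j⟩),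
      Finset.mul_prod_erase _ (fun l => (X 0 - C (x l) * X 2 : MvPolynomial (Fin 3) k))
        (Finset.mem_univ i)]
  have := congrFun (h ![x i, 0, 1] ?_ fun l => ?_) 2
  · simp at this
  · simp [weierstrassForm, hprod]
  · simp [weierstrassForm, hprod, Derivation.leibniz_pow, ← hij]

theorem IsSmoothForm.of_C_mul {κ : k} {F : MvPolynomial (Fin 3) k}
    (h : IsSmoothForm (C κ * F)) : IsSmoothForm F :=
  fun a ha hda => h a (by simp [ha]) fun i => by simp [hda i]

theorem not_isSmoothForm_X_two_mul [IsAlgClosed k] {b : k} (hb : b ≠ 0) (c d f g : k) :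
    ¬ IsSmoothForm (X 2 * (C b * X 1 ^ 2 + C c * X 1 * X 2 + C d * X 0 ^ 2 +
      C f * X 0 * X 2 + C g * X 2 ^ 2) : MvPolynomial (Fin 3) k) := by
  intro h
  obtain ⟨y, hy⟩ := IsAlgClosed.exists_pow_nat_eq (-d / b) two_pos
  rw [eq_div_iff hb] at hy
  have := congrFun (h ![1, y, 0] (by simp) fun i => ?_) 0
  · simp at this
  · fin_cases i
    · simp
    · simp
    · simp [Derivation.leibniz_pow]
      linear_combination hy

theorem exists_linearSubst_eq_C_mul_weierstrassForm [IsAlgClosed k] (h2 : (2 : k) ≠ 0)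
    {a b : k} (ha : a ≠ 0) (hb : b ≠ 0) (c d f g : k) :
    ∃ (M N : Matrix (Fin 3) (Fin 3) k) (x : Fin 3 → k), M * N = 1 ∧
      linearSubst M (C a * X 0 ^ 3 + X 2 * (C b * X 1 ^ 2 + C c * X 1 * X 2 + C d * X 0 ^ 2 +
        C f * X 0 * X 2 + C g * X 2 ^ 2)) = C (-a) * weierstrassForm x := by
  obtain ⟨s, hs⟩ := IsAlgClosed.exists_pow_nat_eq (-a / b) two_pos
  have hs0 : s ≠ 0 := by
    rintro rfl
    rw [zero_pow two_ne_zero, eq_comm, div_eq_zero_iff, neg_eq_zero] at hs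
    exact hs.elim ha hb
  rw [eq_div_iff hb] at hs
  obtain ⟨t, ht⟩ : ∃ t : k, 2 * b * t + c = 0 := ⟨-c / (2 * b), by field_simp; ring⟩
  obtain ⟨x, h₁, h₂, h₃⟩ := exists_roots_of_monic_cubic (d / a) (f / a)
    ((g + c * t + b * t ^ 2) / a)
  rw [div_eq_iff ha] at h₁ h₂ h₃
  refine ⟨!![1, 0, 0; 0, s, t; 0, 0, 1], !![1, 0, 0; 0, s⁻¹, -s⁻¹ * t; 0, 0, 1], x, ?_, ?_⟩
  · ext i j
    fin_cases i <;> fin_cases j <;> simp [Matrix.mul_apply, Fin.sum_univ_three, hs0]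
  · obtain rfl : d = _ := h₁
    obtain rfl : f = _ := h₂
    obtain rfl : g = -(x 0 * x 1 * x 2) * a - c * t - b * t ^ 2 := by linear_combination h₃
    obtain rfl : c = -(2 * b * t) := by linear_combination ht
    obtain rfl : a = -(s ^ 2 * b) := by linear_combination hs
    simp only [map_add, map_mul, map_pow, linearSubst_X, linearSubst_C, weierstrassForm,
      Fin.prod_univ_three, Fin.sum_univ_three]
    simp only [Matrix.of_apply, Matrix.cons_val', Matrix.cons_val_zero, Matrix.cons_val_one,
      Matrix.cons_val, map_neg, map_sub, map_mul, map_add, map_pow, C_0, C_1, map_ofNat]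
    ring

theorem exists_linearSubst_eq_weierstrass [IsAlgClosed k] (h2 : (2 : k) ≠ 0)
    {F : MvPolynomial (Fin 3) k} (hF : F.IsHomogeneous 3) (hFs : IsSmoothForm F) :
    ∃ (M N : Matrix (Fin 3) (Fin 3) k) (κ : k) (x : Fin 3 → k), M * N = 1 ∧ κ ≠ 0 ∧
      Function.Injective x ∧ linearSubst M F = C κ * weierstrassForm x := by
  obtain ⟨M₁, N₁, hMN₁, h0, h1⟩ := exists_linearSubst_flex h2 hF hFs
  have hs₁ := hFs.linearSubst hMN₁
  obtain ⟨a, b, c, d, f, g, hb, hG⟩ :=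
    exists_eq_of_flex h2 (isHomogeneous_linearSubst M₁ hF) hs₁ h0 h1
  have ha : a ≠ 0 := by
    rintro rfl
    rw [C_0, zero_mul, zero_add] at hG
    rw [hG] at hs₁
    exact not_isSmoothForm_X_two_mul hb c d f g hs₁
  obtain ⟨M₂, N₂, x, hMN₂, hW⟩ := exists_linearSubst_eq_C_mul_weierstrassForm h2 ha hb c d f g
  rw [← hG] at hW
  have hs₂ := hs₁.linearSubst hMN₂
  rw [hW] at hs₂
  refine ⟨M₁ * M₂, N₂ * N₁, -a, x, ?_, neg_ne_zero.2 ha,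
    injective_of_isSmoothForm_weierstrassForm hs₂.of_C_mul,
    by rw [← linearSubst_linearSubst, hW]⟩
  rw [Matrix.mul_assoc, ← Matrix.mul_assoc M₂, hMN₂, Matrix.one_mul, hMN₁]

end NormalForm

open MvPolynomial

/-- The Hilbert–Kunz function of the maximal ideal `(X,Y,Z)` of the homogeneous coordinate
ring `k[X,Y,Z]/(F)` of a smooth plane cubic over an algebraically closed field of
characteristic `p ≥ 3` is `φ(q) = (9/4)q² − 5/4`, i.e. `4·φ(q) = 9q² − 5` for `q = p^e`. -/
theorem hilbert_kunz_function_smooth_plane_cubic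
    (k : Type*) [Field k] [IsAlgClosed k] (p : ℕ) (hp : 3 ≤ p) [CharP k p]
    (F : MvPolynomial (Fin 3) k) (hF : F.IsHomogeneous 3)
    (hsmooth : ∀ a : Fin 3 → k,
      eval a F = 0 → (∀ i : Fin 3, eval a (pderiv i F) = 0) → a = 0) :
    ∀ e : ℕ,
      (4 * Module.finrank k
          (MvPolynomial (Fin 3) k ⧸
            Ideal.span {F, X 0 ^ p ^ e, X 1 ^ p ^ e, X 2 ^ p ^ e}) : ℤ) =
        9 * ((p : ℤ) ^ e) ^ 2 - 5 := by
  intro e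
  have hp' : p.Prime := (CharP.char_is_prime_or_zero k p).resolve_right (by omega)
  have : Fact p.Prime := ⟨hp'⟩
  have : ExpChar k p := .prime hp'
  have hp2 : p ≠ 2 := by omega
  have hq : Odd (p ^ e) := (hp'.odd_of_ne_two hp2).pow
  obtain ⟨M, N, κ, x, hMN, hκ, hx, hW⟩ :=
    exists_linearSubst_eq_weierstrass (Ring.two_ne_zero ((ringChar.eq k p).trans_ne hp2)) hF
      hsmooth
  have hI : Ideal.span {F, X 0 ^ p ^ e, X 1 ^ p ^ e, X 2 ^ p ^ e} = frobeniusIdeal F (p ^ e) := by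
    rw [frobeniusIdeal]
    congr 2
    ext P
    simp [Fin.exists_fin_succ, eq_comm]
  have hdim := finrank_quotient_add_of_forall_eq_zero (isHomogeneous_weierstrassForm x) hq
    fun N G hG hN hGbox hFG => eq_zero_of_coeff_weierstrassForm_mul p hp2 hx e hG hN hGbox hFG
  change Module.finrank k (_ ⧸ frobeniusIdeal (weierstrassForm x) (p ^ e)) + _ = _ at hdim
  rw [← frobeniusIdeal_C_mul hκ, ← hW, finrank_quotient_frobeniusIdeal_linearSubst p hMN F e,
    ← hI] at hdim
  have hcard := eight_mul_card hq
  have hdim' := congrArg (Nat.cast (R := ℤ)) hdim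
  rw [Nat.cast_add, Nat.cast_mul] at hdim'
  push_cast at hcard hdim'
  linarith
end

section
/- Let k be an algebraically closed field of characteristic 2 and let R = k[X,Y,Z]/(X³+Y³+Z³) be the homogeneous coordinate ring of the Fermat cubic (a supersingular elliptic curve, of Hasse invariant 0, in characteristic 2). Then the Hilbert–Kunz function of the maximal ideal (X,Y,Z) satisfies: dim_k(R/(X,Y,Z)) = 1, dim_k(R/(X²,Y²,Z²)) = 8, and for every e ≥ 2, writing q = 2^e, 4 · dim_k( k[X,Y,Z]/(X³+Y³+Z³, X^q, Y^q, Z^q) ) = 9q². -/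
open MvPolynomial

/-- If multiplication by `c` identifies `J` with the colon ideal `I : c`, then
`dim A/I = dim A/J + dim A/(I + c)`. -/
lemma length_quotient_eq_add_of_colon (k : Type*) {A : Type*} [Field k] [CommRing A] [Algebra k A]
    (s : Set A) (J : Ideal A) (c : A) (h : ∀ t, t ∈ J ↔ c * t ∈ Ideal.span s) :
    Module.length k (A ⧸ Ideal.span s) =
      Module.length k (A ⧸ J) + Module.length k (A ⧸ Ideal.span (insert c s)) := by
  have hle : Ideal.span s ≤ Ideal.span (insert c s) := Ideal.span_mono (Set.subset_insert c s)
  let F : A →ₗ[k] A ⧸ Ideal.span s :=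
    (Ideal.Quotient.mkₐ k (Ideal.span s)).toLinearMap ∘ₗ LinearMap.mulLeft k c
  have hF : ∀ t, F t = Ideal.Quotient.mk (Ideal.span s) (c * t) := fun t => rfl
  let g : (A ⧸ J) →ₗ[k] A ⧸ Ideal.span s :=
    Submodule.liftQ (J.restrictScalars k) F (fun t ht => by
      rw [LinearMap.mem_ker, hF, Ideal.Quotient.eq_zero_iff_mem]
      exact (h t).1 ht)
  have hg : ∀ t, g (Ideal.Quotient.mk J t) = Ideal.Quotient.mk (Ideal.span s) (c * t) :=
    fun t => rfl
  let q : (A ⧸ Ideal.span s) →ₗ[k] A ⧸ Ideal.span (insert c s) :=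
    (Ideal.Quotient.factorₐ k hle).toLinearMap
  have hq : ∀ t, q (Ideal.Quotient.mk _ t) = Ideal.Quotient.mk _ t := fun t => rfl
  refine Module.length_eq_add_of_exact g q ?_ ?_ ?_
  · rw [← LinearMap.ker_eq_bot, LinearMap.ker_eq_bot']
    intro m hm
    obtain ⟨t, rfl⟩ := Ideal.Quotient.mk_surjective m
    rw [hg, Ideal.Quotient.eq_zero_iff_mem, ← h] at hm
    exact Ideal.Quotient.eq_zero_iff_mem.2 hm
  · intro m
    obtain ⟨t, rfl⟩ := Ideal.Quotient.mk_surjective m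
    exact ⟨Ideal.Quotient.mk _ t, rfl⟩
  · intro m
    obtain ⟨t, rfl⟩ := Ideal.Quotient.mk_surjective m
    rw [hq, Ideal.Quotient.eq_zero_iff_mem, Ideal.mem_span_insert]
    constructor
    · rintro ⟨a, z, hz, rfl⟩
      refine ⟨Ideal.Quotient.mk _ a, ?_⟩
      rw [hg, Ideal.Quotient.mk_eq_mk_iff_sub_mem]
      have : c * a - (a * c + z) = -z := by ring
      rw [this]
      exact neg_mem hz
    · rintro ⟨n, hn⟩
      obtain ⟨a, rfl⟩ := Ideal.Quotient.mk_surjective n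
      rw [hg, Ideal.Quotient.mk_eq_mk_iff_sub_mem] at hn
      exact ⟨a, -(c * a - t), neg_mem hn, by ring⟩

lemma length_quotient_mul (k : Type*) {A : Type*} [Field k] [CommRing A] [Algebra k A]
    (s : Set A) (b c : A) (h : ∀ t, b * t ∈ Ideal.span s → t ∈ Ideal.span s) :
    Module.length k (A ⧸ Ideal.span (insert (b * c) s)) =
      Module.length k (A ⧸ Ideal.span (insert c s)) +
        Module.length k (A ⧸ Ideal.span (insert b s)) := by
  have hspan : Ideal.span (insert b (insert (b * c) s)) = Ideal.span (insert b s) := by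
    apply le_antisymm
    · rw [Ideal.span_le, Set.insert_subset_iff, Set.insert_subset_iff]
      refine ⟨Ideal.subset_span (Set.mem_insert _ _),
        Ideal.mul_mem_right _ _ (Ideal.subset_span (Set.mem_insert _ _)),
        (Set.subset_insert b s).trans Ideal.subset_span⟩
    · exact Ideal.span_mono (Set.insert_subset_insert (Set.subset_insert _ _))
  rw [length_quotient_eq_add_of_colon k (insert (b * c) s) (Ideal.span (insert c s)) b, hspan]
  intro t
  rw [Ideal.mem_span_insert, Ideal.mem_span_insert]
  constructor
  · rintro ⟨a, z, hz, rfl⟩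
    exact ⟨a, b * z, Ideal.mul_mem_left _ _ hz, by ring⟩
  · rintro ⟨a, z, hz, e⟩
    refine ⟨a, t - a * c, h _ ?_, by ring⟩
    have : b * (t - a * c) = z := by linear_combination e
    rwa [this]

lemma length_quotient_pow (k : Type*) {A : Type*} [Field k] [CommRing A] [Algebra k A]
    (s : Set A) (b : A) (h : ∀ t, b * t ∈ Ideal.span s → t ∈ Ideal.span s) (n : ℕ) :
    Module.length k (A ⧸ Ideal.span (insert (b ^ n) s)) =
      n * Module.length k (A ⧸ Ideal.span (insert b s)) := by
  induction n with
  | zero =>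
    have : Ideal.span (insert (b ^ 0) s) = ⊤ := by
      rw [Ideal.eq_top_iff_one]
      exact Ideal.subset_span (by simp)
    have : Subsingleton (A ⧸ Ideal.span (insert (b ^ 0) s)) := Ideal.Quotient.subsingleton_iff.2 this
    simp
  | succ n ih =>
    rw [pow_succ', length_quotient_mul k s b (b ^ n) h, ih]
    push_cast
    ring

section Regular

variable {A : Type*} [CommRing A]

lemma dvd_of_dvd_pow_mul {a b : A} (h : ∀ t, b ∣ a * t → b ∣ t) (n : ℕ) :
    ∀ t, b ∣ a ^ n * t → b ∣ t := by
  induction n with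
  | zero => simp
  | succ n ih =>
    intro t ht
    rw [pow_succ', mul_assoc] at ht
    exact ih _ (h _ ht)

lemma dvd_of_dvd_mul_symm {a b : A} (hb : ∀ t, b * t = 0 → t = 0)
    (h : ∀ t, b ∣ a * t → b ∣ t) : ∀ t, a ∣ b * t → a ∣ t := by
  rintro t ⟨r, hr⟩
  obtain ⟨s, rfl⟩ := h r ⟨t, hr.symm⟩
  exact ⟨s, sub_eq_zero.1 (hb _ (by linear_combination hr))⟩

lemma eq_zero_of_pow_mul {a : A} (h : ∀ t, a * t = 0 → t = 0) (n : ℕ) :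
    ∀ t, a ^ n * t = 0 → t = 0 := by
  induction n with
  | zero => simp
  | succ n ih =>
    intro t ht
    rw [pow_succ', mul_assoc] at ht
    exact ih _ (h _ ht)

lemma dvd_of_pow_dvd_pow_mul {a b : A} (ha : ∀ t, a * t = 0 → t = 0)
    (hb : ∀ t, b * t = 0 → t = 0) (h : ∀ t, b ∣ a * t → b ∣ t) (m n : ℕ) :
    ∀ t, b ^ n ∣ a ^ m * t → b ^ n ∣ t :=
  dvd_of_dvd_mul_symm (eq_zero_of_pow_mul ha m)
    (dvd_of_dvd_pow_mul (dvd_of_dvd_mul_symm hb (dvd_of_dvd_pow_mul h m)) n)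

/-- The linkage `(x⁴, y⁴) : z⁴ = (z², xy)` in characteristic two on `x³ + y³ + z³ = 0`. -/
lemma mem_span_sq_mul_iff {x y z : A} (h2 : (2 : A) = 0) (hf : x ^ 3 + y ^ 3 + z ^ 3 = 0)
    (hx : ∀ t, x * t = 0 → t = 0) (hy : ∀ t, y * t = 0 → t = 0)
    (hxy : ∀ t, y ∣ x * t → y ∣ t)
    (hzx : ∀ t, x ∣ z * t → x ∣ t) (hzy : ∀ t, y ∣ z * t → y ∣ t) (s : A) :
    s ∈ Ideal.span {z ^ 2, x * y} ↔ z ^ 4 * s ∈ Ideal.span {x ^ 4, y ^ 4} := by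
  rw [Ideal.mem_span_pair, Ideal.mem_span_pair]
  constructor
  · rintro ⟨a, b, rfl⟩
    refine ⟨a * x ^ 2 + b * y * z, a * y ^ 2 + b * x * z, ?_⟩
    linear_combination (-a * (z ^ 3 - x ^ 3 - y ^ 3) - b * x * y * z) * hf +
      (-a * x ^ 3 * y ^ 3 + b * x * y * z * (x ^ 3 + y ^ 3)) * h2
  · rintro ⟨a, b, e⟩
    have hyx := dvd_of_dvd_mul_symm hy hxy
    have hx2 := eq_zero_of_pow_mul hx 2
    have hy2 := eq_zero_of_pow_mul hy 2
    have e1 : x ^ 2 * (s * x * z - a * x ^ 2) = y ^ 2 * (b * y ^ 2 - s * y * z) := by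
      linear_combination s * z * hf - e - s * z ^ 4 * h2
    obtain ⟨c, hc⟩ := dvd_of_pow_dvd_pow_mul hx hy hxy 2 2 _ ⟨_, e1⟩
    have e2 : x ^ 2 * c = b * y ^ 2 - s * y * z :=
      sub_eq_zero.1 (hy2 _ (by linear_combination e1 - x ^ 2 * hc))
    obtain ⟨c, rfl⟩ := dvd_of_dvd_pow_mul hyx 2 c ⟨s * z - a * x, by linear_combination -hc⟩
    have e3 : s * z - a * x = y ^ 2 * c :=
      sub_eq_zero.1 (hx _ (by linear_combination hc))
    obtain ⟨d, rfl⟩ := dvd_of_dvd_pow_mul hxy 3 c ⟨b * y - s * z, by linear_combination e2⟩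
    have e4 : x ^ 3 * d = b * y - s * z :=
      sub_eq_zero.1 (hy _ (by linear_combination e2))
    obtain ⟨m, hm⟩ := hxy (a + d * x ^ 2) ⟨b - d * y ^ 2, by linear_combination e4 - e3⟩
    have e5 : z * (s - d * z ^ 2) = x * (y * m) := by
      linear_combination e3 + x * hm - d * hf + d * y ^ 3 * h2
    obtain ⟨t, ht⟩ := hzx _ ⟨_, e5⟩
    have e6 : z * t = y * m :=
      sub_eq_zero.1 (hx _ (by linear_combination e5 - z * ht))
    obtain ⟨t, rfl⟩ := hzy _ ⟨_, e6⟩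
    exact ⟨d, t, by linear_combination -ht⟩

/-- Colength of the ideals `(xⁿ, yⁿ, zⁿ)`, `n = 4 · 2 ^ m`, when any two of `x, y, z` form a
regular sequence of colength `3`. -/
lemma length_quotient_four_mul_two_pow (k : Type*) [Field k] [Algebra k A] {x : Fin 3 → A}
    (h2 : (2 : A) = 0) (hf : x 0 ^ 3 + x 1 ^ 3 + x 2 ^ 3 = 0)
    (hz : ∀ i t, x i * t = 0 → t = 0) (hd : ∀ i j, i ≠ j → ∀ t, x j ∣ x i * t → x j ∣ t)
    (hl : ∀ i j, i ≠ j → Module.length k (A ⧸ Ideal.span {x i, x j}) = 3) (m : ℕ) :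
    Module.length k (A ⧸ Ideal.span {x 2 ^ (2 ^ m * 4), x 0 ^ (2 ^ m * 4), x 1 ^ (2 ^ m * 4)}) =
      36 * (2 ^ m) ^ 2 := by
  have hreg : ∀ i j, i ≠ j → ∀ m n t, x j ^ n ∣ x i ^ m * t → x j ^ n ∣ t := fun i j hij m n =>
    dvd_of_pow_dvd_pow_mul (hz i) (hz j) (hd i j hij) m n
  have hpair : ∀ i j, i ≠ j → ∀ m n : ℕ,
      Module.length k (A ⧸ Ideal.span {x i ^ m, x j ^ n}) = m * n * 3 := by
    intro i j hij m n
    rw [length_quotient_pow k {x j ^ n} (x i), Set.pair_comm, length_quotient_pow k {x i} (x j),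
      Set.pair_comm, hl i j hij, mul_assoc]
    · intro t
      simpa only [Ideal.mem_span_singleton] using hd j i hij.symm t
    · intro t
      simpa only [Ideal.mem_span_singleton, pow_one] using hreg i j hij 1 n t
  have hfm : (x 0 ^ 2 ^ m) ^ 3 + (x 1 ^ 2 ^ m) ^ 3 + (x 2 ^ 2 ^ m) ^ 3 = 0 := by
    induction m with
    | zero => simpa using hf
    | succ m ih =>
      simp only [pow_succ 2, pow_mul _ (2 ^ m) 2]
      generalize x 0 ^ 2 ^ m = X at *
      generalize x 1 ^ 2 ^ m = Y at *
      generalize x 2 ^ 2 ^ m = Z at *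
      linear_combination (X ^ 3 + Y ^ 3 + Z ^ 3) * ih -
        (X ^ 3 * Y ^ 3 + X ^ 3 * Z ^ 3 + Y ^ 3 * Z ^ 3) * h2
  have hcolon := length_quotient_eq_add_of_colon k {(x 0 ^ 2 ^ m) ^ 4, (x 1 ^ 2 ^ m) ^ 4}
    (Ideal.span {(x 2 ^ 2 ^ m) ^ 2, x 0 ^ 2 ^ m * x 1 ^ 2 ^ m}) ((x 2 ^ 2 ^ m) ^ 4)
    (mem_span_sq_mul_iff h2 hfm (eq_zero_of_pow_mul (hz 0) _) (eq_zero_of_pow_mul (hz 1) _)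
      (hreg 0 1 (by decide) _ _) (hreg 2 0 (by decide) _ _) (hreg 2 1 (by decide) _ _))
  rw [Set.pair_comm (_ ^ 2) (_ * _), length_quotient_mul k] at hcolon
  · rw [← pow_mul, ← pow_mul, ← pow_mul, ← pow_mul, hpair 0 1 (by decide), hpair 0 2 (by decide),
      hpair 1 2 (by decide)] at hcolon
    generalize Module.length k (A ⧸ Ideal.span {x 2 ^ (2 ^ m * 4), _, _}) = L at *
    have hL : L ≠ ⊤ := by
      rintro rfl
      rw [add_top] at hcolon
      exact ENat.natCast_ne_top (2 ^ m * 4 * (2 ^ m * 4) * 3) (by exact_mod_cast hcolon)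
    lift L to ℕ using hL
    norm_cast at hcolon ⊢
    linarith
  · intro t
    simpa only [Ideal.mem_span_singleton, ← pow_mul] using hreg 0 2 (by decide) _ _ t

end Regular

section Cubic

variable {k : Type*} [Field k]

lemma mem_span_pow_pair_of_X_mul_mem {σ : Type*} {i j l : σ} (hij : i ≠ j) (hil : i ≠ l) (m n : ℕ)
    {t : MvPolynomial σ k} (h : X i * t ∈ Ideal.span {X j ^ m, X l ^ n}) :
    t ∈ Ideal.span {X j ^ m, X l ^ n} := by
  have himage : ({X j ^ m, X l ^ n} : Set (MvPolynomial σ k)) =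
      (fun e => monomial e 1) '' {Finsupp.single j m, Finsupp.single l n} := by
    rw [Set.image_pair, X_pow_eq_monomial, X_pow_eq_monomial]
  rw [himage, mem_ideal_span_monomial_image] at h ⊢
  intro u hu
  obtain ⟨e, he, hle⟩ := h (Finsupp.single i 1 + u) (by
    rw [mem_support_iff, coeff_X_mul]
    exact mem_support_iff.1 hu)
  refine ⟨e, he, ?_⟩
  rcases he with rfl | rfl <;> rw [Finsupp.single_le_iff] at hle ⊢ <;>
    simpa [Finsupp.single_apply, hij, hil] using hle

lemma mem_span_X_pair_of_X_mul_mem {σ : Type*} {i j l : σ} (hij : i ≠ j) (hil : i ≠ l)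
    {t : MvPolynomial σ k} (h : X i * t ∈ Ideal.span {X j, X l}) : t ∈ Ideal.span {X j, X l} := by
  simpa only [pow_one] using
    mem_span_pow_pair_of_X_mul_mem hij hil 1 1 (by simpa only [pow_one] using h)

lemma length_quotient_span_X (σ : Type*) :
    Module.length k (MvPolynomial σ k ⧸ Ideal.span (Set.range X : Set (MvPolynomial σ k))) = 1 := by
  have hker : RingHom.ker (aeval (0 : σ → k)) =
      Ideal.span (Set.range X : Set (MvPolynomial σ k)) := by
    ext p
    rw [← Set.image_univ, mem_ideal_span_X_image, RingHom.mem_ker, aeval_zero,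
      Algebra.algebraMap_self_apply, constantCoeff_eq]
    constructor
    · intro h m hm
      by_contra! hm0
      obtain rfl : m = 0 := Finsupp.ext fun i => hm0 i (Set.mem_univ i)
      exact mem_support_iff.1 hm h
    · intro h
      by_contra hne
      obtain ⟨i, -, hi⟩ := h 0 (mem_support_iff.2 hne)
      exact hi rfl
  have hsurj : Function.Surjective (aeval (0 : σ → k)) := fun a => ⟨C a, by simp⟩
  rw [← hker, (Ideal.quotientKerAlgEquivOfSurjective hsurj).toLinearEquiv.length_eq,
    Module.length_eq_finrank, Module.finrank_self, Nat.cast_one]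

lemma length_quotient_span_X_triple {i j l : Fin 3} (hij : i ≠ j) (hil : i ≠ l) (hjl : j ≠ l) :
    Module.length k
      (MvPolynomial (Fin 3) k ⧸ Ideal.span {(X l : MvPolynomial (Fin 3) k), X i, X j}) = 1 := by
  rw [← length_quotient_span_X (k := k) (Fin 3)]
  have hrange : Set.range (X : Fin 3 → MvPolynomial (Fin 3) k) = {X l, X i, X j} := by
    ext p
    simp only [Set.mem_range, Set.mem_insert_iff, Set.mem_singleton_iff]
    constructor
    · rintro ⟨y, rfl⟩
      obtain rfl | rfl | rfl : y = l ∨ y = i ∨ y = j := by omega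
      · exact Or.inl rfl
      · exact Or.inr (Or.inl rfl)
      · exact Or.inr (Or.inr rfl)
    · rintro (rfl | rfl | rfl) <;> exact ⟨_, rfl⟩
  rw [hrange]

variable {i j l : Fin 3} {f : MvPolynomial (Fin 3) k}

lemma X_dvd_of_X_dvd_X_mul {σ : Type*} {i j : σ} (hij : i ≠ j) {t : MvPolynomial σ k}
    (h : X j ∣ X i * t) : X j ∣ t := by
  rw [← Ideal.mem_span_singleton, ← Set.pair_eq_singleton] at h ⊢
  exact mem_span_X_pair_of_X_mul_mem hij hij h

lemma mem_span_X_pair_of_cubic_mul (hil : i ≠ l) (hjl : j ≠ l)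
    (hf : f = X i ^ 3 + X j ^ 3 + X l ^ 3) {g : MvPolynomial (Fin 3) k}
    (h : f * g ∈ Ideal.span {(X i : MvPolynomial (Fin 3) k), X j}) :
    g ∈ Ideal.span {(X i : MvPolynomial (Fin 3) k), X j} := by
  have key : ∀ t : MvPolynomial (Fin 3) k, X l * t ∈ Ideal.span {X i, X j} →
      t ∈ Ideal.span {X i, X j} :=
    fun t => mem_span_X_pair_of_X_mul_mem hil.symm hjl.symm
  refine key _ (key _ (key _ ?_))
  obtain ⟨a, b, e⟩ := Ideal.mem_span_pair.1 h
  rw [Ideal.mem_span_pair]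
  exact ⟨a - X i ^ 2 * g, b - X j ^ 2 * g, by rw [hf] at e; linear_combination e⟩

lemma dvd_of_dvd_X_mul_of_cubic (hij : i ≠ j) (hf : f = X i ^ 3 + X j ^ 3 + X l ^ 3)
    (hjl : j ≠ l) {t : MvPolynomial (Fin 3) k} (h : f ∣ X i * t) : f ∣ t := by
  obtain ⟨g, hg⟩ := h
  have hdvd : X i ∣ f * g := ⟨t, hg.symm⟩
  have hndvd : ¬ X i ∣ f := by
    rintro ⟨r, hr⟩
    have := congr_arg (eval (Pi.single j 1)) (hf.symm.trans hr)
    simp [hij, hjl.symm] at this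
  obtain ⟨s, rfl⟩ := ((X_prime.dvd_or_dvd hdvd).resolve_left hndvd)
  exact ⟨s, mul_left_cancel₀ (X_ne_zero i) (by linear_combination hg)⟩

lemma exists_eq_add_of_X_mul_eq (hij : i ≠ j) (hil : i ≠ l) (hjl : j ≠ l)
    (hf : f = X i ^ 3 + X j ^ 3 + X l ^ 3) {t r g : MvPolynomial (Fin 3) k}
    (h : X i * t = X j * r + f * g) : ∃ a b, t = X j * a + f * b := by
  obtain ⟨a, b, rfl⟩ := Ideal.mem_span_pair.1 (mem_span_X_pair_of_cubic_mul hil hjl hf (g := g)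
    (Ideal.mem_span_pair.2 ⟨t, -r, by linear_combination h⟩))
  obtain ⟨c, hc⟩ := X_dvd_of_X_dvd_X_mul hij (t := t - f * a)
    ⟨r + f * b, by linear_combination h⟩
  exact ⟨c, a, by linear_combination hc⟩

lemma length_quotient_quotient (f : MvPolynomial (Fin 3) k) (s : Set (MvPolynomial (Fin 3) k)) :
    Module.length k ((MvPolynomial (Fin 3) k ⧸ Ideal.span {f}) ⧸
        Ideal.span (Ideal.Quotient.mk (Ideal.span {f}) '' s)) =
      Module.length k (MvPolynomial (Fin 3) k ⧸ Ideal.span (insert f s)) := by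
  rw [Ideal.span_insert, ← Ideal.map_span]
  exact (DoubleQuot.quotQuotEquivQuotSupₐ k (Ideal.span {f}) (Ideal.span s)).toLinearEquiv.length_eq

lemma length_quotient_cubic_pair (hij : i ≠ j) (hil : i ≠ l) (hjl : j ≠ l)
    (hf : f = X i ^ 3 + X j ^ 3 + X l ^ 3) :
    Module.length k
      (MvPolynomial (Fin 3) k ⧸ Ideal.span {f, X i, X j}) = 3 := by
  have : Ideal.span {f, X i, X j} = Ideal.span {X l ^ 3, X i, X j} := by
    ext p
    rw [Ideal.mem_span_insert, Ideal.mem_span_insert]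
    have hmem : X i ^ 3 + X j ^ 3 ∈ Ideal.span {(X i : MvPolynomial (Fin 3) k), X j} :=
      Ideal.mem_span_pair.2 ⟨X i ^ 2, X j ^ 2, by ring⟩
    constructor
    · rintro ⟨a, z, hz, rfl⟩
      exact ⟨a, a * (X i ^ 3 + X j ^ 3) + z, add_mem (Ideal.mul_mem_left _ _ hmem) hz,
        by rw [hf]; ring⟩
    · rintro ⟨a, z, hz, rfl⟩
      exact ⟨a, z - a * (X i ^ 3 + X j ^ 3), sub_mem hz (Ideal.mul_mem_left _ _ hmem),
        by rw [hf]; ring⟩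
  rw [this, length_quotient_pow k {X i, X j} (X l), length_quotient_span_X_triple hij hil hjl]
  · simp
  · exact fun t => mem_span_X_pair_of_X_mul_mem hil.symm hjl.symm

lemma length_quotient_span_X_sq_triple :
    Module.length k (MvPolynomial (Fin 3) k ⧸
      Ideal.span {(X 0 ^ 2 : MvPolynomial (Fin 3) k), X 1 ^ 2, X 2 ^ 2}) = 8 := by
  rw [length_quotient_pow k {X 1 ^ 2, X 2 ^ 2} (X 0), Set.insert_comm,
    length_quotient_pow k {X 0, X 2 ^ 2} (X 1), Set.pair_comm (X 0), Set.insert_comm,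
    length_quotient_pow k {X 1, X 0} (X 2),
    length_quotient_span_X_triple (by decide) (by decide) (by decide)]
  · norm_num
  · exact fun t => mem_span_X_pair_of_X_mul_mem (by decide) (by decide)
  · intro t ht
    simpa only [pow_one] using mem_span_pow_pair_of_X_mul_mem (i := (1 : Fin 3)) (j := 0) (l := 2)
      (by decide) (by decide) 1 2 (by simpa only [pow_one] using ht)
  · exact fun t => mem_span_pow_pair_of_X_mul_mem (by decide) (by decide) 2 2

lemma length_quotient_cubic_four_mul_two_pow [CharP k 2] (m : ℕ) :
    Module.length k (MvPolynomial (Fin 3) k ⧸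
      Ideal.span {(X 0 ^ 3 + X 1 ^ 3 + X 2 ^ 3 : MvPolynomial (Fin 3) k),
        X 0 ^ (2 ^ m * 4), X 1 ^ (2 ^ m * 4), X 2 ^ (2 ^ m * 4)}) = 36 * (2 ^ m) ^ 2 := by
  set f : MvPolynomial (Fin 3) k := X 0 ^ 3 + X 1 ^ 3 + X 2 ^ 3 with hf
  let π := Ideal.Quotient.mk (Ideal.span {f})
  have hπ : ∀ t, π t = 0 ↔ f ∣ t := fun t => by
    rw [Ideal.Quotient.eq_zero_iff_mem, Ideal.mem_span_singleton]
  have hthird : ∀ i j : Fin 3, i ≠ j →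
      ∃ l, i ≠ l ∧ j ≠ l ∧ f = X i ^ 3 + X j ^ 3 + X l ^ 3 := by
    intro i j hij
    fin_cases i <;> fin_cases j
    · exact absurd rfl hij
    · exact ⟨2, by decide, by decide, rfl⟩
    · exact ⟨1, by decide, by decide, add_right_comm _ _ _⟩
    · exact ⟨2, by decide, by decide,
        show f = X 1 ^ 3 + X 0 ^ 3 + X 2 ^ 3 by simp only [hf]; ring⟩
    · exact absurd rfl hij
    · exact ⟨0, by decide, by decide,
        show f = X 1 ^ 3 + X 2 ^ 3 + X 0 ^ 3 by simp only [hf]; ring⟩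
    · exact ⟨1, by decide, by decide,
        show f = X 2 ^ 3 + X 0 ^ 3 + X 1 ^ 3 by simp only [hf]; ring⟩
    · exact ⟨0, by decide, by decide,
        show f = X 2 ^ 3 + X 1 ^ 3 + X 0 ^ 3 by simp only [hf]; ring⟩
    · exact absurd rfl hij
  have h := length_quotient_four_mul_two_pow k (x := fun i => π (X i)) ?_ ?_ ?_ ?_ ?_ m
  · have himage : π '' {X 0 ^ (2 ^ m * 4), X 1 ^ (2 ^ m * 4), X 2 ^ (2 ^ m * 4)} =
        {π (X 2) ^ (2 ^ m * 4), π (X 0) ^ (2 ^ m * 4), π (X 1) ^ (2 ^ m * 4)} := by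
      rw [Set.image_insert_eq, Set.image_pair, map_pow, map_pow, map_pow,
        Set.pair_comm (π (X 1) ^ _), Set.insert_comm]
    rw [← h, ← length_quotient_quotient, himage]
  · rw [← map_ofNat π 2, CharTwo.two_eq_zero, map_zero]
  · simp only [← map_pow, ← map_add]
    exact (hπ f).2 dvd_rfl
  · intro i t
    obtain ⟨t, rfl⟩ := Ideal.Quotient.mk_surjective t
    obtain ⟨j, hij⟩ := exists_ne i
    obtain ⟨l, hil, hjl, hl⟩ := hthird i j hij.symm
    change π (X i) * π t = 0 → π t = 0
    rw [← map_mul, hπ, hπ]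
    exact dvd_of_dvd_X_mul_of_cubic hij.symm hl hjl
  · rintro i j hij t ⟨r, hr⟩
    obtain ⟨t, rfl⟩ := Ideal.Quotient.mk_surjective t
    obtain ⟨r, rfl⟩ := Ideal.Quotient.mk_surjective r
    obtain ⟨l, hil, hjl, hl⟩ := hthird i j hij
    obtain ⟨g, hg⟩ := (hπ (X i * t - X j * r)).1 (by
      rw [map_sub, map_mul, map_mul, sub_eq_zero]
      exact hr)
    obtain ⟨a, b, rfl⟩ := exists_eq_add_of_X_mul_eq hij hil hjl hl (sub_eq_iff_eq_add'.1 hg)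
    refine ⟨π a, ?_⟩
    change π _ = _
    rw [map_add, map_mul, (hπ (f * b)).2 (dvd_mul_right _ _), add_zero]
  · intro i j hij
    obtain ⟨l, hil, hjl, hl⟩ := hthird i j hij
    rw [← length_quotient_cubic_pair hij hil hjl hl, ← length_quotient_quotient, Set.image_pair]

end Cubic

/-- The Hilbert–Kunz function of the maximal ideal `(X,Y,Z)` of the homogeneous coordinate
ring of the Fermat cubic `X³+Y³+Z³ = 0` over an algebraically closed field of
characteristic `2` (Hasse invariant `0`): `φ(1) = 1`, `φ(2) = 8`, and
`φ(q) = (9/4)q²` for `q = 2^e`, `e ≥ 2`. -/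
theorem hilbert_kunz_function_fermat_cubic_char_two
    (k : Type*) [Field k] [IsAlgClosed k] [CharP k 2] :
    Module.finrank k
        (MvPolynomial (Fin 3) k ⧸
          Ideal.span
            {(X 0 ^ 3 + X 1 ^ 3 + X 2 ^ 3 : MvPolynomial (Fin 3) k), X 0, X 1, X 2}) = 1 ∧
      Module.finrank k
          (MvPolynomial (Fin 3) k ⧸
            Ideal.span
              {(X 0 ^ 3 + X 1 ^ 3 + X 2 ^ 3 : MvPolynomial (Fin 3) k),
                X 0 ^ 2, X 1 ^ 2, X 2 ^ 2}) = 8 ∧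
      ∀ e : ℕ, 2 ≤ e →
        4 * Module.finrank k
            (MvPolynomial (Fin 3) k ⧸
              Ideal.span
                {(X 0 ^ 3 + X 1 ^ 3 + X 2 ^ 3 : MvPolynomial (Fin 3) k),
                  X 0 ^ 2 ^ e, X 1 ^ 2 ^ e, X 2 ^ 2 ^ e}) =
          9 * (2 ^ e) ^ 2 := by
  have hfin : ∀ {I : Ideal (MvPolynomial (Fin 3) k)} {n : ℕ},
      Module.length k (MvPolynomial (Fin 3) k ⧸ I) = n →
        Module.finrank k (MvPolynomial (Fin 3) k ⧸ I) = n := by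
    intro I n h
    rw [Module.length_eq_rank] at h
    rw [Module.finrank, ← Cardinal.toNat_toENat, h, ENat.toNat_natCast]
  refine ⟨hfin ?_, hfin ?_, ?_⟩
  · have hmem : X 0 ^ 3 + X 1 ^ 3 + X 2 ^ 3 ∈
        Ideal.span {(X 0 : MvPolynomial (Fin 3) k), X 1, X 2} :=
      Ideal.mem_span_insert.2 ⟨X 0 ^ 2, X 1 ^ 3 + X 2 ^ 3,
        Ideal.mem_span_pair.2 ⟨X 1 ^ 2, X 2 ^ 2, by ring⟩, by ring⟩
    rw [Ideal.span, Submodule.span_insert_eq_span hmem]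
    exact length_quotient_span_X_triple (by decide) (by decide) (by decide)
  · have hmem : X 0 ^ 3 + X 1 ^ 3 + X 2 ^ 3 ∈
        Ideal.span {(X 0 ^ 2 : MvPolynomial (Fin 3) k), X 1 ^ 2, X 2 ^ 2} :=
      Ideal.mem_span_insert.2 ⟨X 0, X 1 ^ 3 + X 2 ^ 3,
        Ideal.mem_span_pair.2 ⟨X 1, X 2, by ring⟩, by ring⟩
    rw [Ideal.span, Submodule.span_insert_eq_span hmem]
    exact length_quotient_span_X_sq_triple
  · intro e he
    obtain ⟨m, rfl⟩ := Nat.exists_eq_add_of_le' he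
    rw [pow_add 2 m 2, hfin (n := 36 * (2 ^ m) ^ 2)
      (by exact_mod_cast length_quotient_cubic_four_mul_two_pow (k := k) m)]
    ring
end

section
/- Let k be an algebraically closed field of characteristic 2 and let λ ∈ k satisfy λ ≠ 0 and λ³ ≠ 1, so that F = X³+Y³+Z³+λXYZ defines a smooth plane cubic of Hasse invariant 1. Let R = k[X,Y,Z]/(F). Then the Hilbert–Kunz function of the maximal ideal (X,Y,Z) satisfies: dim_k(R/(X,Y,Z)) = 1, dim_k(R/(X²,Y²,Z²)) = 7, and for every e ≥ 2, writing q = 2^e, 4 · dim_k( k[X,Y,Z]/(F, X^q, Y^q, Z^q) ) = 9q² − 4. -/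
open MvPolynomial

section ColonLength

variable {k A : Type*} [Field k] [CommRing A] [Algebra k A]

/-- `f` is a nonzerodivisor modulo the ideal `J`. -/
def IsRegularMod (J : Ideal A) (f : A) : Prop := ∀ u, f * u ∈ J → u ∈ J

/-- The (possibly infinite) `k`-dimension of the quotient of `A` by `I`. -/
noncomputable def quotLength (k : Type*) {A : Type*} [Field k] [CommRing A] [Algebra k A]
    (I : Ideal A) : ℕ∞ := Module.length k (A ⧸ I)

theorem quotLength_eq_add_colon {I C : Ideal A} {f : A} (h : ∀ u, u ∈ C ↔ f * u ∈ I) :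
    quotLength k I = quotLength k C + quotLength k (I ⊔ Ideal.span {f}) := by
  let φ : (A ⧸ C) →ₗ[A] (A ⧸ I) :=
    Submodule.mapQ C I (LinearMap.mulLeft A f) fun u hu => (h u).1 hu
  have hφ : ∀ u, φ (Ideal.Quotient.mk C u) = Ideal.Quotient.mk I (f * u) := fun _ => rfl
  let ψ : (A ⧸ I) →ₐ[k] (A ⧸ (I ⊔ Ideal.span {f})) := Ideal.Quotient.factorₐ k le_sup_left
  have hψ : ∀ u, ψ (Ideal.Quotient.mk I u) = Ideal.Quotient.mk (I ⊔ Ideal.span {f}) u :=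
    fun _ => rfl
  refine Module.length_eq_add_of_exact (φ.restrictScalars k) ψ.toLinearMap ?_ ?_ ?_
  · refine (injective_iff_map_eq_zero φ).2 fun a hu => ?_
    obtain ⟨u, rfl⟩ := Ideal.Quotient.mk_surjective a
    rw [hφ, Ideal.Quotient.eq_zero_iff_mem] at hu
    exact Ideal.Quotient.eq_zero_iff_mem.2 ((h u).2 hu)
  · exact Ideal.Quotient.factor_surjective le_sup_left
  · intro a
    obtain ⟨v, rfl⟩ := Ideal.Quotient.mk_surjective a
    rw [AlgHom.toLinearMap_apply, hψ, Ideal.Quotient.eq_zero_iff_mem]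
    refine ⟨fun hv => ?_, ?_⟩
    · obtain ⟨i, hi, w, hw, rfl⟩ := Submodule.mem_sup.1 hv
      obtain ⟨u, rfl⟩ := Ideal.mem_span_singleton'.1 hw
      refine ⟨Ideal.Quotient.mk C u, ?_⟩
      rw [LinearMap.restrictScalars_apply, hφ, Ideal.Quotient.eq]
      have : f * u - (i + u * f) = -i := by ring
      rw [this]
      exact I.neg_mem hi
    · rintro ⟨b, hb⟩
      obtain ⟨u, rfl⟩ := Ideal.Quotient.mk_surjective b
      rw [LinearMap.restrictScalars_apply, hφ, Ideal.Quotient.eq] at hb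
      have : v = -(f * u - v) + u * f := by ring
      rw [this]
      exact Submodule.add_mem_sup (I.neg_mem hb) (Ideal.mem_span_singleton'.2 ⟨u, rfl⟩)

theorem quotLength_anti {I J : Ideal A} (h : I ≤ J) : quotLength k J ≤ quotLength k I :=
  Module.length_le_of_surjective (Ideal.Quotient.factorₐ k h).toLinearMap
    (Ideal.Quotient.factor_surjective h)

theorem sup_span_singleton_congr {J : Ideal A} {g h : A} (hgh : g - h ∈ J) :
    J ⊔ Ideal.span {g} = J ⊔ Ideal.span {h} := by
  have key : ∀ g h : A, g - h ∈ J → J ⊔ Ideal.span {g} ≤ J ⊔ Ideal.span {h} := by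
    intro g h hgh
    refine sup_le le_sup_left ((Ideal.span_singleton_le_iff_mem _).2 ?_)
    rw [← sub_add_cancel g h]
    exact Submodule.add_mem_sup hgh (Ideal.mem_span_singleton_self h)
  refine le_antisymm (key _ _ hgh) (key _ _ ?_)
  rw [← neg_sub]
  exact J.neg_mem hgh

namespace IsRegularMod

variable {J : Ideal A} {f g : A}

theorem mul (hf : IsRegularMod J f) (hg : IsRegularMod J g) : IsRegularMod J (f * g) :=
  fun u hu => hg u (hf _ (by rwa [← mul_assoc]))

theorem pow (hf : IsRegularMod J f) (n : ℕ) : IsRegularMod J (f ^ n) := by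
  induction n with
  | zero => intro u hu; simpa using hu
  | succ n ih => rw [pow_succ]; exact ih.mul hf

theorem of_mul_sub_mem {e : A} (he : IsRegularMod J e) (h : f * g - e ∈ J) :
    IsRegularMod J f := by
  intro u hu
  refine he u ?_
  have : e * u = g * (f * u) - u * (f * g - e) := by ring
  rw [this]
  exact J.sub_mem (J.mul_mem_left _ hu) (J.mul_mem_left _ h)

theorem swap (hf : IsRegularMod J f) (hg : IsRegularMod (J ⊔ Ideal.span {f}) g) :
    IsRegularMod (J ⊔ Ideal.span {g}) f := by
  intro u hu
  obtain ⟨v, hv⟩ := Ideal.mem_span_singleton_sup.1 (by rwa [sup_comm] at hu)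
  obtain ⟨j, hj, hv⟩ := hv
  have h1 : g * v ∈ J ⊔ Ideal.span {f} := by
    have : g * v = -j + u * f := by linear_combination hv
    rw [this]
    exact Submodule.add_mem_sup (J.neg_mem hj) (Ideal.mem_span_singleton'.2 ⟨u, rfl⟩)
  obtain ⟨w, j', hj', hw⟩ := Ideal.mem_span_singleton_sup.1 (by
    have := hg _ h1
    rwa [sup_comm] at this)
  have h2 : u - g * w ∈ J := by
    refine hf _ ?_
    have : f * (u - g * w) = j + g * j' := by linear_combination -hv - g * hw
    rw [this]
    exact J.add_mem hj (J.mul_mem_left _ hj')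
  have : u = (u - g * w) + w * g := by ring
  rw [this]
  exact Submodule.add_mem_sup h2 (Ideal.mem_span_singleton'.2 ⟨w, rfl⟩)

theorem sup_pow (hf : IsRegularMod J f) (hg : IsRegularMod (J ⊔ Ideal.span {f}) g) (n : ℕ) :
    IsRegularMod (J ⊔ Ideal.span {f ^ n}) g := by
  induction n with
  | zero => intro u _; simp
  | succ n ih =>
    intro u hu
    have hle : J ⊔ Ideal.span {f ^ (n + 1)} ≤ J ⊔ Ideal.span {f} :=
      sup_le_sup_left (Ideal.span_singleton_le_span_singleton.2 (dvd_pow_self f n.succ_ne_zero)) _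
    obtain ⟨w, j, hj, rfl⟩ := Ideal.mem_span_singleton_sup.1 (by
      have := hg _ (hle hu)
      rwa [sup_comm] at this)
    obtain ⟨v, j', hj', hv⟩ := Ideal.mem_span_singleton_sup.1 (by rwa [sup_comm] at hu)
    have h1 : g * w - v * f ^ n ∈ J := by
      refine hf _ ?_
      have : f * (g * w - v * f ^ n) = j' - g * j := by linear_combination -hv
      rw [this]
      exact J.sub_mem hj' (J.mul_mem_left _ hj)
    have h2 : w ∈ J ⊔ Ideal.span {f ^ n} := by
      refine ih _ ?_
      have : g * w = (g * w - v * f ^ n) + v * f ^ n := by ring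
      rw [this]
      exact Submodule.add_mem_sup h1 (Ideal.mem_span_singleton'.2 ⟨v, rfl⟩)
    obtain ⟨t, j'', hj'', rfl⟩ := Ideal.mem_span_singleton_sup.1 (by rwa [sup_comm] at h2)
    have : (t * f ^ n + j'') * f + j = (j'' * f + j) + t * f ^ (n + 1) := by ring
    rw [this]
    exact Submodule.add_mem_sup (J.add_mem (J.mul_mem_right _ hj'') hj)
      (Ideal.mem_span_singleton'.2 ⟨t, rfl⟩)

theorem quotLength_sup_mul (hf : IsRegularMod J f) (N : Ideal A) :
    quotLength k (J ⊔ Ideal.span {f} * N) =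
      quotLength k (J ⊔ N) + quotLength k (J ⊔ Ideal.span {f}) := by
  have key := quotLength_eq_add_colon (k := k) (I := J ⊔ Ideal.span {f} * N) (C := J ⊔ N)
    (f := f) fun u => ⟨fun hu => ?_, fun hu => ?_⟩
  · rw [key, sup_assoc, sup_eq_right.2 (Ideal.mul_le_left : Ideal.span {f} * N ≤ Ideal.span {f})]
  · obtain ⟨j, hj, n, hn, rfl⟩ := Submodule.mem_sup.1 hu
    rw [mul_add]
    exact Submodule.add_mem_sup (J.mul_mem_left _ hj)
      (Ideal.mul_mem_mul (Ideal.mem_span_singleton_self f) hn)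
  · obtain ⟨j, hj, w, hw, hu⟩ := Submodule.mem_sup.1 hu
    obtain ⟨n, hn, rfl⟩ := Ideal.mem_span_singleton_mul.1 hw
    have : u = (u - n) + n := by ring
    rw [this]
    refine Submodule.add_mem_sup (hf _ ?_) hn
    have : f * (u - n) = j := by linear_combination -hu
    rwa [this]

theorem quotLength_sup_pow (hf : IsRegularMod J f) (n : ℕ) :
    quotLength k (J ⊔ Ideal.span {f ^ n}) = n * quotLength k (J ⊔ Ideal.span {f}) := by
  induction n with
  | zero =>
    have : Subsingleton (A ⧸ (J ⊔ Ideal.span {f ^ 0})) := by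
      rw [Ideal.Quotient.subsingleton_iff]; simp
    simp [quotLength]
  | succ n ih =>
    rw [pow_succ', ← Ideal.span_singleton_mul_span_singleton, hf.quotLength_sup_mul, ih]
    push_cast
    ring

theorem quotLength_sup_pow_sup_pow (hf : IsRegularMod J f)
    (hg : IsRegularMod (J ⊔ Ideal.span {f}) g) (m n : ℕ) :
    quotLength k (J ⊔ Ideal.span {f ^ m} ⊔ Ideal.span {g ^ n}) =
      m * n * quotLength k (J ⊔ Ideal.span {f} ⊔ Ideal.span {g}) := by
  rw [(hf.sup_pow hg m).quotLength_sup_pow n, sup_right_comm,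
    (hf.swap hg).quotLength_sup_pow m, sup_right_comm]
  ring

/-- If `b / c = z / y` modulo `J`, then the fractional ideals `(b, c) / c` and `(y, z) / y`
agree, so the colengths of `(b, c)` and `(y, z)` differ as those of `(c)` and `(y)`. -/
theorem quotLength_add_of_mul_sub_mem {y z b c : A} (hy : IsRegularMod J y)
    (hc : IsRegularMod J c) (h : b * y - c * z ∈ J) :
    quotLength k (J ⊔ Ideal.span {y} ⊔ Ideal.span {z}) + quotLength k (J ⊔ Ideal.span {c}) =
      quotLength k (J ⊔ Ideal.span {b} ⊔ Ideal.span {c}) +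
        quotLength k (J ⊔ Ideal.span {y}) := by
  rw [sup_assoc, sup_assoc, ← hc.quotLength_sup_mul, ← hy.quotLength_sup_mul]
  congr 1
  simp only [Ideal.mul_sup, Ideal.span_singleton_mul_span_singleton]
  rw [mul_comm y c, sup_comm (Ideal.span {c * y}), ← sup_assoc, ← sup_assoc]
  rw [sup_right_comm J, sup_span_singleton_congr (g := c * z) (h := y * b), sup_right_comm J]
  have : c * z - y * b = -(b * y - c * z) := by ring
  rw [this]
  exact Ideal.mem_sup_left (J.neg_mem h)

end IsRegularMod

end ColonLength

section TernaryPolynomials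

variable {k : Type*} [Field k]

theorem MvPolynomial.sub_aeval_mem {σ : Type*} {J : Ideal (MvPolynomial σ k)}
    {v : σ → MvPolynomial σ k} (hv : ∀ i, X i - v i ∈ J) (p : MvPolynomial σ k) :
    p - aeval v p ∈ J := by
  have : (Ideal.Quotient.mkₐ k J) = (Ideal.Quotient.mkₐ k J).comp (aeval v) := by
    refine algHom_ext fun i => ?_
    simpa using Ideal.Quotient.eq.2 (hv i)
  exact Ideal.Quotient.eq.1 (DFunLike.congr_fun this p)

theorem IsRegularMod.of_aeval_ne_zero {σ : Type*} {J : Ideal (MvPolynomial σ k)}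
    (v : σ → MvPolynomial σ k) (hv : ∀ i, X i - v i ∈ J)
    (hJ : J ≤ RingHom.ker (aeval (R := k) v)) {g : MvPolynomial σ k} (hg : aeval v g ≠ 0) :
    IsRegularMod J g := by
  intro u hu
  have h0 : aeval v g * aeval v u = 0 := by simpa using hJ hu
  have := sub_aeval_mem hv u
  rwa [(mul_eq_zero.1 h0).resolve_left hg, sub_zero] at this

theorem isRegularMod_span_X_zero {g : MvPolynomial (Fin 3) k}
    (hg : aeval ![0, X 1, X 2] g ≠ (0 : MvPolynomial (Fin 3) k)) :
    IsRegularMod (Ideal.span {X 0}) g := by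
  refine IsRegularMod.of_aeval_ne_zero _ (fun i => ?_) ?_ hg
  · fin_cases i <;> simp
  · simp [Ideal.span_le]

theorem isRegularMod_span_X_zero_sup_span_X_one {g : MvPolynomial (Fin 3) k}
    (hg : aeval ![0, 0, X 2] g ≠ (0 : MvPolynomial (Fin 3) k)) :
    IsRegularMod (Ideal.span {X 0} ⊔ Ideal.span {X 1}) g := by
  refine IsRegularMod.of_aeval_ne_zero _ (fun i => ?_) ?_ hg
  · fin_cases i <;>
      simp [Ideal.mem_sup_left, Ideal.mem_sup_right]
  · simp [Ideal.span_le]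

theorem isRegularMod_span_X_zero_sup_span_X_two {g : MvPolynomial (Fin 3) k}
    (hg : aeval ![0, X 1, 0] g ≠ (0 : MvPolynomial (Fin 3) k)) :
    IsRegularMod (Ideal.span {X 0} ⊔ Ideal.span {X 2}) g := by
  refine IsRegularMod.of_aeval_ne_zero _ (fun i => ?_) ?_ hg
  · fin_cases i <;>
      simp [Ideal.mem_sup_left, Ideal.mem_sup_right]
  · simp [Ideal.span_le]

variable (k) in
/-- The irrelevant maximal ideal of `k[X, Y, Z]`. -/
noncomputable def irrelevantIdeal : Ideal (MvPolynomial (Fin 3) k) :=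
  Ideal.span {X 0} ⊔ Ideal.span {X 1} ⊔ Ideal.span {X 2}

theorem X_mem_irrelevantIdeal (i : Fin 3) : X i ∈ irrelevantIdeal k := by
  fin_cases i <;>
    simp [irrelevantIdeal, Ideal.mem_sup_left, Ideal.mem_sup_right]

theorem irrelevantIdeal_eq_ker :
    irrelevantIdeal k = RingHom.ker (aeval (R := k) (0 : Fin 3 → k)) := by
  refine le_antisymm ?_ fun p hp => ?_
  · simp [irrelevantIdeal, Ideal.span_le]
  · have := sub_aeval_mem (J := irrelevantIdeal k) (v := 0)
      (fun i => by simpa using X_mem_irrelevantIdeal i) p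
    have h2 : aeval (0 : Fin 3 → MvPolynomial (Fin 3) k) p = C (aeval (0 : Fin 3 → k) p) := by
      rw [aeval_zero, aeval_zero]
      rfl
    rwa [h2, (RingHom.mem_ker).1 hp, C_0, sub_zero] at this

theorem quotLength_irrelevantIdeal : quotLength k (irrelevantIdeal k) = 1 := by
  rw [irrelevantIdeal_eq_ker, quotLength,
    (Ideal.quotientKerAlgEquivOfSurjective (f := aeval (R := k) (0 : Fin 3 → k))
      fun c => ⟨C c, by simp⟩).toLinearEquiv.length_eq]
  exact Module.length_eq_one k k

theorem eq_irrelevantIdeal {C : Ideal (MvPolynomial (Fin 3) k)} (h : ∀ i, X i ∈ C)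
    (h1 : 1 ∉ C) : C = irrelevantIdeal k := by
  have hle : irrelevantIdeal k ≤ C := by
    simp [irrelevantIdeal, Ideal.span_le, h]
  have hm : (irrelevantIdeal k).IsMaximal := by
    rw [irrelevantIdeal_eq_ker]
    exact RingHom.ker_isMaximal_of_surjective _ fun c => ⟨MvPolynomial.C c, by simp⟩
  exact (hm.eq_of_le (fun hC => h1 ((Ideal.eq_top_iff_one _).1 hC)) hle).symm

theorem quotLength_eq_add_one {I : Ideal (MvPolynomial (Fin 3) k)} {f : MvPolynomial (Fin 3) k}
    (hf : f ∉ I) (h : ∀ i, f * X i ∈ I) :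
    quotLength k I = quotLength k (I ⊔ Ideal.span {f}) + 1 := by
  let C : Ideal (MvPolynomial (Fin 3) k) := Submodule.comap (LinearMap.mulLeft _ f) I
  have hC : C = irrelevantIdeal k :=
    eq_irrelevantIdeal h fun h1 => hf (by simpa [C] using h1)
  rw [quotLength_eq_add_colon (k := k) (I := I) (C := C) (f := f) fun _ => Iff.rfl, hC,
    quotLength_irrelevantIdeal, add_comm]

theorem quotLength_X_zero_sup_pow_sup_pow (m n : ℕ) :
    quotLength k (Ideal.span {(X 0 : MvPolynomial (Fin 3) k)} ⊔ Ideal.span {X 1 ^ m} ⊔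
      Ideal.span {X 2 ^ n}) = m * n := by
  rw [IsRegularMod.quotLength_sup_pow_sup_pow]
  · rw [← irrelevantIdeal, quotLength_irrelevantIdeal, mul_one]
  · exact isRegularMod_span_X_zero (by simp)
  · exact isRegularMod_span_X_zero_sup_span_X_one (by simp)

theorem isRegularMod_bot {f : MvPolynomial (Fin 3) k} (hf : f ≠ 0) : IsRegularMod ⊥ f := by
  intro u hu
  simpa [hf] using hu

theorem Prime.isRegularMod {f g : MvPolynomial (Fin 3) k} (hf : Prime f) (hg : ¬ f ∣ g) :
    IsRegularMod (Ideal.span {f}) g := by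
  intro u hu
  rw [Ideal.mem_span_singleton] at hu ⊢
  exact (hf.dvd_or_dvd hu).resolve_left hg

theorem IsRegularMod.swap_bot {f g : MvPolynomial (Fin 3) k} (hf : f ≠ 0)
    (hg : IsRegularMod (Ideal.span {f}) g) : IsRegularMod (Ideal.span {g}) f := by
  have := (isRegularMod_bot hf).swap (g := g) (by simpa using hg)
  simpa using this

theorem quotLength_span_X_sq :
    quotLength k (Ideal.span {(X 2 ^ 2 : MvPolynomial (Fin 3) k)} ⊔ Ideal.span {X 0 ^ 2} ⊔
      Ideal.span {X 1 ^ 2}) = 8 := by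
  have hx : IsRegularMod (Ideal.span {(X 2 ^ 2 : MvPolynomial (Fin 3) k)}) (X 0) :=
    IsRegularMod.swap_bot (X_ne_zero 0) (isRegularMod_span_X_zero (by simp))
  rw [hx.quotLength_sup_pow_sup_pow]
  · rw [sup_comm (Ideal.span {X 2 ^ 2}), sup_right_comm]
    have := quotLength_X_zero_sup_pow_sup_pow (k := k) 1 2
    rw [pow_one] at this
    rw [this]
    norm_num
  · rw [sup_comm]
    refine IsRegularMod.sup_pow (f := X 2) ?_ ?_ 2
    · exact isRegularMod_span_X_zero (by simp)
    · exact isRegularMod_span_X_zero_sup_span_X_two (by simp)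

end TernaryPolynomials

section HesseCubic

variable {k : Type*} [Field k]

/-- The cubic `X³ + Y³ + Z³ + l XYZ`. -/
noncomputable def hesseCubic (l : k) : MvPolynomial (Fin 3) k :=
  X 0 ^ 3 + X 1 ^ 3 + X 2 ^ 3 + C l * (X 0 * X 1 * X 2)

/-- In characteristic two, the partial derivative of the cubic with respect to `Y`. -/
noncomputable def hesseConicY (l : k) : MvPolynomial (Fin 3) k := X 1 ^ 2 + C l * (X 0 * X 2)

/-- In characteristic two, the partial derivative of the cubic with respect to `Z`. -/
noncomputable def hesseConicZ (l : k) : MvPolynomial (Fin 3) k := X 2 ^ 2 + C l * (X 0 * X 1)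

theorem not_dvd_of_eval {f g : MvPolynomial (Fin 3) k} (v : Fin 3 → k) (hf : eval v f = 0)
    (hg : eval v g ≠ 0) : ¬ f ∣ g := by
  rintro ⟨h, rfl⟩
  simp [hf] at hg

theorem prime_hesseConicY {l : k} (hl : l ≠ 0) : Prime (hesseConicY l) := by
  classical
  have h2 : ¬ (X 1 : MvPolynomial (Fin 3) k) ∣ C l * X 2 :=
    not_dvd_of_eval ![0, 0, 1] (by simp) (by simpa)
  have hv : (C l * X 2 : MvPolynomial (Fin 3) k).vars ⊆ {2} := by
    refine (vars_mul _ _).trans ?_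
    simp
  have hirr : Irreducible (C l * X 2 * X 0 + X 1 ^ 2 : MvPolynomial (Fin 3) k) := by
    refine irreducible_mul_X_add _ _ 0 ?_ ?_ ?_ ?_
    · simp [hl]
    · intro h
      simpa using hv h
    · intro h
      simpa using vars_pow _ _ h
    · exact ((X_prime.irreducible.isRelPrime_iff_not_dvd).2 h2).symm.pow_right
  have heq : hesseConicY l = C l * X 2 * X 0 + X 1 ^ 2 := by
    rw [hesseConicY]; ring
  rw [heq]
  exact hirr.prime

theorem span_X_zero_sup_hesseConicY (l : k) :
    Ideal.span {(X 0 : MvPolynomial (Fin 3) k)} ⊔ Ideal.span {hesseConicY l} =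
      Ideal.span {X 0} ⊔ Ideal.span {X 1 ^ 2} := by
  refine sup_span_singleton_congr ?_
  rw [Ideal.mem_span_singleton', hesseConicY]
  exact ⟨C l * X 2, by ring⟩

theorem span_X_zero_sup_hesseConicZ (l : k) :
    Ideal.span {(X 0 : MvPolynomial (Fin 3) k)} ⊔ Ideal.span {hesseConicZ l} =
      Ideal.span {X 0} ⊔ Ideal.span {X 2 ^ 2} := by
  refine sup_span_singleton_congr ?_
  rw [Ideal.mem_span_singleton', hesseConicZ]
  exact ⟨C l * X 1, by ring⟩

theorem span_X_zero_sup_hesseCubic (l : k) :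
    Ideal.span {(X 0 : MvPolynomial (Fin 3) k)} ⊔ Ideal.span {hesseCubic l} =
      Ideal.span {X 0} ⊔ Ideal.span {X 1 ^ 3 + X 2 ^ 3} := by
  refine sup_span_singleton_congr ?_
  rw [Ideal.mem_span_singleton', hesseCubic]
  exact ⟨X 0 ^ 2 + C l * (X 1 * X 2), by ring⟩

theorem X_pow_add_X_pow_ne_zero :
    (X 1 ^ 3 + X 2 ^ 3 : MvPolynomial (Fin 3) k) ≠ 0 := by
  intro h
  simpa using congrArg (eval ![0, 1, 0]) h

theorem isRegularMod_X_zero_hesseCubic (l : k) :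
    IsRegularMod (Ideal.span {X 0}) (hesseCubic l) :=
  isRegularMod_span_X_zero (by simpa [hesseCubic] using X_pow_add_X_pow_ne_zero)

theorem isRegularMod_hesseCubic_X_zero (l : k) :
    IsRegularMod (Ideal.span {hesseCubic l}) (X 0) :=
  IsRegularMod.swap_bot (X_ne_zero 0) (isRegularMod_X_zero_hesseCubic l)

theorem isRegularMod_hesseCubic_X_zero_X_one (l : k) :
    IsRegularMod (Ideal.span {hesseCubic l} ⊔ Ideal.span {X 0}) (X 1) := by
  rw [sup_comm]
  refine IsRegularMod.swap ?_ ?_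
  · exact isRegularMod_span_X_zero (by simp)
  · exact isRegularMod_span_X_zero_sup_span_X_one (by simp [hesseCubic])

theorem isRegularMod_hesseCubic_X_zero_conicZ (l : k) :
    IsRegularMod (Ideal.span {hesseCubic l} ⊔ Ideal.span {X 0}) (hesseConicZ l) := by
  rw [sup_comm]
  refine IsRegularMod.swap ?_ ?_
  · exact isRegularMod_span_X_zero (by simp [hesseConicZ])
  · rw [span_X_zero_sup_hesseConicZ]
    refine IsRegularMod.sup_pow (f := X 2) ?_ ?_ 2
    · exact isRegularMod_span_X_zero (by simp)
    · exact isRegularMod_span_X_zero_sup_span_X_two (by simp [hesseCubic])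

theorem quotLength_hesseCubic_X_zero_X_one (l : k) :
    quotLength k (Ideal.span {hesseCubic l} ⊔ Ideal.span {X 0} ⊔ Ideal.span {X 1}) = 3 := by
  have : Ideal.span {hesseCubic l} ⊔ Ideal.span {X 0} ⊔ Ideal.span {X 1} =
      Ideal.span {X 0} ⊔ Ideal.span {X 1 ^ 1} ⊔ Ideal.span {X 2 ^ 3} := by
    rw [sup_comm (Ideal.span {hesseCubic l}), span_X_zero_sup_hesseCubic, sup_right_comm, pow_one]
    refine sup_span_singleton_congr (Ideal.mem_sup_right ?_)
    exact Ideal.mem_span_singleton'.2 ⟨X 1 ^ 2, by ring⟩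
  rw [this, quotLength_X_zero_sup_pow_sup_pow]
  norm_num

theorem quotLength_hesseCubic_X_zero_conicZ (l : k) :
    quotLength k (Ideal.span {hesseCubic l} ⊔ Ideal.span {X 0} ⊔
      Ideal.span {hesseConicZ l}) = 6 := by
  have : Ideal.span {hesseCubic l} ⊔ Ideal.span {X 0} ⊔ Ideal.span {hesseConicZ l} =
      Ideal.span {X 0} ⊔ Ideal.span {X 1 ^ 3} ⊔ Ideal.span {X 2 ^ 2} := by
    rw [sup_assoc, span_X_zero_sup_hesseConicZ, ← sup_assoc,
      sup_comm (Ideal.span {hesseCubic l}), span_X_zero_sup_hesseCubic, sup_right_comm,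
      sup_right_comm _ (Ideal.span {X 1 ^ 3})]
    refine sup_span_singleton_congr (Ideal.mem_sup_right ?_)
    exact Ideal.mem_span_singleton'.2 ⟨X 2, by ring⟩
  rw [this, quotLength_X_zero_sup_pow_sup_pow]
  norm_num

theorem isRegularMod_conicY_conicZ_X_zero {l : k} (hl : l ≠ 0) :
    IsRegularMod (Ideal.span {hesseConicY l} ⊔ Ideal.span {hesseConicZ l}) (X 0) := by
  refine IsRegularMod.swap ?_ ?_
  · exact (prime_hesseConicY hl).isRegularMod
      (not_dvd_of_eval ![1, 0, 0] (by simp [hesseConicY]) (by simp))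
  · rw [sup_comm, span_X_zero_sup_hesseConicY]
    refine IsRegularMod.sup_pow ?_ ?_ 2
    · exact isRegularMod_span_X_zero (by simp)
    · exact isRegularMod_span_X_zero_sup_span_X_one (by simp [hesseConicZ])

theorem quotLength_conicY_conicZ_X_zero (l : k) :
    quotLength k (Ideal.span {hesseConicY l} ⊔ Ideal.span {hesseConicZ l} ⊔
      Ideal.span {X 0}) = 4 := by
  rw [sup_right_comm, sup_comm (Ideal.span {hesseConicY l}), span_X_zero_sup_hesseConicY,
    sup_right_comm, span_X_zero_sup_hesseConicZ, sup_right_comm,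
    quotLength_X_zero_sup_pow_sup_pow]
  norm_num

end HesseCubic

section Cartier

variable {k : Type*} [Field k] [CharP k 2] [PerfectRing k 2]

/-- The exponent vector of the monomial `XYZ`. -/
noncomputable def onesExponent : Fin 3 →₀ ℕ := Finsupp.equivFunOnFinite.symm 1

theorem onesExponent_apply (i : Fin 3) : onesExponent i = 1 := rfl

theorem two_smul_add_onesExponent_injective :
    Function.Injective fun m : Fin 3 →₀ ℕ => 2 • m + onesExponent := by
  intro m n h
  ext i
  have := DFunLike.congr_fun h i
  simp at this
  omega

/-- The Cartier operator on `k[X, Y, Z]` in characteristic two, which sends `XYZ · g²` to `g`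
and kills `m · g²` for every other squarefree monomial `m`. -/
noncomputable def cartier (p : MvPolynomial (Fin 3) k) : MvPolynomial (Fin 3) k :=
  AddMonoidAlgebra.ofCoeff
    ((Finsupp.comapDomain (fun m : Fin 3 →₀ ℕ => 2 • m + onesExponent)
      (AddMonoidAlgebra.coeff p) two_smul_add_onesExponent_injective.injOn).mapRange
        (frobeniusEquiv k 2).symm (map_zero _))

theorem coeff_cartier (m : Fin 3 →₀ ℕ) (p : MvPolynomial (Fin 3) k) :
    coeff m (cartier p) = (frobeniusEquiv k 2).symm (coeff (2 • m + onesExponent) p) := rfl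

theorem cartier_add (p q : MvPolynomial (Fin 3) k) : cartier (p + q) = cartier p + cartier q := by
  ext m
  simp [coeff_cartier]

theorem cartier_sq_mul (g h : MvPolynomial (Fin 3) k) :
    cartier (g ^ 2 * h) = g * cartier h := by
  induction g using MvPolynomial.induction_on' with
  | monomial s c =>
    ext m
    rw [monomial_pow, coeff_cartier, coeff_monomial_mul', coeff_monomial_mul', coeff_cartier]
    have hiff : 2 • s ≤ 2 • m + onesExponent ↔ s ≤ m := by
      simp only [Finsupp.le_def, Finsupp.add_apply, Finsupp.smul_apply, onesExponent_apply,
        smul_eq_mul]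
      exact forall_congr' fun i => by omega
    by_cases hsm : s ≤ m
    · have : 2 • m + onesExponent - 2 • s = 2 • (m - s) + onesExponent := by
        ext i
        have := hsm i
        simp [onesExponent_apply]
        omega
      rw [if_pos (hiff.2 hsm), if_pos hsm, this, map_mul, frobeniusEquiv_symm_pow]
    · rw [if_neg (mt hiff.1 hsm), if_neg hsm, map_zero]
  | add p q hp hq =>
    rw [CharTwo.add_sq, add_mul, cartier_add, hp, hq, add_mul]

theorem cartier_X (i : Fin 3) : cartier (X i : MvPolynomial (Fin 3) k) = 0 := by
  ext m
  rw [coeff_cartier, coeff_X, if_neg, map_zero, coeff_zero]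
  intro h
  have := DFunLike.congr_fun h (i + 1)
  rw [Finsupp.single_eq_of_ne (by fin_cases i <;> decide)] at this
  simp [onesExponent_apply] at this

theorem cartier_X_mul_X_mul_X :
    cartier (X 0 * X 1 * X 2 : MvPolynomial (Fin 3) k) = 1 := by
  have : (X 0 * X 1 * X 2 : MvPolynomial (Fin 3) k) = monomial onesExponent 1 := by
    rw [X, X, X, monomial_mul, monomial_mul]
    congr 2
    · ext i; fin_cases i <;> simp [onesExponent_apply]
    · simp
  ext m
  rw [this, coeff_cartier, coeff_monomial, coeff_one]
  have hiff : onesExponent = 2 • m + onesExponent ↔ 0 = m := by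
    refine ⟨fun h => ?_, fun h => by simp [← h]⟩
    ext i
    have := DFunLike.congr_fun h i
    simp [onesExponent_apply] at this
    simp [this]
  simp only [hiff]
  split_ifs <;> simp

theorem cartier_hesseCubic (l : k) :
    cartier (hesseCubic l) = C ((frobeniusEquiv k 2).symm l) := by
  have hl : C l = (C ((frobeniusEquiv k 2).symm l) : MvPolynomial (Fin 3) k) ^ 2 := by
    rw [← C_pow, frobeniusEquiv_symm_pow_p]
  have hX : ∀ i : Fin 3, cartier (X i ^ 3 : MvPolynomial (Fin 3) k) = 0 := fun i => by
    rw [pow_succ, cartier_sq_mul, cartier_X, mul_zero]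
  rw [hesseCubic, cartier_add, cartier_add, cartier_add, hX, hX, hX, hl, cartier_sq_mul,
    cartier_X_mul_X_mul_X]
  simp

theorem mem_span_sup_span_sup_span {R : Type*} [CommRing R] {f g h p : R} :
    p ∈ Ideal.span {f} ⊔ Ideal.span {g} ⊔ Ideal.span {h} ↔
      ∃ a b c, p = a * f + b * g + c * h := by
  constructor
  · intro hp
    obtain ⟨s, hs, q, hq, hsq⟩ := Submodule.mem_sup.1 hp
    obtain ⟨t, ht, r, hr, htr⟩ := Submodule.mem_sup.1 hs
    obtain ⟨a, rfl⟩ := Ideal.mem_span_singleton'.1 ht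
    obtain ⟨b, rfl⟩ := Ideal.mem_span_singleton'.1 hr
    obtain ⟨c, rfl⟩ := Ideal.mem_span_singleton'.1 hq
    exact ⟨a, b, c, by rw [← hsq, ← htr]⟩
  · rintro ⟨a, b, c, rfl⟩
    exact Submodule.add_mem_sup (Submodule.add_mem_sup
      (Ideal.mem_span_singleton'.2 ⟨a, rfl⟩) (Ideal.mem_span_singleton'.2 ⟨b, rfl⟩))
      (Ideal.mem_span_singleton'.2 ⟨c, rfl⟩)

/-- The `F`-purity of `k[X, Y, Z] / (F)`: membership in `(F, g, h)` can be tested after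
Frobenius. -/
theorem mem_of_sq_mem {l : k} (hl : l ≠ 0) {p g h : MvPolynomial (Fin 3) k}
    (hp : p ^ 2 ∈ Ideal.span {hesseCubic l} ⊔ Ideal.span {g ^ 2} ⊔ Ideal.span {h ^ 2}) :
    p ∈ Ideal.span {hesseCubic l} ⊔ Ideal.span {g} ⊔ Ideal.span {h} := by
  obtain ⟨a, b, c, habc⟩ := mem_span_sup_span_sup_span.1 hp
  have key : p * cartier (hesseCubic l) = cartier a * hesseCubic l +
      cartier (b * hesseCubic l) * g + cartier (c * hesseCubic l) * h := by
    rw [← cartier_sq_mul, habc]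
    have : (a * hesseCubic l + b * g ^ 2 + c * h ^ 2) * hesseCubic l =
        hesseCubic l ^ 2 * a + g ^ 2 * (b * hesseCubic l) + h ^ 2 * (c * hesseCubic l) := by ring
    rw [this, cartier_add, cartier_add, cartier_sq_mul, cartier_sq_mul, cartier_sq_mul]
    ring
  set s := (frobeniusEquiv k 2).symm l with hs
  have hs0 : s ≠ 0 := by simpa [hs] using hl
  have hC : (C s : MvPolynomial (Fin 3) k) * C s⁻¹ = 1 := by
    rw [← C_mul, mul_inv_cancel₀ hs0, C_1]
  rw [cartier_hesseCubic, ← hs] at key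
  have : p = C s⁻¹ * (p * C s) := by linear_combination -p * hC
  rw [this]
  exact Ideal.mul_mem_left _ _ (mem_span_sup_span_sup_span.2 ⟨_, _, _, key⟩)

end Cartier

section Certificates

variable {A : Type*} [CommRing A]

theorem span_sup_span_pow_le (b c : A) (i j : ℕ) :
    (Ideal.span {b} ⊔ Ideal.span {c}) ^ (i + j + 1) ≤
      Ideal.span {b ^ (i + 1)} ⊔ Ideal.span {c ^ (j + 1)} := by
  rw [← Ideal.add_eq_sup, add_pow, Ideal.sum_eq_sup]
  refine Finset.sup_le fun n _ => Ideal.mul_le_left.trans ?_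
  rcases le_or_gt (i + 1) n with h | h
  · refine Ideal.mul_le_left.trans (le_sup_of_le_left ?_)
    rw [Ideal.span_singleton_pow]
    exact Ideal.span_singleton_le_span_singleton.2 (pow_dvd_pow b h)
  · refine Ideal.mul_le_right.trans (le_sup_of_le_right ?_)
    rw [Ideal.span_singleton_pow]
    exact Ideal.span_singleton_le_span_singleton.2 (pow_dvd_pow c (by omega))

theorem mul_pow_mem_of_reduction {F f b c : A} {V : Ideal A}
    (h : ∀ v ∈ V, f * v ∈ Ideal.span {F} ⊔ (Ideal.span {b} ⊔ Ideal.span {c}) * V) (n : ℕ) :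
    ∀ v ∈ V, f ^ n * v ∈ Ideal.span {F} ⊔ (Ideal.span {b} ⊔ Ideal.span {c}) ^ n * V := by
  induction n with
  | zero => intro v hv; simpa using Ideal.mem_sup_right hv
  | succ n ih =>
    intro v hv
    obtain ⟨p, hp, q, hq, hpq⟩ := Submodule.mem_sup.1 (ih v hv)
    have hfv : f ^ (n + 1) * v = f * (f ^ n * v) := by ring
    rw [hfv, ← hpq, mul_add]
    refine add_mem (Ideal.mem_sup_left (Ideal.mul_mem_left _ _ hp)) ?_
    have hle : Ideal.span {f} * ((Ideal.span {b} ⊔ Ideal.span {c}) ^ n * V) ≤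
        Ideal.span {F} ⊔ (Ideal.span {b} ⊔ Ideal.span {c}) ^ (n + 1) * V := by
      rw [mul_left_comm, Ideal.mul_le]
      intro r hr s hs
      obtain ⟨w, hw, rfl⟩ := Ideal.mem_span_singleton_mul.1 hs
      obtain ⟨p, hp, q, hq, hpq⟩ := Submodule.mem_sup.1 (h w hw)
      rw [← hpq, mul_add]
      refine Submodule.add_mem_sup (Ideal.mul_mem_left _ _ hp) ?_
      rw [pow_succ, mul_assoc]
      exact Ideal.mul_mem_mul hr hq
    exact hle (Ideal.mul_mem_mul (Ideal.mem_span_singleton_self f) hq)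

/-- The cube of the ideal `(x, y, z)`. -/
def cubicForms (x y z : A) : Ideal A :=
  Ideal.span {x ^ 3, x ^ 2 * y, x ^ 2 * z, x * y ^ 2, x * y * z, x * z ^ 2, y ^ 3, y ^ 2 * z,
    y * z ^ 2, z ^ 3}

/-- Modulo the cubic `F`, the square of `x` is integral over the ideal of the two conics. -/
theorem sq_mul_mem_of_mem_cubicForms (h2 : (2 : A) = 0) {x y z l n : A}
    (hn : n * (1 + l ^ 3) = 1) :
    ∀ v ∈ cubicForms x y z, x ^ 2 * v ∈
      Ideal.span {x ^ 3 + y ^ 3 + z ^ 3 + l * (x * y * z)} ⊔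
        (Ideal.span {y ^ 2 + l * (x * z)} ⊔ Ideal.span {z ^ 2 + l * (x * y)}) *
          cubicForms x y z := by
  set V := cubicForms x y z with hV
  set K := Ideal.span {x ^ 3 + y ^ 3 + z ^ 3 + l * (x * y * z)} ⊔
        (Ideal.span {y ^ 2 + l * (x * z)} ⊔ Ideal.span {z ^ 2 + l * (x * y)}) * V with hK
  have hF : ∀ p, (x ^ 3 + y ^ 3 + z ^ 3 + l * (x * y * z)) * p ∈ K := fun p =>
    Ideal.mem_sup_left (Ideal.mul_mem_right _ _ (Ideal.mem_span_singleton_self _))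
  have hb : ∀ p ∈ V, (y ^ 2 + l * (x * z)) * p ∈ K := fun p hp =>
    Ideal.mem_sup_right (Ideal.mul_mem_mul
      (Ideal.mem_sup_left (Ideal.mem_span_singleton_self _)) hp)
  have hc : ∀ p ∈ V, (z ^ 2 + l * (x * y)) * p ∈ K := fun p hp =>
    Ideal.mem_sup_right (Ideal.mul_mem_mul
      (Ideal.mem_sup_right (Ideal.mem_span_singleton_self _)) hp)
  have v1 : x ^ 3 ∈ V := Ideal.subset_span (by simp)
  have v2 : x ^ 2 * y ∈ V := Ideal.subset_span (by simp)
  have v3 : x ^ 2 * z ∈ V := Ideal.subset_span (by simp)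
  have v4 : x * y ^ 2 ∈ V := Ideal.subset_span (by simp)
  have v5 : x * y * z ∈ V := Ideal.subset_span (by simp)
  have v6 : x * z ^ 2 ∈ V := Ideal.subset_span (by simp)
  have v8 : y ^ 2 * z ∈ V := Ideal.subset_span (by simp)
  have v9 : y * z ^ 2 ∈ V := Ideal.subset_span (by simp)
  have k2 : x ^ 2 * (x ^ 2 * y) ∈ K := by
    convert K.mul_mem_left n (add_mem (add_mem (hF (x * y))
      (hb _ (add_mem v4 (V.mul_mem_left l v3))))
      (hc _ (add_mem v5 (V.mul_mem_left (l ^ 2) v1)))) using 1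
    linear_combination (-x ^ 4 * y) * hn - n * (x * y ^ 4 + x * y * z ^ 3
      + 2 * l * x ^ 2 * y ^ 2 * z + l ^ 2 * x ^ 3 * z ^ 2) * h2
  have k3 : x ^ 2 * (x ^ 2 * z) ∈ K := by
    convert K.mul_mem_left n (add_mem (add_mem (hF (x * z))
      (hc _ (add_mem v6 (V.mul_mem_left l v2))))
      (hb _ (add_mem v5 (V.mul_mem_left (l ^ 2) v1)))) using 1
    linear_combination (-x ^ 4 * z) * hn - n * (x * z ^ 4 + x * z * y ^ 3
      + 2 * l * x ^ 2 * z ^ 2 * y + l ^ 2 * x ^ 3 * y ^ 2) * h2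
  have k5 : x ^ 2 * (x * y * z) ∈ K := by
    convert K.mul_mem_left n (add_mem (add_mem (hF (y * z))
      (hb _ (add_mem v8 (V.mul_mem_left l v6))))
      (hc _ (add_mem v9 (V.mul_mem_left (l ^ 2) v3)))) using 1
    linear_combination (-x ^ 3 * y * z) * hn - n * (y ^ 4 * z + y * z ^ 4
      + 2 * l * x * y ^ 2 * z ^ 2 + l ^ 2 * x ^ 2 * z ^ 3) * h2
  have k1 : x ^ 2 * x ^ 3 ∈ K := by
    convert add_mem (add_mem (hF (x ^ 2)) (hb _ v2)) (add_mem (hc _ v3)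
      (K.mul_mem_left l k5)) using 1
    linear_combination (-x ^ 2 * y ^ 3 - x ^ 2 * z ^ 3 - 2 * l * x ^ 3 * y * z) * h2
  have k4 : x ^ 2 * (x * y ^ 2) ∈ K := by
    convert add_mem (hb _ v1) (K.mul_mem_left l k3) using 1
    linear_combination (-l * x ^ 4 * z) * h2
  have k6 : x ^ 2 * (x * z ^ 2) ∈ K := by
    convert add_mem (hc _ v1) (K.mul_mem_left l k2) using 1
    linear_combination (-l * x ^ 4 * y) * h2
  have k7 : x ^ 2 * y ^ 3 ∈ K := by
    convert add_mem (hb _ v2) (K.mul_mem_left l k5) using 1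
    linear_combination (-l * x ^ 3 * y * z) * h2
  have k8 : x ^ 2 * (y ^ 2 * z) ∈ K := by
    convert add_mem (hb _ v3) (K.mul_mem_left l k6) using 1
    linear_combination (-l * x ^ 3 * z ^ 2) * h2
  have k9 : x ^ 2 * (y * z ^ 2) ∈ K := by
    convert add_mem (hc _ v2) (K.mul_mem_left l k4) using 1
    linear_combination (-l * x ^ 3 * y ^ 2) * h2
  have k10 : x ^ 2 * z ^ 3 ∈ K := by
    convert add_mem (hc _ v3) (K.mul_mem_left l k5) using 1
    linear_combination (-l * x ^ 3 * y * z) * h2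
  have hle : V ≤ Submodule.comap (LinearMap.mulLeft A (x ^ 2)) K := by
    rw [hV, cubicForms, Ideal.span_le]
    simp [Set.insert_subset_iff, k1, k2, k3, k4, k5, k6, k7, k8, k9, k10]
  exact fun v hv => hle hv

end Certificates

section ConicCertificates

variable {A : Type*} [CommRing A]

theorem hesse_mul_sub_pow_mem (h2 : (2 : A) = 0) {x y z l n : A} (hn : n * (1 + l ^ 3) = 1) :
    (x ^ 3 + y ^ 3 + z ^ 3 + l * (x * y * z)) * (x ^ 2 + n * l * (y * z)) - x ^ 5 ∈
      Ideal.span {y ^ 2 + l * (x * z)} ⊔ Ideal.span {z ^ 2 + l * (x * y)} := by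
  rw [← Ideal.span_insert]
  refine Ideal.mem_span_pair.2 ⟨x ^ 2 * y - n * l * (y ^ 2 * z + l * x * z ^ 2),
    x ^ 2 * z - n * l * (y * z ^ 2 + l ^ 2 * x ^ 2 * z), ?_⟩
  linear_combination (-l * x ^ 3 * y * z) * hn - n * l * (y ^ 4 * z + y * z ^ 4
    + 2 * l * x * y ^ 2 * z ^ 2 + l ^ 2 * x ^ 2 * z ^ 3) * h2

/-- Modulo the conics, multiplication by `F` and by `x³` agree on `(y, z, x²)` up to units. -/
theorem hesse_mul_mem_iff (h2 : (2 : A) = 0) {x y z l n : A} (hn : n * (1 + l ^ 3) = 1)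
    {K : Ideal A} (hb : y ^ 2 + l * (x * z) ∈ K) (hc : z ^ 2 + l * (x * y) ∈ K) :
    ((x ^ 3 + y ^ 3 + z ^ 3 + l * (x * y * z)) * y ∈ K ∧
      (x ^ 3 + y ^ 3 + z ^ 3 + l * (x * y * z)) * z ∈ K ∧
      (x ^ 3 + y ^ 3 + z ^ 3 + l * (x * y * z)) * x ^ 2 ∈ K) ↔
    (x ^ 3 * y ∈ K ∧ x ^ 3 * z ∈ K ∧ x ^ 3 * x ^ 2 ∈ K) := by
  have hy : (x ^ 3 + y ^ 3 + z ^ 3 + l * (x * y * z)) * y - (1 + l ^ 3) * (x ^ 3 * y) ∈ K := by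
    convert K.neg_mem (add_mem (K.mul_mem_left (y ^ 2 + l * x * z) hb)
      (K.mul_mem_left (y * z + l ^ 2 * x ^ 2) hc)) using 1
    linear_combination (y ^ 4 + y * z ^ 3 + 2 * l * x * y ^ 2 * z + l ^ 2 * x ^ 2 * z ^ 2) * h2
  have hz : (x ^ 3 + y ^ 3 + z ^ 3 + l * (x * y * z)) * z - (1 + l ^ 3) * (x ^ 3 * z) ∈ K := by
    convert K.neg_mem (add_mem (K.mul_mem_left (z ^ 2 + l * x * y) hc)
      (K.mul_mem_left (y * z + l ^ 2 * x ^ 2) hb)) using 1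
    linear_combination (z ^ 4 + z * y ^ 3 + 2 * l * x * z ^ 2 * y + l ^ 2 * x ^ 2 * y ^ 2) * h2
  have hx : (x ^ 3 + y ^ 3 + z ^ 3 + l * (x * y * z)) * x ^ 2 -
      (x ^ 3 * x ^ 2 - l * z * (x ^ 3 * y)) ∈ K := by
    convert add_mem (K.mul_mem_left (x ^ 2 * y) hb) (K.mul_mem_left (x ^ 2 * z) hc) using 1
    ring
  have hunit : ∀ u, (1 + l ^ 3) * u ∈ K ↔ u ∈ K := fun u =>
    ⟨fun h => by
      convert K.mul_mem_left n h using 1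
      linear_combination -u * hn, K.mul_mem_left _⟩
  rw [← sub_add_cancel (_ * y) ((1 + l ^ 3) * (x ^ 3 * y)), K.add_mem_iff_right hy, hunit,
    ← sub_add_cancel (_ * z) ((1 + l ^ 3) * (x ^ 3 * z)), K.add_mem_iff_right hz, hunit,
    ← sub_add_cancel (_ * x ^ 2) (x ^ 3 * x ^ 2 - l * z * (x ^ 3 * y)), K.add_mem_iff_right hx]
  refine and_congr_right fun h => and_congr_right fun _ => ?_
  exact K.sub_mem_iff_left (K.mul_mem_left _ h)

end ConicCertificates

section Conics

variable {k : Type*} [Field k]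

theorem C_inv_mul_one_add {l : k} (hl3 : 1 + l ^ 3 ≠ 0) :
    (C (1 + l ^ 3)⁻¹ : MvPolynomial (Fin 3) k) * (1 + C l ^ 3) = 1 := by
  rw [← C_1, ← C_pow, ← C_add, ← C_mul, inv_mul_cancel₀ hl3]

theorem isRegularMod_hesseCubic_conicY {l : k} (hl : l ≠ 0) :
    IsRegularMod (Ideal.span {hesseCubic l}) (hesseConicY l) :=
  IsRegularMod.swap_bot (prime_hesseConicY hl).ne_zero
    ((prime_hesseConicY hl).isRegularMod
      (not_dvd_of_eval ![0, 0, 1] (by simp [hesseConicY]) (by simp [hesseCubic])))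

variable [CharP k 2]

theorem isRegularMod_conics_hesseCubic {l : k} (hl : l ≠ 0) (hl3 : 1 + l ^ 3 ≠ 0) :
    IsRegularMod (Ideal.span {hesseConicY l} ⊔ Ideal.span {hesseConicZ l}) (hesseCubic l) :=
  ((isRegularMod_conicY_conicZ_X_zero hl).pow 5).of_mul_sub_mem
    (hesse_mul_sub_pow_mem CharTwo.two_eq_zero (C_inv_mul_one_add hl3))

theorem conics_sup_hesseCubic_mul {l : k} (hl3 : 1 + l ^ 3 ≠ 0) :
    Ideal.span {hesseConicY l} ⊔ Ideal.span {hesseConicZ l} ⊔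
        Ideal.span {hesseCubic l} * Ideal.span {X 1, X 2, X 0 ^ 2} =
      Ideal.span {hesseConicY l} ⊔ Ideal.span {hesseConicZ l} ⊔
        Ideal.span {X 0 ^ 3} * Ideal.span {X 1, X 2, X 0 ^ 2} := by
  refine eq_of_forall_ge_iff fun K => ?_
  have hmul : ∀ f : MvPolynomial (Fin 3) k,
      Ideal.span {f} * Ideal.span {X 1, X 2, X 0 ^ 2} ≤ K ↔
        f * X 1 ∈ K ∧ f * X 2 ∈ K ∧ f * X 0 ^ 2 ∈ K := fun f => by
    rw [Ideal.span_mul_span', Ideal.span_le]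
    simp [Set.insert_subset_iff, Set.image_insert_eq]
  rw [sup_le_iff, sup_le_iff, sup_le_iff, sup_le_iff, hmul, hmul, Ideal.span_singleton_le_iff_mem,
    Ideal.span_singleton_le_iff_mem]
  exact and_congr_right fun h =>
    hesse_mul_mem_iff CharTwo.two_eq_zero (C_inv_mul_one_add hl3) h.1 h.2

theorem isRegularMod_hesseCubic_conicY_conicZ {l : k} (hl : l ≠ 0) (hl3 : 1 + l ^ 3 ≠ 0) :
    IsRegularMod (Ideal.span {hesseCubic l} ⊔ Ideal.span {hesseConicY l}) (hesseConicZ l) := by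
  rw [sup_comm]
  exact IsRegularMod.swap ((prime_hesseConicY hl).isRegularMod
      (not_dvd_of_eval ![0, 0, 1] (by simp [hesseConicY]) (by simp [hesseConicZ])))
    (isRegularMod_conics_hesseCubic hl hl3)

theorem quotLength_hesseCubic_conicY_conicZ {l : k} (hl : l ≠ 0) (hl3 : 1 + l ^ 3 ≠ 0) :
    quotLength k (Ideal.span {hesseCubic l} ⊔ Ideal.span {hesseConicY l} ⊔
      Ideal.span {hesseConicZ l}) = 12 := by
  have h1 := (isRegularMod_conics_hesseCubic hl hl3).quotLength_sup_mul (k := k)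
    (Ideal.span {X 1, X 2, X 0 ^ 2})
  rw [conics_sup_hesseCubic_mul hl3,
    ((isRegularMod_conicY_conicZ_X_zero hl).pow 3).quotLength_sup_mul (k := k),
    (isRegularMod_conicY_conicZ_X_zero hl).quotLength_sup_pow,
    quotLength_conicY_conicZ_X_zero] at h1
  have hfin : quotLength k (Ideal.span {hesseConicY l} ⊔ Ideal.span {hesseConicZ l} ⊔
      Ideal.span {X 1, X 2, X 0 ^ 2}) ≠ ⊤ := by
    refine ne_top_of_le_ne_top (b := 8) (by decide) ?_
    rw [← quotLength_span_X_sq (k := k)]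
    refine quotLength_anti (le_sup_of_le_right ?_)
    refine sup_le (sup_le ?_ ?_) ?_ <;> rw [Ideal.span_singleton_le_iff_mem]
    · exact Ideal.pow_mem_of_mem _ (Ideal.subset_span (by simp)) 2 two_pos
    · exact Ideal.subset_span (by simp)
    · exact Ideal.pow_mem_of_mem _ (Ideal.subset_span (by simp)) 2 two_pos
  rw [sup_assoc, sup_comm, ← (ENat.add_right_injective_of_ne_top hfin) h1]
  norm_num

end Conics

section Socle

variable {k : Type*} [Field k]

/-- A cubic apolar to the partial derivatives of `hesseCubic l` in characteristic two. -/
noncomputable def apolarFunctional (l : k) : MvPolynomial (Fin 3) k →ₗ[k] k :=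
  l • ∑ i : Fin 3, lcoeff k (Finsupp.single i 3) +
    lcoeff k (Finsupp.single 0 1 + Finsupp.single 1 1 + Finsupp.single 2 1)

theorem apolarFunctional_X_zero_pow (l : k) : apolarFunctional l (X 0 ^ 3) = l := by
  have h : (Finsupp.single 0 3 : Fin 3 →₀ ℕ) ≠
      Finsupp.single 0 1 + Finsupp.single 1 1 + Finsupp.single 2 1 := fun h => by
    simpa using DFunLike.congr_fun h 0
  simp [apolarFunctional, Fin.sum_univ_three, coeff_X_pow, h, Finsupp.single_left_inj]

variable [CharP k 2]

theorem apolarFunctional_mul (l : k) (p : MvPolynomial (Fin 3) k) (i : Fin 3) :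
    apolarFunctional l ((X i ^ 2 + C l * (X (i + 1) * X (i + 2))) * p) = 0 := by
  have hexp : ∀ j : Fin 3, Finsupp.single j 3 - Finsupp.single j 1 - Finsupp.single j 1 =
      (Finsupp.single j 1 : Fin 3 →₀ ℕ) := fun j => by
    rw [← Finsupp.single_tsub, ← Finsupp.single_tsub]
  have hxyz : ∀ a b c : Fin 3 →₀ ℕ,
      a + b + c - b - c = a ∧ a + b + c - a - c = b ∧ a + b + c - b - a = c := fun a b c => by
    refine ⟨?_, ?_, ?_⟩ <;> ext j <;> simp <;> omega
  have hmul : (X i ^ 2 + C l * (X (i + 1) * X (i + 2))) * p =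
      X i * (X i * p) + C l * (X (i + 2) * (X (i + 1) * p)) := by ring
  rw [hmul]
  fin_cases i <;> simp [apolarFunctional, Fin.sum_univ_three, coeff_X_mul', hexp, hxyz,
    CharTwo.add_self_eq_zero]

theorem X_zero_pow_three_notMem {l : k} (hl : l ≠ 0) (p : MvPolynomial (Fin 3) k) :
    X 0 ^ 3 - p * (X 0 ^ 2 + C l * (X 1 * X 2)) ∉
      Ideal.span {hesseConicY l} ⊔ Ideal.span {hesseConicZ l} := by
  intro h
  rw [← Ideal.span_insert] at h
  obtain ⟨u, v, huv⟩ := Ideal.mem_span_pair.1 h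
  have hY : apolarFunctional l (u * hesseConicY l) = 0 := by
    rw [hesseConicY, mul_comm u, mul_comm (X 0)]
    exact apolarFunctional_mul l u 1
  have hZ : apolarFunctional l (v * hesseConicZ l) = 0 := by
    rw [hesseConicZ, mul_comm v]
    exact apolarFunctional_mul l v 2
  have hX : apolarFunctional l (p * (X 0 ^ 2 + C l * (X 1 * X 2))) = 0 := by
    rw [mul_comm p]
    exact apolarFunctional_mul l p 0
  have := congrArg (apolarFunctional l) huv
  rw [map_add, map_sub, hX, hY, hZ, apolarFunctional_X_zero_pow, add_zero, sub_zero] at this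
  exact hl this.symm

theorem X_zero_pow_four_notMem {l : k} (hl : l ≠ 0) :
    X 0 ^ 4 ∉ Ideal.span {hesseCubic l} ⊔ Ideal.span {hesseConicY l} ⊔
      Ideal.span {hesseConicZ l} := by
  intro h
  obtain ⟨p, u, v, h⟩ := mem_span_sup_span_sup_span.1 h
  have h2 : (2 : MvPolynomial (Fin 3) k) = 0 := CharTwo.two_eq_zero
  refine X_zero_pow_three_notMem hl p (isRegularMod_conicY_conicZ_X_zero hl _ ?_)
  rw [← Ideal.span_insert]
  refine Ideal.mem_span_pair.2 ⟨u + p * X 1, v + p * X 2, ?_⟩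
  rw [hesseCubic] at h
  rw [hesseConicY, hesseConicZ] at h ⊢
  linear_combination -h + p * C l * X 0 * X 1 * X 2 * h2

theorem X_zero_pow_mul_X_mem {l : k} (hl3 : 1 + l ^ 3 ≠ 0) (r : ℕ) (i : Fin 3) :
    X 0 ^ (4 * (r + 1)) * X i ∈ Ideal.span {hesseCubic l} ⊔
      Ideal.span {hesseConicY l ^ (r + 1)} ⊔ Ideal.span {hesseConicZ l ^ (r + 1)} := by
  have hV : X 0 ^ 2 * X i ∈ cubicForms (X 0) (X 1) (X 2 : MvPolynomial (Fin 3) k) := by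
    refine Ideal.subset_span ?_
    fin_cases i <;> simp [← pow_succ]
  have h := mul_pow_mem_of_reduction (sq_mul_mem_of_mem_cubicForms
    (CharTwo.two_eq_zero) (C_inv_mul_one_add hl3)) (r + r + 1) _ hV
  rw [sup_assoc]
  have hle := (Ideal.mul_le_left (J := cubicForms (X 0) (X 1) (X 2))).trans
    (span_sup_span_pow_le (hesseConicY l) (hesseConicZ l) r r)
  have hmem := sup_le_sup_left hle (Ideal.span {hesseCubic l}) h
  convert hmem using 1
  ring

variable [PerfectRing k 2]

theorem X_zero_pow_notMem {l : k} (hl : l ≠ 0) (j : ℕ) :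
    X 0 ^ (4 * 2 ^ j) ∉ Ideal.span {hesseCubic l} ⊔ Ideal.span {hesseConicY l ^ 2 ^ j} ⊔
      Ideal.span {hesseConicZ l ^ 2 ^ j} := by
  induction j with
  | zero => simpa using X_zero_pow_four_notMem hl
  | succ j ih =>
    intro h
    refine ih (mem_of_sq_mem hl ?_)
    rwa [← pow_mul, ← pow_mul, ← pow_mul, mul_assoc, ← pow_succ]

theorem quotLength_hesseCubic_sup_pow_sup_pow_sup_pow {l : k} (hl : l ≠ 0) (hl3 : 1 + l ^ 3 ≠ 0)
    (j : ℕ) :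
    quotLength k (Ideal.span {hesseCubic l} ⊔ Ideal.span {X 0 ^ (4 * 2 ^ j)} ⊔
      Ideal.span {hesseConicY l ^ 2 ^ j} ⊔ Ideal.span {hesseConicZ l ^ 2 ^ j}) + 1 =
    ((12 * 2 ^ j * 2 ^ j : ℕ) : ℕ∞) := by
  have h := quotLength_eq_add_one (X_zero_pow_notMem hl j) fun i => by
    have := X_zero_pow_mul_X_mem hl3 (2 ^ j - 1) i
    rwa [Nat.sub_add_cancel Nat.one_le_two_pow] at this
  rw [(isRegularMod_hesseCubic_conicY hl).quotLength_sup_pow_sup_pow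
    (isRegularMod_hesseCubic_conicY_conicZ hl hl3),
    quotLength_hesseCubic_conicY_conicZ hl hl3] at h
  rw [sup_right_comm _ (Ideal.span {X 0 ^ _}), sup_right_comm _ (Ideal.span {X 0 ^ _}), ← h]
  push_cast
  ring

end Socle

section HilbertKunz

variable {k : Type*} [Field k]

theorem quotLength_hesseCubic_X (l : k) :
    quotLength k (Ideal.span {hesseCubic l} ⊔ Ideal.span {X 0} ⊔ Ideal.span {X 1} ⊔
      Ideal.span {X 2}) = 1 := by
  have hF : hesseCubic l ∈ irrelevantIdeal k := by
    have h : ∀ i, X i ^ 3 ∈ irrelevantIdeal k := fun i =>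
      Ideal.pow_mem_of_mem _ (X_mem_irrelevantIdeal i) 3 (by norm_num)
    exact add_mem (add_mem (add_mem (h 0) (h 1)) (h 2))
      (Ideal.mul_mem_left _ _ (Ideal.mul_mem_left _ _ (X_mem_irrelevantIdeal 2)))
  rw [sup_assoc, sup_assoc, ← sup_assoc (Ideal.span {X 0}),
    ← irrelevantIdeal, sup_eq_right.2 ((Ideal.span_singleton_le_iff_mem _).2 hF)]
  exact quotLength_irrelevantIdeal

theorem finrank_eq_toNat_quotLength {A : Type*} [CommRing A] [Algebra k A] (I : Ideal A) :
    Module.finrank k (A ⧸ I) = (quotLength k I).toNat := by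
  rw [quotLength, Module.length_eq_rank, Module.finrank]
  rfl

variable [CharP k 2]

theorem hesseCubic_relation (l : k) (j : ℕ) :
    (hesseConicY l) ^ 2 ^ j * X 1 ^ (4 * 2 ^ j) - (hesseConicZ l) ^ 2 ^ j * X 2 ^ (4 * 2 ^ j) ∈
      Ideal.span {hesseCubic l} ⊔ Ideal.span {X 0 ^ (4 * 2 ^ j)} := by
  have h2 : (2 : MvPolynomial (Fin 3) k) = 0 := CharTwo.two_eq_zero
  have h : hesseConicY l * X 1 ^ 4 - hesseConicZ l * X 2 ^ 4 =
      (X 0 ^ 3 + X 1 ^ 3 + X 2 ^ 3) * hesseCubic l -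
        (X 0 ^ 2 + C l * (X 1 * X 2)) * X 0 ^ 4 := by
    rw [hesseConicY, hesseConicZ, hesseCubic]
    linear_combination -(X 2 ^ 6 + C l * X 0 * X 1 * X 2 ^ 4 + X 0 ^ 3 * X 1 ^ 3 +
      X 0 ^ 3 * X 2 ^ 3 + X 1 ^ 3 * X 2 ^ 3) * h2
  rw [pow_mul, pow_mul, pow_mul, ← mul_pow, ← mul_pow, ← sub_pow_char_pow, h, sub_pow_char_pow,
    mul_pow, mul_pow]
  refine sub_mem (Ideal.mem_sup_left (Ideal.mul_mem_left _ _ ?_))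
    (Ideal.mem_sup_right (Ideal.mul_mem_left _ _ (Ideal.mem_span_singleton_self _)))
  exact Ideal.pow_mem_of_mem _ (Ideal.mem_span_singleton_self _) _ (by positivity)

variable [PerfectRing k 2]

theorem quotLength_hesseCubic_X_pow {l : k} (hl : l ≠ 0) (hl3 : 1 + l ^ 3 ≠ 0) (j : ℕ) :
    quotLength k (Ideal.span {hesseCubic l} ⊔ Ideal.span {X 0 ^ (4 * 2 ^ j)} ⊔
      Ideal.span {X 1 ^ (4 * 2 ^ j)} ⊔ Ideal.span {X 2 ^ (4 * 2 ^ j)}) + 1 =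
    ((36 * 2 ^ j * 2 ^ j : ℕ) : ℕ∞) := by
  have hX := isRegularMod_hesseCubic_X_zero l
  have hY := isRegularMod_hesseCubic_X_zero_X_one l
  have hc := isRegularMod_hesseCubic_X_zero_conicZ l
  have h := IsRegularMod.quotLength_add_of_mul_sub_mem (k := k)
    ((hX.sup_pow hY (4 * 2 ^ j)).pow (4 * 2 ^ j)) ((hX.sup_pow hc (4 * 2 ^ j)).pow (2 ^ j))
    (hesseCubic_relation l j)
  rw [hX.quotLength_sup_pow_sup_pow hY, hX.quotLength_sup_pow_sup_pow hc,
    quotLength_hesseCubic_X_zero_X_one, quotLength_hesseCubic_X_zero_conicZ] at h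
  have h' := quotLength_hesseCubic_sup_pow_sup_pow_sup_pow hl hl3 j
  generalize 2 ^ j = r at h h' ⊢
  refine ENat.add_left_injective_of_ne_top (ENat.natCast_ne_top (24 * r * r)) ?_
  push_cast at h h' ⊢
  calc _ = quotLength k _ + 4 * (r : ℕ∞) * r * 6 + 1 := by ring
    _ = _ + 1 + 4 * (r : ℕ∞) * (4 * r) * 3 := by rw [h]; ring
    _ = _ := by rw [h']; ring

theorem quotLength_hesseCubic_X_sq {l : k} (hl : l ≠ 0) :
    quotLength k (Ideal.span {hesseCubic l} ⊔ Ideal.span {X 0 ^ 2} ⊔ Ideal.span {X 1 ^ 2} ⊔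
      Ideal.span {X 2 ^ 2}) = 7 := by
  have hF : hesseCubic l ∉ Ideal.span {X 2 ^ 2} ⊔ Ideal.span {X 0 ^ 2} ⊔ Ideal.span {X 1 ^ 2} := by
    intro h
    obtain ⟨u, v, w, h⟩ := mem_span_sup_span_sup_span.1 h
    have h := congrArg (fun p => eval 0 (cartier p)) h
    simp only [cartier_add, mul_comm _ (X _ ^ 2), cartier_sq_mul, cartier_hesseCubic] at h
    simp [hl] at h
  have hX : ∀ i : Fin 3, hesseCubic l * X i ∈
      Ideal.span {X 2 ^ 2} ⊔ Ideal.span {X 0 ^ 2} ⊔ Ideal.span {X 1 ^ 2} := fun i => by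
    rw [mem_span_sup_span_sup_span, hesseCubic]
    match i with
    | 0 => exact ⟨X 2 * X 0, X 0 ^ 2 + C l * (X 1 * X 2), X 1 * X 0, by ring⟩
    | 1 => exact ⟨X 2 * X 1, X 0 * X 1, X 1 ^ 2 + C l * (X 0 * X 2), by ring⟩
    | 2 => exact ⟨X 2 ^ 2 + C l * (X 0 * X 1), X 0 * X 2, X 1 * X 2, by ring⟩
  have h := quotLength_eq_add_one hF hX
  rw [quotLength_span_X_sq] at h
  have hsup : Ideal.span {hesseCubic l} ⊔ Ideal.span {X 0 ^ 2} ⊔ Ideal.span {X 1 ^ 2} ⊔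
      Ideal.span {X 2 ^ 2} = Ideal.span {X 2 ^ 2} ⊔ Ideal.span {X 0 ^ 2} ⊔ Ideal.span {X 1 ^ 2} ⊔
        Ideal.span {hesseCubic l} := by
    ac_rfl
  rw [hsup]
  exact ENat.add_left_injective_of_ne_top (n := 1) (by decide) (h.symm.trans (by norm_num))

end HilbertKunz

/-- The Hilbert–Kunz function of the maximal ideal `(X,Y,Z)` of the homogeneous coordinate
ring of the smooth plane cubic `X³+Y³+Z³+λXYZ = 0` (with `λ ≠ 0`, `λ³ ≠ 1`, i.e. Hasse
invariant `1`) over an algebraically closed field of characteristic `2`: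
`φ(1) = 1`, `φ(2) = 7`, and `4·φ(q) = 9q² − 4` for `q = 2^e`, `e ≥ 2`. -/
theorem hilbert_kunz_function_hasse_one_cubic_char_two
    (k : Type*) [Field k] [IsAlgClosed k] [CharP k 2]
    (l : k) (hl : l ≠ 0) (hl3 : l ^ 3 ≠ 1) :
    Module.finrank k
        (MvPolynomial (Fin 3) k ⧸
          Ideal.span
            {(X 0 ^ 3 + X 1 ^ 3 + X 2 ^ 3 + MvPolynomial.C l * (X 0 * X 1 * X 2) :
                MvPolynomial (Fin 3) k),
              X 0, X 1, X 2}) = 1 ∧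
      Module.finrank k
          (MvPolynomial (Fin 3) k ⧸
            Ideal.span
              {(X 0 ^ 3 + X 1 ^ 3 + X 2 ^ 3 + MvPolynomial.C l * (X 0 * X 1 * X 2) :
                  MvPolynomial (Fin 3) k),
                X 0 ^ 2, X 1 ^ 2, X 2 ^ 2}) = 7 ∧
      ∀ e : ℕ, 2 ≤ e →
        (4 * Module.finrank k
            (MvPolynomial (Fin 3) k ⧸
              Ideal.span
                {(X 0 ^ 3 + X 1 ^ 3 + X 2 ^ 3 + MvPolynomial.C l * (X 0 * X 1 * X 2) :
                    MvPolynomial (Fin 3) k),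
                  X 0 ^ 2 ^ e, X 1 ^ 2 ^ e, X 2 ^ 2 ^ e}) : ℤ) =
          9 * ((2 : ℤ) ^ e) ^ 2 - 4 := by
  have : Fact (Nat.Prime 2) := ⟨Nat.prime_two⟩
  have hl3' : 1 + l ^ 3 ≠ 0 := fun h => hl3 (CharTwo.add_eq_zero.1 h).symm
  refine ⟨?_, ?_, fun e he => ?_⟩
  · rw [finrank_eq_toNat_quotLength, Ideal.span_insert, Ideal.span_insert, Ideal.span_insert,
      ← sup_assoc, ← sup_assoc]
    exact congrArg ENat.toNat (quotLength_hesseCubic_X l)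
  · rw [finrank_eq_toNat_quotLength, Ideal.span_insert, Ideal.span_insert, Ideal.span_insert,
      ← sup_assoc, ← sup_assoc]
    exact congrArg ENat.toNat (quotLength_hesseCubic_X_sq hl)
  · obtain ⟨j, rfl⟩ := Nat.exists_eq_add_of_le he
    have hq : 2 ^ (2 + j) = 4 * 2 ^ j := by rw [pow_add]; norm_num
    rw [finrank_eq_toNat_quotLength, Ideal.span_insert, Ideal.span_insert, Ideal.span_insert,
      ← sup_assoc, ← sup_assoc, hq]
    have h := quotLength_hesseCubic_X_pow hl hl3' j
    rw [hesseCubic] at h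
    generalize quotLength k (Ideal.span {(_ : MvPolynomial (Fin 3) k)} ⊔ _ ⊔ _ ⊔ _) = m at h ⊢
    have hm : m ≠ ⊤ := by
      rintro rfl
      exact ENat.natCast_ne_top _ h.symm
    lift m to ℕ using hm
    have h' : ((m + 1 : ℕ) : ℤ) = ((36 * 2 ^ j * 2 ^ j : ℕ) : ℤ) := by exact_mod_cast h
    rw [ENat.toNat_natCast, pow_add]
    push_cast at h'
    linear_combination 4 * h'
end
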